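/- arXiv:2502.11802 — 3 statements merged into one kernel-verified Lean document; each statement's English description precedes it below -/
import Mathlib

section
/- There exists a constant C > 0 such that for every r ∈ (0, 1/8) and every function u that is continuous on the closed annulus {x ∈ ℝ⁴ : r ≤ |x| ≤ 1}, harmonic on the open annulus A(r,1) = {x ∈ ℝ⁴ : r < |x| < 1}, and satisfies the boundary conditions ∫_{|x|=1} u dσ = 0 and ∫_{|x|=r} u dσ = 0, one has Λ_{A(2r,1/2)}(u) ≤ C · ‖u‖_{L²(A(r,1))}. In particular C is independent of r and of u. -/
open MeasureTheory Filter Set ENNReal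

noncomputable section

/-- A function is harmonic on an open set `U ⊆ ℝⁿ` if it is twice continuously
differentiable there and its Laplacian (the sum of second partial derivatives)
vanishes on `U`. -/
def IsHarmonicOn {n : ℕ} (u : EuclideanSpace ℝ (Fin n) → ℝ)
    (U : Set (EuclideanSpace ℝ (Fin n))) : Prop :=
  ContDiffOn ℝ 2 u U ∧
    ∀ x ∈ U,
      (∑ i : Fin n,
        fderiv ℝ (fun y => fderiv ℝ u y (EuclideanSpace.single i (1 : ℝ))) x
          (EuclideanSpace.single i (1 : ℝ))) = 0

/-- `Λ_Ω(g) = ∫₀^∞ (L {x ∈ Ω : |g x| > λ})^{1/2} dλ`, a quantity comparable to the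
Lorentz norm `‖g‖_{L^{2,1}(Ω)}`. -/
def Lam {n : ℕ} (Ω : Set (EuclideanSpace ℝ (Fin n)))
    (g : EuclideanSpace ℝ (Fin n) → ℝ) : ℝ≥0∞ :=
  ∫⁻ l in Set.Ioi (0 : ℝ), (volume {x | x ∈ Ω ∧ l < |g x|}) ^ ((1 : ℝ) / 2)

abbrev E4 := EuclideanSpace ℝ (Fin 4)

lemma cont_mul_of_supp {a b : E4 → ℝ} {U : Set E4} (hU : IsOpen U) (ha : ContinuousOn a U)
    (hb : Continuous b) (hs : tsupport b ⊆ U) : Continuous (fun y => a y * b y) := by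
  rw [continuous_iff_continuousAt]
  intro x
  by_cases hx : x ∈ U
  · exact (ha.continuousAt (hU.mem_nhds hx)).mul hb.continuousAt
  · have hx' : x ∉ tsupport b := fun h => hx (hs h)
    rw [notMem_tsupport_iff_eventuallyEq] at hx'
    have : (fun y => a y * b y) =ᶠ[nhds x] fun _ => 0 := by
      filter_upwards [hx'] with y hy
      simp [hy]
    exact continuousAt_const.congr this.symm

lemma integ_mul_of_supp {a b : E4 → ℝ} {U K : Set E4} (hU : IsOpen U) (ha : ContinuousOn a U)
    (hb : Continuous b) (hK : IsCompact K) (hKU : K ⊆ U) (hs : ∀ y, y ∉ K → b y = 0) :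
    Integrable (fun y => a y * b y) := by
  have h1 : tsupport b ⊆ K := by
    apply closure_minimal _ hK.isClosed
    intro y hy
    by_contra h
    exact hy (hs y h)
  apply (cont_mul_of_supp hU ha hb (h1.trans hKU)).integrable_of_hasCompactSupport
  apply HasCompactSupport.mul_left
  exact HasCompactSupport.intro hK (fun x hx => hs x hx)

lemma weak_harm {u φ : E4 → ℝ} {P R : Fin 4 → E4 → ℝ} {U K : Set E4} (hU : IsOpen U)
    (hu : IsHarmonicOn u U) (hK : IsCompact K) (hKU : K ⊆ U)
    (hφ : Differentiable ℝ φ) (hP : ∀ i, Differentiable ℝ (P i))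
    (hφP : ∀ i y, fderiv ℝ φ y (EuclideanSpace.single i (1:ℝ)) = P i y)
    (hPR : ∀ i y, fderiv ℝ (P i) y (EuclideanSpace.single i (1:ℝ)) = R i y)
    (hR : ∀ i, Continuous (R i))
    (sφ : ∀ y, y ∉ K → φ y = 0) (sP : ∀ i y, y ∉ K → P i y = 0)
    (sR : ∀ i y, y ∉ K → R i y = 0) :
    ∫ y, u y * ∑ i, R i y = 0 := by
  obtain ⟨hc, hl⟩ := hu
  have ts : ∀ b : E4 → ℝ, (∀ y, y ∉ K → b y = 0) → tsupport b ⊆ U := by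
    intro b hb
    refine Subset.trans (closure_minimal ?_ hK.isClosed) hKU
    intro y hy
    by_contra h
    exact hy (hb y h)
  have hdu : ∀ y ∈ U, DifferentiableAt ℝ u y := fun y hy =>
    (hc.contDiffAt (hU.mem_nhds hy)).differentiableAt (by norm_num)
  have hc1 : ContDiffOn ℝ 1 (fderiv ℝ u) U := hc.fderiv_of_isOpen hU (by norm_num)
  have hc1i : ∀ i : Fin 4, ContDiffOn ℝ 1
      (fun y => fderiv ℝ u y (EuclideanSpace.single i (1:ℝ))) U := fun i =>
    hc1.clm_apply contDiffOn_const
  have hdi : ∀ i : Fin 4, ∀ y ∈ U, DifferentiableAt ℝ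
      (fun y => fderiv ℝ u y (EuclideanSpace.single i (1:ℝ))) y := fun i y hy =>
    ((hc1i i).contDiffAt (hU.mem_nhds hy)).differentiableAt (by norm_num)
  have hc2i : ∀ i : Fin 4, ContinuousOn (fun z => fderiv ℝ
      (fun y => fderiv ℝ u y (EuclideanSpace.single i (1:ℝ))) z (EuclideanSpace.single i (1:ℝ))) U :=
    fun i => ((hc1i i).continuousOn_fderiv_of_isOpen hU (by norm_num)).clm_apply continuousOn_const
  have key : ∀ i : Fin 4, ∫ y, u y * R i y = ∫ y, fderiv ℝ
      (fun y => fderiv ℝ u y (EuclideanSpace.single i (1:ℝ))) y (EuclideanSpace.single i (1:ℝ))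
        * φ y := by
    intro i
    have e1 := integral_mul_fderiv_eq_neg_fderiv_mul_of_integrable (μ := (volume : Measure E4))
      (f := u) (g := P i) (v := EuclideanSpace.single i (1:ℝ))
      (integ_mul_of_supp hU (hc1i i).continuousOn (hP i).continuous hK hKU (sP i))
      (by simp_rw [hPR]; exact integ_mul_of_supp hU hc.continuousOn (hR i) hK hKU (sR i))
      (integ_mul_of_supp hU hc.continuousOn (hP i).continuous hK hKU (sP i))
      (fun x hx => hdu x (ts _ (sP i) hx)) (fun x _ => hP i x)
    have hPc : Continuous fun x => fderiv ℝ φ x (EuclideanSpace.single i (1:ℝ)) := by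
      simp_rw [hφP]; exact (hP i).continuous
    have e2 := integral_mul_fderiv_eq_neg_fderiv_mul_of_integrable (μ := (volume : Measure E4))
      (f := fun y => fderiv ℝ u y (EuclideanSpace.single i (1:ℝ))) (g := φ)
      (v := EuclideanSpace.single i (1:ℝ))
      (integ_mul_of_supp hU (hc2i i) hφ.continuous hK hKU sφ)
      (by simp_rw [hφP]; exact integ_mul_of_supp hU (hc1i i).continuousOn (hP i).continuous hK hKU (sP i))
      (integ_mul_of_supp hU (hc1i i).continuousOn hφ.continuous hK hKU sφ)
      (fun x hx => hdi i x (ts _ sφ hx)) (fun x _ => hφ x)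
    simp_rw [hPR] at e1
    simp_rw [hφP] at e2
    rw [e1, e2, neg_neg]
  simp_rw [Finset.mul_sum]
  rw [integral_finsetSum _ (fun i _ => integ_mul_of_supp hU hc.continuousOn (hR i) hK hKU (sR i))]
  simp_rw [key]
  rw [← integral_finsetSum _ (fun i _ => integ_mul_of_supp hU (hc2i i) hφ.continuous hK hKU sφ)]
  apply integral_eq_zero_of_ae
  apply Eventually.of_forall
  intro y
  simp only [Pi.zero_apply]
  rw [← Finset.sum_mul]
  by_cases hy : y ∈ K
  · rw [hl y (hKU hy), zero_mul]
  · rw [sφ y hy, mul_zero]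

lemma radial_hasFDerivAt {f : ℝ → ℝ} {a : ℝ} (x y : E4) (h : HasDerivAt f a (‖y - x‖ ^ 2)) :
    HasFDerivAt (fun y : E4 => f (‖y - x‖ ^ 2)) (a • (2 • innerSL ℝ (y - x))) y := by
  have h1 : HasFDerivAt (fun y : E4 => ‖y - x‖ ^ 2) (2 • innerSL ℝ (y - x)) y := by
    have := ((hasFDerivAt_id y).sub_const x).norm_sq
    simpa using this
  exact h.comp_hasFDerivAt y h1

lemma inner_e (x : E4) (i : Fin 4) : inner ℝ x (EuclideanSpace.single i (1:ℝ)) = x i := by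
  simp [EuclideanSpace.inner_single_right]

lemma sum_sq (x : E4) : ∑ i, x i * x i = ‖x‖ ^ 2 := by
  rw [EuclideanSpace.norm_sq_eq]; simp [sq]

lemma sum_inner4 (x y : E4) : ∑ i, x i * y i = inner ℝ x y := by
  rw [PiLp.inner_apply]; simp [mul_comm]

lemma coord_hasFDerivAt (x y : E4) (i : Fin 4) :
    HasFDerivAt (fun y : E4 => (y i - x i)) (EuclideanSpace.proj i : E4 →L[ℝ] ℝ) y := by
  exact (EuclideanSpace.proj i : E4 →L[ℝ] ℝ).hasFDerivAt.sub_const _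

/-- explicit weak formulation -/
lemma weak_explicit {u : E4 → ℝ} {r : ℝ} (hr : 0 < r)
    (hu : IsHarmonicOn u {x | r < ‖x‖ ∧ ‖x‖ < 1})
    {f f' f'' g g' g'' : ℝ → ℝ} {a b : ℝ} (ha : r ^ 2 < a) (hb : b < 1)
    (hf : ∀ t, HasDerivAt f (f' t) t) (hf' : ∀ t, HasDerivAt f' (f'' t) t) (cf : Continuous f'')
    (sf : ∀ t, t ∉ Icc a b → f t = 0) (sf' : ∀ t, t ∉ Icc a b → f' t = 0)
    (sf'' : ∀ t, t ∉ Icc a b → f'' t = 0)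
    (hg : ∀ t, 0 ≤ t → HasDerivAt g (g' t) t) (hg' : ∀ t, 0 ≤ t → HasDerivAt g' (g'' t) t)
    (cg : ContinuousOn g'' (Ici 0)) (x : E4) :
    ∫ y, u y * (f (‖y‖ ^ 2) * (8 * g' (‖y - x‖ ^ 2) + 4 * ‖y - x‖ ^ 2 * g'' (‖y - x‖ ^ 2))
      + 8 * inner ℝ y (y - x) * f' (‖y‖ ^ 2) * g' (‖y - x‖ ^ 2)
      + g (‖y - x‖ ^ 2) * (8 * f' (‖y‖ ^ 2) + 4 * ‖y‖ ^ 2 * f'' (‖y‖ ^ 2))) = 0 := by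
  have hU : IsOpen {x : E4 | r < ‖x‖ ∧ ‖x‖ < 1} :=
    (isOpen_lt continuous_const continuous_norm).inter (isOpen_lt continuous_norm continuous_const)
  have hK : IsCompact {y : E4 | ‖y‖ ^ 2 ∈ Icc a b} := by
    apply Metric.isCompact_of_isClosed_isBounded
    · exact isClosed_Icc.preimage (by fun_prop)
    · apply (Metric.isBounded_closedBall (x := (0:E4)) (r := 1)).subset
      intro y hy
      simp only [Metric.mem_closedBall, dist_zero_right]
      have : ‖y‖ ^ 2 ≤ 1 := hy.2.trans hb.le
      nlinarith [norm_nonneg y]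
  have hKU : {y : E4 | ‖y‖ ^ 2 ∈ Icc a b} ⊆ {x : E4 | r < ‖x‖ ∧ ‖x‖ < 1} := by
    intro y hy
    have h1 := hy.1
    have h2 := hy.2
    constructor
    · exact lt_of_pow_lt_pow_left₀ 2 (norm_nonneg y) (by linarith)
    · exact lt_of_pow_lt_pow_left₀ 2 (by norm_num) (by linarith)
  -- derivatives
  have F0 : ∀ y : E4, HasFDerivAt (fun y : E4 => f (‖y‖ ^ 2))
      (f' (‖y‖ ^ 2) • (2 • innerSL ℝ y)) y := fun y => by
    simpa using radial_hasFDerivAt (f := f) 0 y (hf _)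
  have F1 : ∀ y : E4, HasFDerivAt (fun y : E4 => f' (‖y‖ ^ 2))
      (f'' (‖y‖ ^ 2) • (2 • innerSL ℝ y)) y := fun y => by
    simpa using radial_hasFDerivAt (f := f') 0 y (hf' _)
  have G0 : ∀ y : E4, HasFDerivAt (fun y : E4 => g (‖y - x‖ ^ 2))
      (g' (‖y - x‖ ^ 2) • (2 • innerSL ℝ (y - x))) y := fun y =>
    radial_hasFDerivAt x y (hg _ (by positivity))
  have G1 : ∀ y : E4, HasFDerivAt (fun y : E4 => g' (‖y - x‖ ^ 2))
      (g'' (‖y - x‖ ^ 2) • (2 • innerSL ℝ (y - x))) y := fun y =>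
    radial_hasFDerivAt x y (hg' _ (by positivity))
  have C0 : ∀ (i : Fin 4) (y : E4), HasFDerivAt (fun y : E4 => y i)
      (EuclideanSpace.proj i : E4 →L[ℝ] ℝ) y := fun i y => by
    simpa using coord_hasFDerivAt 0 y i
  have C1 := fun (i : Fin 4) (y : E4) => coord_hasFDerivAt x y i
  have cF0 : Continuous (fun y : E4 => f (‖y‖ ^ 2)) :=
    continuous_iff_continuousAt.2 fun y => (F0 y).continuousAt
  have cF1 : Continuous (fun y : E4 => f' (‖y‖ ^ 2)) :=
    continuous_iff_continuousAt.2 fun y => (F1 y).continuousAt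
  have cF2 : Continuous (fun y : E4 => f'' (‖y‖ ^ 2)) := cf.comp (by fun_prop)
  have cG0 : Continuous (fun y : E4 => g (‖y - x‖ ^ 2)) :=
    continuous_iff_continuousAt.2 fun y => (G0 y).continuousAt
  have cG1 : Continuous (fun y : E4 => g' (‖y - x‖ ^ 2)) :=
    continuous_iff_continuousAt.2 fun y => (G1 y).continuousAt
  have cG2 : Continuous (fun y : E4 => g'' (‖y - x‖ ^ 2)) :=
    cg.comp_continuous (by fun_prop) (fun y => by simp only [mem_Ici]; positivity)
  let φ : E4 → ℝ := fun y => f (‖y‖ ^ 2) * g (‖y - x‖ ^ 2)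
  let P : Fin 4 → E4 → ℝ := fun i y =>
    f' (‖y‖ ^ 2) * (2 * y i) * g (‖y - x‖ ^ 2) + f (‖y‖ ^ 2) * (g' (‖y - x‖ ^ 2) * (2 * (y i - x i)))
  let R : Fin 4 → E4 → ℝ := fun i y =>
    f'' (‖y‖ ^ 2) * (2 * y i) * (2 * y i) * g (‖y - x‖ ^ 2) + f' (‖y‖ ^ 2) * 2 * g (‖y - x‖ ^ 2)
     + 2 * (f' (‖y‖ ^ 2) * (2 * y i) * (g' (‖y - x‖ ^ 2) * (2 * (y i - x i))))
     + f (‖y‖ ^ 2) * (g'' (‖y - x‖ ^ 2) * (2 * (y i - x i)) * (2 * (y i - x i)))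
     + f (‖y‖ ^ 2) * (g' (‖y - x‖ ^ 2) * 2)
  have hφd := fun y => (F0 y).mul (G0 y)
  have hPd := fun i y => (((F1 y).mul ((C0 i y).const_mul 2)).mul (G0 y)).add
    ((F0 y).mul ((G1 y).mul ((C1 i y).const_mul 2)))
  have key := weak_harm (φ := φ) (P := P) (R := R) hU hu hK hKU
    (fun y => (hφd y).differentiableAt) (fun i y => (hPd i y).differentiableAt)
    (fun i y => by
      refine (congrArg (fun L : E4 →L[ℝ] ℝ => L (EuclideanSpace.single i 1)) (hφd y).fderiv).trans ?_
      simp [P, inner_e]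
      ring)
    (fun i y => by
      refine (congrArg (fun L : E4 →L[ℝ] ℝ => L (EuclideanSpace.single i 1)) (hPd i y).fderiv).trans ?_
      simp [R, inner_e]
      ring)
    (fun i => by
      have c1 : Continuous fun y : E4 => 2 * y i := by fun_prop
      have c2 : Continuous fun y : E4 => 2 * (y i - x i) := by fun_prop
      exact ((((((cF2.mul c1).mul c1).mul cG0).add ((cF1.mul continuous_const).mul cG0)).add
        (continuous_const.mul ((cF1.mul c1).mul (cG1.mul c2)))).add
        (cF0.mul ((cG2.mul c2).mul c2))).add (cF0.mul (cG1.mul continuous_const)))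
    (fun y hy => by simp [φ, sf _ hy])
    (fun i y hy => by simp [P, sf _ hy, sf' _ hy])
    (fun i y hy => by simp [R, sf _ hy, sf' _ hy, sf'' _ hy])
  rw [← key]
  congr 1
  ext y
  congr 1
  have s1 := sum_sq y
  have s2 := sum_sq (y - x)
  have s3 := sum_inner4 y (y - x)
  rw [← s3]
  simp only [R]
  rw [← s1, ← s2]
  simp only [Fin.sum_univ_four, PiLp.sub_apply]
  ring


lemma contDiff_insert (i : Fin 4) (s : ℝ) :
    ContDiff ℝ 1 (fun y : Fin 3 → ℝ => (WithLp.toLp 2 (i.insertNth (α := fun _ => ℝ) s y) : E4)) := by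
  rw [contDiff_euclidean]
  intro j
  rcases Fin.eq_self_or_eq_succAbove i j with h | ⟨k, h⟩
  · subst h
    simp only [Fin.insertNth_apply_same]
    exact contDiff_const
  · subst h
    simp only [Fin.insertNth_apply_succAbove]
    exact contDiff_apply ℝ ℝ k

lemma haus_sphere_lt_top : (μH[(3:ℝ)] : Measure E4) (Metric.sphere 0 1) < ⊤ := by
  let z : Fin 4 → ℝ → (Fin 3 → ℝ) → E4 := fun i s y => WithLp.toLp 2 (i.insertNth (α := fun _ => ℝ) s y)
  let G : Fin 4 → ℝ → (Fin 3 → ℝ) → E4 := fun i s y => ‖z i s y‖⁻¹ • z i s y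
  have hz : ∀ i s y, s ≠ 0 → z i s y ≠ 0 := by
    intro i s y hs h
    apply hs
    have := congrArg (fun w : E4 => w i) h
    simpa [z] using this
  have hG : ∀ i s, s ≠ 0 → (μH[(3:ℝ)] : Measure E4) (G i s '' Metric.closedBall 0 1) < ⊤ := by
    intro i s hs
    have hc : ContDiff ℝ 1 (G i s) := by
      have h1 : ContDiff ℝ 1 (z i s) := contDiff_insert i s
      exact ((h1.norm ℝ (fun y => hz i s y hs)).inv (fun y => norm_ne_zero_iff.2 (hz i s y hs))).smul h1
    obtain ⟨C, hC⟩ := hc.contDiffOn.exists_lipschitzOnWith (s := Metric.closedBall (0 : Fin 3 → ℝ) 1)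
      one_ne_zero (convex_closedBall _ _) (isCompact_closedBall _ _)
    have h2 := hC.hausdorffMeasure_image_le (d := 3) (by norm_num)
    refine h2.trans_lt ?_
    have h3 : (μH[(3:ℝ)] : Measure (Fin 3 → ℝ)) = volume := by
      have := hausdorffMeasure_pi_real (ι := Fin 3)
      simpa using this
    rw [h3]
    exact ENNReal.mul_lt_top (by simp) (isCompact_closedBall _ _).measure_lt_top
  have hsub : Metric.sphere (0:E4) 1 ⊆ ⋃ i : Fin 4, (G i 1 '' Metric.closedBall 0 1 ∪ G i (-1) '' Metric.closedBall 0 1) := by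
    intro x hx
    have hx1 : ‖x‖ = 1 := by simpa using hx
    obtain ⟨i, -, hi⟩ := Finset.exists_max_image (Finset.univ : Finset (Fin 4)) (fun i => |x i|) ⟨0, by simp⟩
    have hi0 : x i ≠ 0 := by
      intro h0
      have : x = 0 := by
        ext j
        have := hi j (by simp)
        simpa [h0] using this
      rw [this] at hx1; simp at hx1
    have hpos : 0 < |x i| := abs_pos.2 hi0
    let y : Fin 3 → ℝ := fun k => x (i.succAbove k) / |x i|
    have hy : y ∈ Metric.closedBall (0 : Fin 3 → ℝ) 1 := by
      simp only [Metric.mem_closedBall, dist_zero_right]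
      rw [pi_norm_le_iff_of_nonneg (by norm_num)]
      intro k
      simp only [y, Real.norm_eq_abs, abs_div, abs_abs]
      rw [div_le_one hpos]
      exact hi _ (by simp)
    have hzz : z i (x i / |x i|) y = |x i|⁻¹ • x := by
      ext j
      rcases Fin.eq_self_or_eq_succAbove i j with h | ⟨k, h⟩
      · subst h; simp [z]; ring
      · subst h; simp [z, y]; ring
    have hGG : G i (x i / |x i|) y = x := by
      simp only [G]
      rw [hzz, norm_smul, hx1, smul_smul]
      simp [abs_abs, hpos.ne']
    rw [mem_iUnion]
    refine ⟨i, ?_⟩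
    rcases lt_or_gt_of_ne hi0 with h | h
    · right
      refine ⟨y, hy, ?_⟩
      rw [← hGG]; congr 1
      rw [abs_of_neg h]; field_simp
    · left
      refine ⟨y, hy, ?_⟩
      rw [← hGG]; congr 1
      rw [abs_of_pos h]; field_simp
  refine (measure_mono hsub).trans_lt ?_
  refine (measure_iUnion_le _).trans_lt ?_
  rw [tsum_fintype]
  rw [ENNReal.sum_lt_top]
  intro i _
  exact (measure_union_le _ _).trans_lt (ENNReal.add_lt_top.2 ⟨hG i 1 (by norm_num), hG i (-1) (by norm_num)⟩)

lemma haus_sphere_ne_zero : (μH[(3:ℝ)] : Measure E4) (Metric.sphere 0 1) ≠ 0 := by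
  let p : E4 → (Fin 3 → ℝ) := fun x j => x j.castSucc
  have hp : LipschitzWith 1 p := by
    apply LipschitzWith.of_dist_le_mul
    intro x y
    rw [dist_pi_le_iff (by positivity)]
    intro j
    simp only [p, NNReal.coe_one, one_mul]
    rw [dist_eq_norm, dist_eq_norm]
    exact PiLp.norm_apply_le (x - y) j.castSucc
  have h1 := hp.hausdorffMeasure_image_le (d := 3) (by norm_num) (Metric.sphere 0 1)
  have h3 : (μH[(3:ℝ)] : Measure (Fin 3 → ℝ)) = volume := by
    have := hausdorffMeasure_pi_real (ι := Fin 3)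
    simpa using this
  rw [h3] at h1
  have hsub : Metric.ball (0 : Fin 3 → ℝ) (1/2) ⊆ p '' Metric.sphere 0 1 := by
    intro y hy
    have hy' : ∀ j, |y j| ≤ 1/2 := fun j => by
      have h := norm_le_pi_norm y j
      rw [mem_ball_zero_iff] at hy
      rw [Real.norm_eq_abs] at h
      linarith
    have hsq : ∀ j, y j ^ 2 ≤ 1/4 := fun j => by
      have := hy' j
      rw [← sq_abs]; nlinarith [abs_nonneg (y j)]
    have h0 : 0 ≤ 1 - (y 0 ^ 2 + y 1 ^ 2 + y 2 ^ 2) := by linarith [hsq 0, hsq 1, hsq 2]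
    refine ⟨!₂[y 0, y 1, y 2, √(1 - (y 0 ^ 2 + y 1 ^ 2 + y 2 ^ 2))], ?_, ?_⟩
    · simp only [mem_sphere_zero_iff_norm]
      rw [EuclideanSpace.norm_eq, Fin.sum_univ_four]
      simp [Real.sq_sqrt h0]
    · ext j
      fin_cases j <;> simp [p]
  intro h
  rw [h] at h1
  have h4 : volume (Metric.ball (0 : Fin 3 → ℝ) (1/2)) = 0 :=
    measure_mono_null hsub (by simpa using h1)
  exact (Metric.measure_ball_pos volume (0 : Fin 3 → ℝ) (by norm_num : (0:ℝ) < 1/2)).ne' h4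

def sig : Measure E4 := (μH[(3:ℝ)] : Measure E4).restrict (Metric.sphere 0 1)

instance : IsFiniteMeasure sig := ⟨by simpa [sig] using haus_sphere_lt_top⟩

lemma sig_univ_pos : 0 < sig.real univ := by
  rw [Measure.real, ENNReal.toReal_pos_iff]
  constructor
  · simpa [sig, pos_iff_ne_zero] using haus_sphere_ne_zero
  · exact measure_lt_top _ _

lemma sig_ae : ∀ᵐ θ ∂sig, ‖θ‖ = 1 := by
  have : ∀ᵐ θ ∂sig, θ ∈ Metric.sphere (0:E4) 1 :=
    ae_restrict_mem Metric.isClosed_sphere.measurableSet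
  filter_upwards [this] with θ h
  simpa using h

open Quaternion in
def qq : ℍ ≃ₗᵢ[ℝ] E4 := linearIsometryEquivTuple

def qm (a b : E4) : E4 := qq (qq.symm a * qq.symm b)

lemma norm_qm (a b : E4) : ‖qm a b‖ = ‖a‖ * ‖b‖ := by
  simp [qm]

lemma continuous_qm : Continuous (fun p : E4 × E4 => qm p.1 p.2) := by
  unfold qm
  have h := qq.continuous
  have h' := qq.symm.continuous
  exact h.comp ((h'.comp continuous_fst).mul (h'.comp continuous_snd))

lemma qm_smul_left (t : ℝ) (b c : E4) : qm b (t • c) = t • qm b c := by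
  simp [qm]

def qL (a : E4) (ha : ‖a‖ = 1) : E4 ≃ₗᵢ[ℝ] E4 :=
  LinearIsometry.toLinearIsometryEquiv
    (⟨{ toFun := fun b => qm a b
        map_add' := fun b c => by simp [qm, mul_add]
        map_smul' := fun t c => by simp [qm] }, fun b => (norm_qm a b).trans (by rw [ha, one_mul])⟩ : E4 →ₗᵢ[ℝ] E4) rfl

def qR (a : E4) (ha : ‖a‖ = 1) : E4 ≃ₗᵢ[ℝ] E4 :=
  LinearIsometry.toLinearIsometryEquiv
    (⟨{ toFun := fun b => qm b a
        map_add' := fun b c => by simp [qm, add_mul]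
        map_smul' := fun t c => by simp [qm] }, fun b => (norm_qm b a).trans (by rw [ha, mul_one])⟩ : E4 →ₗᵢ[ℝ] E4) rfl

lemma qL_apply (a b : E4) (ha : ‖a‖ = 1) : qL a ha b = qm a b := rfl
lemma qR_apply (a b : E4) (ha : ‖a‖ = 1) : qR a ha b = qm b a := rfl

lemma qR_mp (a : E4) (ha : ‖a‖ = 1) : MeasurePreserving (qR a ha) sig sig := by
  have h1 := (qR a ha).toIsometryEquiv.measurePreserving_hausdorffMeasure 3
  have h2 := h1.restrict_preimage (s := Metric.sphere (0:E4) 1) Metric.isClosed_sphere.measurableSet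
  have h3 : (qR a ha).toIsometryEquiv ⁻¹' Metric.sphere (0:E4) 1 = Metric.sphere 0 1 := by
    ext x; simp
  rw [h3] at h2
  exact h2

def mm (v : E4 → ℝ) (ρ : ℝ) : ℝ := ∫ θ, v (ρ • θ) ∂sig

lemma mm_eq {v : E4 → ℝ} (y : E4) : ∫ θ, v (qm θ y) ∂sig = mm v ‖y‖ := by
  by_cases hy : y = 0
  · subst hy
    simp [mm, qm]
  · have hn : ‖y‖ ≠ 0 := norm_ne_zero_iff.2 hy
    let a : E4 := ‖y‖⁻¹ • y
    have ha : ‖a‖ = 1 := by simp [a, norm_smul, hn]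
    have h := (qR_mp a ha).integral_comp (qR a ha).toHomeomorph.measurableEmbedding (fun θ => v (‖y‖ • θ))
    rw [mm, ← h]
    congr 1
    ext θ
    rw [qR_apply, ← qm_smul_left]
    simp [a, smul_smul, hn]

lemma avg_formula {v : E4 → ℝ} (hv : Continuous v) {F : ℝ → ℝ} (hF : Continuous F)
    (sF : ∀ t, 1 < t → F t = 0) :
    sig.real univ * ∫ y, v y * F (‖y‖ ^ 2) = ∫ y : E4, mm v ‖y‖ * F (‖y‖ ^ 2) := by
  have hcF : Continuous fun y : E4 => F (‖y‖ ^ 2) := by fun_prop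
  have hFi : Integrable fun y : E4 => F (‖y‖ ^ 2) := by
    apply hcF.integrable_of_hasCompactSupport
    apply HasCompactSupport.intro (isCompact_closedBall (0:E4) 1)
    intro x hx
    apply sF
    simp only [Metric.mem_closedBall, dist_zero_right, not_le] at hx
    nlinarith
  have h1 : ∀ θ : E4, ‖θ‖ = 1 → ∫ y, v (qm θ y) * F (‖y‖ ^ 2) = ∫ y, v y * F (‖y‖ ^ 2) := by
    intro θ hθ
    have h := (qL θ hθ).measurePreserving.integral_comp (qL θ hθ).toHomeomorph.measurableEmbedding
      (fun y => v y * F (‖y‖ ^ 2))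
    rw [← h]
    congr 1
    ext y
    rw [LinearIsometryEquiv.norm_map]; rfl
  obtain ⟨B, hB⟩ := (isCompact_closedBall (0:E4) 1).exists_bound_of_continuousOn hv.continuousOn
  have hint : Integrable (Function.uncurry fun (θ y : E4) => v (qm θ y) * F (‖y‖ ^ 2))
      (sig.prod volume) := by
    have hd : Integrable (fun p : E4 × E4 => B * F (‖p.2‖ ^ 2)) (sig.prod volume) :=
      (hFi.const_mul B).comp_snd sig
    apply hd.mono
    · apply Continuous.aestronglyMeasurable
      exact (hv.comp continuous_qm).mul (hcF.comp continuous_snd)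
    · have : ∀ᵐ p ∂(sig.prod (volume : Measure E4)), ‖p.1‖ = 1 :=
        Measure.quasiMeasurePreserving_fst.ae sig_ae
      filter_upwards [this] with p hp
      simp only [Function.uncurry, norm_mul]
      by_cases hy : ‖p.2‖ ≤ 1
      · gcongr
        refine (hB _ ?_).trans (le_abs_self _)
        simp [norm_qm, hp, hy]
      · rw [sF _ (by nlinarith [norm_nonneg p.2])]; simp
  have h2 := integral_integral_swap hint
  have h3 : ∫ θ, (∫ y, v (qm θ y) * F (‖y‖ ^ 2)) ∂sig = ∫ θ, (∫ y, v y * F (‖y‖ ^ 2)) ∂sig := by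
    apply integral_congr_ae
    filter_upwards [sig_ae] with θ hθ using h1 θ hθ
  rw [h3, integral_const, smul_eq_mul] at h2
  rw [h2]
  congr 1
  ext y
  rw [integral_mul_const, mm_eq]

lemma mm_continuous {v : E4 → ℝ} (hv : Continuous v) : Continuous (mm v) := by
  unfold mm sig
  have := continuous_parametric_integral_of_continuous (μ := sig)
    (f := fun (ρ : ℝ) (θ : E4) => v (ρ • θ)) (by fun_prop) (isCompact_sphere (0:E4) 1)
  simpa [sig, Measure.restrict_restrict Metric.isClosed_sphere.measurableSet] using this

lemma mm_eq_sphere {v : E4 → ℝ} {ρ : ℝ} (hρ : 0 < ρ)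
    (h : ∫ x in Metric.sphere (0 : E4) ρ, v x ∂(μH[(3 : ℝ)]) = 0) : mm v ρ = 0 := by
  have hemb : MeasurableEmbedding (fun x : E4 => ρ • x) :=
    (Homeomorph.smulOfNeZero ρ hρ.ne').measurableEmbedding
  have hmap : Measure.map (fun x : E4 => ρ • x) sig
      = (‖ρ⁻¹‖₊ ^ (3:ℝ)) • (μH[(3:ℝ)] : Measure E4).restrict (Metric.sphere 0 ρ) := by
    ext s hs
    rw [hemb.map_apply, sig, Measure.restrict_apply (hemb.measurable hs), Measure.smul_apply,
      Measure.restrict_apply hs, ← Measure.hausdorffMeasure_smul₀ (by norm_num) (inv_ne_zero hρ.ne')]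
    congr 1
    ext x
    rw [Set.mem_smul_set_iff_inv_smul_mem₀ (inv_ne_zero hρ.ne')]
    simp only [inv_inv, mem_inter_iff, mem_preimage, mem_sphere_zero_iff_norm, norm_smul,
      Real.norm_eq_abs, abs_of_pos hρ]
    refine and_congr_right fun _ => ?_
    constructor
    · intro h; rw [h, mul_one]
    · intro h; exact mul_left_cancel₀ hρ.ne' (by rw [h, mul_one])
  have h1 : mm v ρ = ∫ x, v x ∂(Measure.map (fun x : E4 => ρ • x) sig) := by
    rw [hemb.integral_map]; rfl
  rw [h1, hmap, integral_smul_nnreal_measure, h, smul_zero]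


lemma exists_S : ∃ (s s' s'' : ℝ → ℝ) (A : ℝ), 0 < A ∧ (∀ t, HasDerivAt s (s' t) t) ∧
    (∀ t, HasDerivAt s' (s'' t) t) ∧ Continuous s'' ∧ (∀ t, t ≤ 0 → s t = 0) ∧
    (∀ t, 1 ≤ t → s t = 1) ∧ (∀ t, t ∉ Icc (0:ℝ) 1 → s' t = 0) ∧
    (∀ t, t ∉ Icc (0:ℝ) 1 → s'' t = 0) ∧ (∀ t, |s' t| ≤ A) ∧ (∀ t, |s'' t| ≤ A) ∧
    (∀ t, 0 ≤ s t) ∧ (∀ t, s t ≤ 1) := by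
  have hS : ContDiff ℝ 2 Real.smoothTransition := Real.smoothTransition.contDiff
  have hS1 : ContDiff ℝ 1 (deriv Real.smoothTransition) := by
    have : ContDiff ℝ (1+1) Real.smoothTransition := by simpa [one_add_one_eq_two] using hS
    exact (contDiff_succ_iff_deriv.1 this).2.2
  have hS2 : Continuous (deriv (deriv Real.smoothTransition)) := hS1.continuous_deriv (by norm_num)
  have z1 : ∀ t, t ∉ Icc (0:ℝ) 1 → deriv Real.smoothTransition t = 0 := by
    intro t ht
    rw [mem_Icc, not_and_or, not_le, not_le] at ht
    rcases ht with h | h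
    · have : Real.smoothTransition =ᶠ[nhds t] fun _ => 0 := by
        filter_upwards [gt_mem_nhds h] with x hx
        exact Real.smoothTransition.zero_of_nonpos hx.le
      rw [this.deriv_eq]; simp
    · have : Real.smoothTransition =ᶠ[nhds t] fun _ => 1 := by
        filter_upwards [lt_mem_nhds h] with x hx
        exact Real.smoothTransition.one_of_one_le hx.le
      rw [this.deriv_eq]; simp
  have z2 : ∀ t, t ∉ Icc (0:ℝ) 1 → deriv (deriv Real.smoothTransition) t = 0 := by
    intro t ht
    have : deriv Real.smoothTransition =ᶠ[nhds t] fun _ => 0 := by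
      filter_upwards [isClosed_Icc.isOpen_compl.mem_nhds ht] with x hx
      exact z1 x hx
    rw [this.deriv_eq]; simp
  obtain ⟨A1, h1⟩ := (isCompact_Icc (a := (0:ℝ)) (b := 1)).exists_bound_of_continuousOn
    hS1.continuous.continuousOn
  obtain ⟨A2, h2⟩ := (isCompact_Icc (a := (0:ℝ)) (b := 1)).exists_bound_of_continuousOn
    hS2.continuousOn
  refine ⟨Real.smoothTransition, _, _, max 1 (max A1 A2), by positivity,
    fun t => (hS.differentiable (by norm_num) t).hasDerivAt,
    fun t => (hS1.differentiable (by norm_num) t).hasDerivAt, hS2,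
    fun t => Real.smoothTransition.zero_of_nonpos, fun t => Real.smoothTransition.one_of_one_le,
    z1, z2, ?_, ?_, Real.smoothTransition.nonneg, Real.smoothTransition.le_one⟩
  · intro t
    by_cases ht : t ∈ Icc (0:ℝ) 1
    · exact (h1 t ht).trans ((le_max_left _ _).trans (le_max_right _ _))
    · rw [z1 t ht]; simp
  · intro t
    by_cases ht : t ∈ Icc (0:ℝ) 1
    · exact (h2 t ht).trans ((le_max_right _ _).trans (le_max_right _ _))
    · rw [z2 t ht]; simp

lemma k_weak {u : E4 → ℝ} {r : ℝ} (hr : 0 < r)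
    (hu : IsHarmonicOn u {x | r < ‖x‖ ∧ ‖x‖ < 1})
    {k k' : ℝ → ℝ} {a b : ℝ} (ha : r ^ 2 < a) (hab : a ≤ b) (hb : b < 1)
    (hk : ∀ t, HasDerivAt k (k' t) t) (ck : Continuous k')
    (sk : ∀ t, t ∉ Icc a b → k t = 0) (sk' : ∀ t, t ∉ Icc a b → k' t = 0)
    (hint : ∫ t in a..b, k t = 0) :
    ∫ y, u y * (8 * k (‖y‖ ^ 2) + 4 * ‖y‖ ^ 2 * k' (‖y‖ ^ 2)) = 0 := by
  have cont : Continuous k := continuous_iff_continuousAt.2 fun t => (hk t).continuousAt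
  have hf : ∀ t, HasDerivAt (fun t => ∫ s in a..t, k s) (k t) t := fun t =>
    intervalIntegral.integral_hasDerivAt_right (cont.intervalIntegrable _ _)
      (cont.stronglyMeasurableAtFilter _ _) cont.continuousAt
  have h := weak_explicit hr hu (f := fun t => ∫ s in a..t, k s) (f' := k) (f'' := k')
    (g := fun _ => 1) (g' := fun _ => 0) (g'' := fun _ => 0) ha hb hf hk ck ?_ sk sk'
    (fun t _ => hasDerivAt_const _ _) (fun t _ => hasDerivAt_const _ _) continuousOn_const 0
  · simpa using h
  · intro t ht
    rw [mem_Icc, not_and_or, not_le, not_le] at ht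
    rcases ht with h | h
    · rw [intervalIntegral.integral_symm, neg_eq_zero]
      rw [intervalIntegral.integral_of_le h.le, integral_Ioc_eq_integral_Ioo]
      apply setIntegral_eq_zero_of_forall_eq_zero
      intro x hx
      exact sk x (fun h' => by linarith [h'.1, hx.2])
    · rw [← intervalIntegral.integral_add_adjacent_intervals (b := b)
        (cont.intervalIntegrable _ _) (cont.intervalIntegrable _ _), hint, zero_add]
      rw [intervalIntegral.integral_of_le h.le]
      apply setIntegral_eq_zero_of_forall_eq_zero
      intro x hx
      exact sk x (fun h' => by linarith [h'.2, hx.1])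

def V4 : ℝ := volume.real (Metric.ball (0:E4) 1)

lemma V4_pos : 0 < V4 := by
  rw [V4, Measure.real, ENNReal.toReal_pos_iff]
  exact ⟨Metric.measure_ball_pos _ _ (by norm_num), measure_ball_lt_top⟩

lemma ball_vol (R : ℝ) (hR : 0 ≤ R) : volume (Metric.ball (0:E4) R) = ENNReal.ofReal (R ^ 4 * V4) := by
  rw [Measure.addHaar_ball volume (0:E4) hR, ENNReal.ofReal_mul (by positivity), V4,
    ofReal_measureReal measure_ball_lt_top.ne]
  simp

lemma cball_vol (R : ℝ) (hR : 0 ≤ R) : volume (Metric.closedBall (0:E4) R) = ENNReal.ofReal (R ^ 4 * V4) := by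
  rw [Measure.addHaar_closedBall volume (0:E4) hR, ENNReal.ofReal_mul (by positivity), V4,
    ofReal_measureReal measure_ball_lt_top.ne]
  simp

lemma shell_eq (a b : ℝ) (ha : 0 ≤ a) (hab : a ≤ b) : {y : E4 | ‖y‖ ^ 2 ∈ Icc a b}
    = Metric.closedBall (0:E4) (√b) \ Metric.ball (0:E4) (√a) := by
  ext y
  simp only [mem_ofPred_eq, mem_Icc, Set.mem_sdiff, Metric.mem_closedBall, dist_zero_right,
    Metric.mem_ball, not_lt]
  rw [Real.le_sqrt (norm_nonneg _) (ha.trans hab), Real.sqrt_le_left (norm_nonneg _), and_comm]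

lemma shell_vol (a b : ℝ) (ha : 0 ≤ a) (hab : a ≤ b) :
    volume {y : E4 | ‖y‖ ^ 2 ∈ Icc a b} = ENNReal.ofReal ((b ^ 2 - a ^ 2) * V4) := by
  rw [shell_eq a b ha hab, measure_sdiff _ Metric.isOpen_ball.measurableSet.nullMeasurableSet
    measure_ball_lt_top.ne, ball_vol _ (Real.sqrt_nonneg _), cball_vol _ (Real.sqrt_nonneg _),
    ← ENNReal.ofReal_sub _ (mul_nonneg (by positivity) V4_pos.le)]
  · congr 1
    have h1 : (√b)^4 = b^2 := by
      rw [show (√b)^4 = ((√b)^2)^2 by ring, Real.sq_sqrt (ha.trans hab)]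
    have h2 : (√a)^4 = a^2 := by
      rw [show (√a)^4 = ((√a)^2)^2 by ring, Real.sq_sqrt ha]
    rw [h1, h2]; ring
  · intro y hy
    simp only [Metric.mem_ball, dist_zero_right, Metric.mem_closedBall] at *
    exact hy.le.trans (Real.sqrt_le_sqrt hab)

lemma shell_bound {m : E4 → ℝ} {a b c : ℝ} (ha : 0 ≤ a) (hab : a ≤ b) (hb : b ≤ 1)
    (hm : ∀ y, ‖y‖ ^ 2 ∈ Icc a b → |m y| ≤ c) (hc : 0 ≤ c)
    (h0 : ∀ y, ‖y‖ ^ 2 ∉ Icc a b → m y = 0) : |∫ y, m y| ≤ c * (2 * (b - a) * V4) := by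
  rw [← setIntegral_eq_integral_of_forall_compl_eq_zero (s := {y : E4 | ‖y‖ ^ 2 ∈ Icc a b})
    (fun y hy => h0 y hy)]
  have hv := shell_vol a b ha hab
  have h := norm_setIntegral_le_of_norm_le_const (μ := volume) (f := m)
    (s := {y : E4 | ‖y‖ ^ 2 ∈ Icc a b}) (C := c) (by rw [hv]; exact ENNReal.ofReal_lt_top)
    (fun y hy => hm y hy)
  rw [Real.norm_eq_abs] at h
  refine h.trans ?_
  rw [Measure.real, hv, ENNReal.toReal_ofReal (mul_nonneg (by nlinarith) V4_pos.le)]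
  gcongr
  · exact V4_pos.le
  · nlinarith


lemma mean_zero_aux {v : E4 → ℝ} (hv : Continuous v) {r : ℝ} (hr : 0 < r) (hr8 : r < 1 / 8)
    (hu : IsHarmonicOn v {x | r < ‖x‖ ∧ ‖x‖ < 1})
    {δ ε : ℝ} (hδ : 0 < δ) (hδ' : δ ≤ 1 / 16)
    (hε1 : ∀ t, t ∈ Icc (r ^ 2 + δ) (r ^ 2 + 2 * δ) → |mm v (√t)| ≤ ε)
    (hε2 : ∀ t, t ∈ Icc (1 - 2 * δ) (1 - δ) → |mm v (√t)| ≤ ε)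
    {s s' s'' : ℝ → ℝ} {A : ℝ} (hA : 0 < A) (hs : ∀ t, HasDerivAt s (s' t) t)
    (hs' : ∀ t, HasDerivAt s' (s'' t) t) (s0 : ∀ t, t ≤ 0 → s t = 0)
    (s1 : ∀ t, 1 ≤ t → s t = 1) (z1 : ∀ t, t ∉ Icc (0:ℝ) 1 → s' t = 0)
    (b1 : ∀ t, |s' t| ≤ A) (sn : ∀ t, 0 ≤ s t) (sl : ∀ t, s t ≤ 1)
    {k k' : ℝ → ℝ} {B : ℝ}
    (hk : ∀ t, HasDerivAt k (k' t) t) (ck : Continuous k')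
    (sk : ∀ t, t ∉ Icc (r ^ 2 + δ) (1 - δ) → k t = 0)
    (sk' : ∀ t, t ∉ Icc (r ^ 2 + δ) (1 - δ) → k' t = 0) (hB : ∀ t, |k t| ≤ B) :
    sig.real univ * |∫ y, v y * (8 * k (‖y‖ ^ 2) + 4 * ‖y‖ ^ 2 * k' (‖y‖ ^ 2))| ≤
      32 * B * A * V4 * ε / r ^ 2 := by
  have hr2 : 0 < r ^ 2 := by positivity
  have hr2' : r ^ 2 < 1 / 64 := by nlinarith
  have cs : Continuous s := continuous_iff_continuousAt.2 fun t => (hs t).continuousAt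
  have cs' : Continuous s' := continuous_iff_continuousAt.2 fun t => (hs' t).continuousAt
  have ckk : Continuous k := continuous_iff_continuousAt.2 fun t => (hk t).continuousAt
  let p : ℝ → ℝ := fun t => s ((t - r ^ 2) / δ - 1)
  let q : ℝ → ℝ := fun t => s ((1 - t) / δ - 1)
  let p' : ℝ → ℝ := fun t => s' ((t - r ^ 2) / δ - 1) * (1 / δ)
  let q' : ℝ → ℝ := fun t => s' ((1 - t) / δ - 1) * (-1 / δ)
  have hp : ∀ t, HasDerivAt p (p' t) t := fun t => by
    have : HasDerivAt (fun t => (t - r ^ 2) / δ - 1) (1 / δ) t :=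
      (((hasDerivAt_id t).sub_const _).div_const δ).sub_const 1
    exact (hs _).comp t this
  have hq : ∀ t, HasDerivAt q (q' t) t := fun t => by
    have : HasDerivAt (fun t => (1 - t) / δ - 1) (-1 / δ) t :=
      (((hasDerivAt_id t).const_sub 1).div_const δ).sub_const 1
    exact (hs _).comp t this
  have cp : Continuous p := by fun_prop
  have cq : Continuous q := by fun_prop
  have cp' : Continuous p' := by fun_prop
  have cq' : Continuous q' := by fun_prop
  have p0 : ∀ t, t ≤ r ^ 2 + δ → p t = 0 := fun t ht => s0 _ (by
    rw [sub_nonpos, div_le_one hδ]; linarith)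
  have q0 : ∀ t, 1 - δ ≤ t → q t = 0 := fun t ht => s0 _ (by
    rw [sub_nonpos, div_le_one hδ]; linarith)
  have p1 : ∀ t, r ^ 2 + 2 * δ ≤ t → p t = 1 := fun t ht => s1 _ (by
    rw [le_sub_iff_add_le, le_div_iff₀ hδ]; linarith)
  have q1 : ∀ t, t ≤ 1 - 2 * δ → q t = 1 := fun t ht => s1 _ (by
    rw [le_sub_iff_add_le, le_div_iff₀ hδ]; linarith)
  have p'0 : ∀ t, t ∉ Icc (r ^ 2 + δ) (r ^ 2 + 2 * δ) → p' t = 0 := fun t ht => by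
    simp only [p']
    rw [z1, zero_mul]
    intro h
    apply ht
    have h1 := h.1
    have h2 := h.2
    rw [le_sub_iff_add_le, le_div_iff₀ hδ] at h1
    rw [sub_le_iff_le_add, div_le_iff₀ hδ] at h2
    constructor <;> linarith
  have q'0 : ∀ t, t ∉ Icc (1 - 2 * δ) (1 - δ) → q' t = 0 := fun t ht => by
    simp only [q']
    rw [z1, zero_mul]
    intro h
    apply ht
    have h1 := h.1
    have h2 := h.2
    rw [le_sub_iff_add_le, le_div_iff₀ hδ] at h1
    rw [sub_le_iff_le_add, div_le_iff₀ hδ] at h2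
    constructor <;> linarith
  have p'b : ∀ t, |p' t| ≤ A / δ := fun t => by
    simp only [p', abs_mul, abs_of_pos (one_div_pos.2 hδ)]
    rw [mul_one_div]; gcongr; exact b1 _
  have q'b : ∀ t, |q' t| ≤ A / δ := fun t => by
    simp only [q', abs_mul, abs_div, abs_neg, abs_one, abs_of_pos hδ]
    rw [mul_one_div]; gcongr; exact b1 _
  let P : ℝ → ℝ := fun t => p t * q t
  let P' : ℝ → ℝ := fun t => p' t * q t + p t * q' t
  have hP : ∀ t, HasDerivAt P (P' t) t := fun t => (hp t).mul (hq t)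
  have cP : Continuous P := by fun_prop
  have cP' : Continuous P' := by fun_prop
  have P0 : ∀ t, t ∉ Icc (r ^ 2 + δ) (1 - δ) → P t = 0 := fun t ht => by
    rw [mem_Icc, not_and_or, not_le, not_le] at ht
    rcases ht with h | h
    · simp [P, p0 t h.le]
    · simp [P, q0 t h.le]
  have P'0 : ∀ t, t ∉ Icc (r ^ 2 + δ) (1 - δ) → P' t = 0 := fun t ht => by
    have h1 : p' t = 0 := p'0 t (fun h => ht ⟨h.1, by linarith [h.2]⟩)
    have h2 : q' t = 0 := q'0 t (fun h => ht ⟨by linarith [h.1], h.2⟩)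
    simp [P', h1, h2]
  let k2 : ℝ → ℝ := fun t => P t / t ^ 2
  let k2' : ℝ → ℝ := fun t => P' t / t ^ 2 - 2 * P t / t ^ 3
  have loc : ∀ t, t ≠ 0 ∨ t < r ^ 2 + δ := fun t => by
    rcases eq_or_ne t 0 with h | h
    · right; rw [h]; positivity
    · exact Or.inl h
  have P0e : ∀ t, t < r ^ 2 + δ → ∀ᶠ x in nhds t, P x = 0 ∧ P' x = 0 := fun t ht => by
    filter_upwards [gt_mem_nhds ht] with x hx
    exact ⟨P0 x fun h => by linarith [h.1], P'0 x fun h => by linarith [h.1]⟩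
  have hk2 : ∀ t, HasDerivAt k2 (k2' t) t := fun t => by
    rcases loc t with h | h
    · have h1 := (hP t).div (hasDerivAt_pow 2 t) (by positivity)
      refine h1.congr_deriv ?_
      simp only [k2']
      field_simp
      push_cast
      ring
    · have h1 := P0e t h
      have h2 : k2 =ᶠ[nhds t] fun _ => 0 := by
        filter_upwards [h1] with x hx; simp [k2, hx.1]
      have h3 : k2' t = 0 := by simp [k2', h1.self_of_nhds.1, h1.self_of_nhds.2]
      rw [h3]
      exact (hasDerivAt_const t (0:ℝ)).congr_of_eventuallyEq h2
  have ck2' : Continuous k2' := by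
    rw [continuous_iff_continuousAt]
    intro t
    rcases loc t with h | h
    · exact (cP'.continuousAt.div (continuousAt_id.pow 2) (by simpa using h)).sub
        ((continuousAt_const.mul cP.continuousAt).div (continuousAt_id.pow 3) (by simpa using h))
    · have h2 : k2' =ᶠ[nhds t] fun _ => 0 := by
        filter_upwards [P0e t h] with x hx; simp [k2', hx.1, hx.2]
      exact continuousAt_const.congr h2.symm
  have ck2 : Continuous k2 := continuous_iff_continuousAt.2 fun t => (hk2 t).continuousAt
  let F1 : ℝ → ℝ := fun t => 4 * (p' t * q t) / t
  let F2 : ℝ → ℝ := fun t => 4 * (p t * q' t) / t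
  have contF : ∀ G : ℝ → ℝ, Continuous G → (∀ t, t < r ^ 2 + δ → G t = 0) →
      Continuous (fun t => 4 * G t / t) := by
    intro G hG hG0
    rw [continuous_iff_continuousAt]
    intro t
    rcases loc t with h | h
    · exact (continuousAt_const.mul hG.continuousAt).div continuousAt_id h
    · have h2 : (fun t => 4 * G t / t) =ᶠ[nhds t] fun _ => 0 := by
        filter_upwards [gt_mem_nhds h] with x hx; simp [hG0 x hx]
      exact continuousAt_const.congr h2.symm
  have cF1 : Continuous F1 := contF _ (by fun_prop) (fun t ht => by
    rw [p'0 t (fun h => by linarith [h.1]), zero_mul])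
  have cF2 : Continuous F2 := contF _ (by fun_prop) (fun t ht => by
    rw [p0 t ht.le, zero_mul])
  have bound : ∀ (F : ℝ → ℝ) (a b : ℝ), r ^ 2 ≤ a → b ≤ 1 → b - a = δ → Continuous F →
      (∀ t, t ∉ Icc a b → F t = 0) → (∀ t ∈ Icc a b, |F t| ≤ 4 * (A / δ) / r ^ 2) →
      (∀ t, t ∈ Icc a b → |mm v (√t)| ≤ ε) →
      sig.real univ * |∫ y, v y * F (‖y‖ ^ 2)| ≤ 8 * A * V4 * ε / r ^ 2 := by
    intro F a b ha hb hab hF hF0 hFb hmb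
    have hε : 0 ≤ ε := (abs_nonneg _).trans (hmb a ⟨le_rfl, by linarith⟩)
    have h1 := avg_formula hv hF (fun t ht => hF0 t (fun h => by linarith [h.2]))
    rw [← abs_of_pos sig_univ_pos, ← abs_mul, h1]
    have h2 := shell_bound (m := fun y => mm v ‖y‖ * F (‖y‖ ^ 2)) (a := a) (b := b)
      (c := ε * (4 * (A / δ) / r ^ 2)) (by linarith) (by linarith) hb
      (fun y hy => by
        rw [abs_mul]
        have := hmb _ hy
        rw [Real.sqrt_sq (norm_nonneg _)] at this
        exact mul_le_mul this (hFb _ hy) (abs_nonneg _) hε)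
      (by positivity) (fun y hy => by rw [hF0 _ hy, mul_zero])
    refine h2.trans (le_of_eq ?_)
    rw [hab]
    field_simp
    ring
  have bnd1 := bound F1 (r ^ 2 + δ) (r ^ 2 + 2 * δ) (by linarith) (by linarith) (by ring) cF1
    (fun t ht => by simp [F1, p'0 t ht])
    (fun t ht => by
      have ht0 : r ^ 2 ≤ t := by linarith [ht.1]
      have ht1 : 0 < t := by linarith
      simp only [F1, abs_div, abs_mul, abs_of_pos ht1, abs_of_pos (show (0:ℝ) < 4 by norm_num)]
      gcongr
      calc |p' t| * |q t| ≤ A / δ * 1 := by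
            gcongr
            · exact p'b t
            · rw [abs_of_nonneg (sn _)]; exact sl _
        _ = A / δ := mul_one _) hε1
  have bnd2 := bound F2 (1 - 2 * δ) (1 - δ) (by linarith) (by linarith) (by ring) cF2
    (fun t ht => by simp [F2, q'0 t ht])
    (fun t ht => by
      have ht0 : r ^ 2 ≤ t := by linarith [ht.1]
      have ht1 : 0 < t := by linarith
      simp only [F2, abs_div, abs_mul, abs_of_pos ht1, abs_of_pos (show (0:ℝ) < 4 by norm_num)]
      gcongr
      calc |p t| * |q' t| ≤ 1 * (A / δ) := by
            gcongr
            · rw [abs_of_nonneg (sn _)]; exact sl _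
            · exact q'b t
        _ = A / δ := one_mul _) hε2
  -- linear combination
  set c : ℝ := ∫ t in (r ^ 2 + δ)..(1 - δ), k t with hc
  set c2 : ℝ := ∫ t in (r ^ 2 + δ)..(1 - δ), k2 t with hc2
  have hle : r ^ 2 + δ ≤ 1 - δ := by linarith
  have w := k_weak hr hu (k := fun t => c2 * k t - c * k2 t) (k' := fun t => c2 * k' t - c * k2' t)
    (a := r ^ 2 + δ) (b := 1 - δ) (by linarith) hle (by linarith)
    (fun t => ((hk t).const_mul c2).sub ((hk2 t).const_mul c)) (by fun_prop)
    (fun t ht => by simp [sk t ht, k2, P0 t ht])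
    (fun t ht => by simp [sk' t ht, k2', P0 t ht, P'0 t ht])
    (by
      rw [intervalIntegral.integral_sub ((ckk.const_mul c2).intervalIntegrable _ _)
        ((ck2.const_mul c).intervalIntegrable _ _), intervalIntegral.integral_const_mul,
        intervalIntegral.integral_const_mul]
      ring)
  have integ : ∀ F : ℝ → ℝ, Continuous F → (∀ t, 1 < t → F t = 0) →
      Integrable (fun y : E4 => v y * F (‖y‖ ^ 2)) := by
    intro F hF hF0
    apply Continuous.integrable_of_hasCompactSupport (by fun_prop)
    apply HasCompactSupport.intro (isCompact_closedBall (0:E4) 1)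
    intro x hx
    simp only [Metric.mem_closedBall, dist_zero_right, not_le] at hx
    rw [hF0 _ (by nlinarith), mul_zero]
  have i1 := integ F1 cF1 (fun t ht => by
    simp only [F1]; rw [p'0 t (fun h => by linarith [h.2])]; simp)
  have i2 := integ F2 cF2 (fun t ht => by
    simp only [F2]; rw [q'0 t (fun h => by linarith [h.2])]; simp)
  have i0 := integ (fun t => 8 * k t + 4 * t * k' t) (by fun_prop) (fun t ht => by
    rw [sk t (fun h => by linarith [h.2]), sk' t (fun h => by linarith [h.2])]; simp)
  have w2 : ∫ y, v y * (8 * (c2 * k (‖y‖ ^ 2) - c * k2 (‖y‖ ^ 2)) +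
      4 * ‖y‖ ^ 2 * (c2 * k' (‖y‖ ^ 2) - c * k2' (‖y‖ ^ 2))) =
      c2 * (∫ y, v y * (8 * k (‖y‖ ^ 2) + 4 * ‖y‖ ^ 2 * k' (‖y‖ ^ 2))) -
      c * ((∫ y, v y * F1 (‖y‖ ^ 2)) + ∫ y, v y * F2 (‖y‖ ^ 2)) := by
    have i12 : Integrable (fun y : E4 => c * (v y * F1 (‖y‖ ^ 2) + v y * F2 (‖y‖ ^ 2))) :=
      (i1.add i2).const_mul c
    rw [← integral_add i1 i2, ← integral_const_mul, ← integral_const_mul,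
      ← integral_sub (i0.const_mul c2) i12]
    congr 1
    ext y
    have : 8 * k2 (‖y‖ ^ 2) + 4 * ‖y‖ ^ 2 * k2' (‖y‖ ^ 2) = F1 (‖y‖ ^ 2) + F2 (‖y‖ ^ 2) := by
      generalize ‖y‖ ^ 2 = t
      simp only [k2, k2', F1, F2]
      rcases eq_or_ne t 0 with h | h
      · simp [h]
      · have : P' t = p' t * q t + p t * q' t := rfl
        rw [this]
        field_simp
        ring
    have e : 8 * (c2 * k (‖y‖ ^ 2) - c * k2 (‖y‖ ^ 2)) +
      4 * ‖y‖ ^ 2 * (c2 * k' (‖y‖ ^ 2) - c * k2' (‖y‖ ^ 2)) =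
      c2 * (8 * k (‖y‖ ^ 2) + 4 * ‖y‖ ^ 2 * k' (‖y‖ ^ 2)) -
      c * (8 * k2 (‖y‖ ^ 2) + 4 * ‖y‖ ^ 2 * k2' (‖y‖ ^ 2)) := by ring
    rw [e, this]
    ring
  rw [w2] at w
  have hcB : |c| ≤ B := by
    have h := intervalIntegral.norm_integral_le_of_norm_le_const (f := k) (a := r ^ 2 + δ)
      (b := 1 - δ) (C := B) (fun t _ => hB t)
    have hB0 : 0 ≤ B := (abs_nonneg _).trans (hB 0)
    rw [Real.norm_eq_abs, abs_of_nonneg (by linarith : 0 ≤ 1 - δ - (r ^ 2 + δ))] at h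
    refine h.trans ?_
    nlinarith
  have hc2l : 1 / 2 ≤ c2 := by
    have h1 : ∫ t in (1/4:ℝ)..(3/4), (1:ℝ) ≤ ∫ t in (1/4:ℝ)..(3/4), k2 t := by
      apply intervalIntegral.integral_mono_on (by norm_num) (by simp) (ck2.intervalIntegrable _ _)
      intro t ht
      have h1 := ht.1
      have h2 := ht.2
      simp only [k2, P]
      rw [p1 t (by linarith), q1 t (by linarith), one_mul, le_div_iff₀ (by nlinarith)]
      nlinarith
    have h2 : ∫ t in (1/4:ℝ)..(3/4), k2 t ≤ c2 := by
      apply intervalIntegral.integral_mono_interval (by linarith) (by norm_num) (by linarith) _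
        (ck2.intervalIntegrable _ _)
      apply Eventually.of_forall
      intro t
      exact div_nonneg (mul_nonneg (sn _) (sn _)) (by positivity)
    simp at h1
    linarith
  set J := ∫ y, v y * (8 * k (‖y‖ ^ 2) + 4 * ‖y‖ ^ 2 * k' (‖y‖ ^ 2)) with hJ
  set J1 := ∫ y, v y * F1 (‖y‖ ^ 2)
  set J2 := ∫ y, v y * F2 (‖y‖ ^ 2)
  have hB0 : 0 ≤ B := (abs_nonneg _).trans (hB 0)
  have hs0 := sig_univ_pos.le
  have e1 : |J| ≤ 2 * (B * (|J1| + |J2|)) := by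
    have : |c2 * J| = |c * (J1 + J2)| := by congr 1; linarith
    rw [abs_mul, abs_mul, abs_of_pos (by linarith : 0 < c2)] at this
    have h1 : |c| * |J1 + J2| ≤ B * (|J1| + |J2|) := by
      gcongr
      exact abs_add_le _ _
    have h2 : 1 / 2 * |J| ≤ c2 * |J| := by gcongr
    linarith
  calc sig.real univ * |J| ≤ sig.real univ * (2 * (B * (|J1| + |J2|))) := by gcongr
    _ = 2 * B * (sig.real univ * |J1| + sig.real univ * |J2|) := by ring
    _ ≤ 2 * B * (8 * A * V4 * ε / r ^ 2 + 8 * A * V4 * ε / r ^ 2) := by gcongr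
    _ = 32 * B * A * V4 * ε / r ^ 2 := by ring

lemma mean_zero {v : E4 → ℝ} (hv : Continuous v) {r : ℝ} (hr : 0 < r) (hr8 : r < 1 / 8)
    (hu : IsHarmonicOn v {x | r < ‖x‖ ∧ ‖x‖ < 1}) (m1 : mm v 1 = 0) (mr : mm v r = 0)
    {k k' : ℝ → ℝ} {a b : ℝ} (ha : r ^ 2 < a) (hb : b < 1)
    (hk : ∀ t, HasDerivAt k (k' t) t) (ck : Continuous k')
    (sk : ∀ t, t ∉ Icc a b → k t = 0) (sk' : ∀ t, t ∉ Icc a b → k' t = 0) :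
    ∫ y, v y * (8 * k (‖y‖ ^ 2) + 4 * ‖y‖ ^ 2 * k' (‖y‖ ^ 2)) = 0 := by
  obtain ⟨s, s', s'', A, hA, hs, hs', cs'', s0, s1, z1, z2, b1, b2, sn, sl⟩ := exists_S
  have ckk : Continuous k := continuous_iff_continuousAt.2 fun t => (hk t).continuousAt
  obtain ⟨B, hB⟩ : ∃ B, ∀ t, |k t| ≤ B := by
    obtain ⟨B, h⟩ := (isCompact_Icc (a := a) (b := b)).exists_bound_of_continuousOn ckk.continuousOn
    refine ⟨max B 0, fun t => ?_⟩
    by_cases ht : t ∈ Icc a b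
    · exact (h t ht).trans (le_max_left _ _)
    · rw [sk t ht]; simp
  have cm : Continuous fun t => mm v (√t) := (mm_continuous hv).comp Real.continuous_sqrt
  have key : ∀ ε > 0, sig.real univ * |∫ y, v y * (8 * k (‖y‖ ^ 2) + 4 * ‖y‖ ^ 2 * k' (‖y‖ ^ 2))| ≤
      32 * B * A * V4 * ε / r ^ 2 := by
    intro ε hε
    obtain ⟨η1, h1, H1⟩ := Metric.continuousAt_iff.1 (cm.continuousAt (x := r ^ 2)) ε hε
    obtain ⟨η2, h2, H2⟩ := Metric.continuousAt_iff.1 (cm.continuousAt (x := 1)) ε hε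
    simp only [Real.sqrt_sq hr.le, mr, Real.sqrt_one, m1, dist_zero_right, Real.norm_eq_abs,
      Real.dist_eq] at H1 H2
    obtain ⟨δ, hδ, hδ'⟩ := exists_between (show 0 < min (min (η1 / 2) (η2 / 2))
      (min (1 / 16) (min (a - r ^ 2) (1 - b))) by
        have : 0 < a - r ^ 2 := by linarith
        have : 0 < 1 - b := by linarith
        positivity)
    simp only [lt_min_iff] at hδ'
    obtain ⟨⟨d1, d2⟩, d3, d4, d5⟩ := hδ'
    have sub : ∀ t, t ∉ Icc (r ^ 2 + δ) (1 - δ) → t ∉ Icc a b := fun t ht h =>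
      ht ⟨by linarith [h.1], by linarith [h.2]⟩
    exact mean_zero_aux hv hr hr8 hu hδ d3.le
      (fun t ht => (H1 (by rw [abs_lt]; constructor <;> linarith [ht.1, ht.2])).le)
      (fun t ht => (H2 (by rw [abs_lt]; constructor <;> linarith [ht.1, ht.2])).le)
      hA hs hs' s0 s1 z1 b1 sn sl hk ck (fun t ht => sk t (sub t ht)) (fun t ht => sk' t (sub t ht)) hB
  by_contra hne
  have hpos := mul_pos sig_univ_pos (abs_pos.2 hne)
  have lim : Tendsto (fun ε : ℝ => 32 * B * A * V4 * ε / r ^ 2) (nhdsWithin 0 (Ioi 0)) (nhds 0) := by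
    have : Continuous (fun ε : ℝ => 32 * B * A * V4 * ε / r ^ 2) := by fun_prop
    have h := this.tendsto 0
    simp only [mul_zero, zero_div] at h
    exact h.mono_left nhdsWithin_le_nhds
  have := ge_of_tendsto lim (eventually_nhdsWithin_of_forall (fun ε hε => key ε hε))
  linarith


def C6 : ℝ := ∫ z : E4, ((1 + ‖z‖ ^ 2) ^ 3)⁻¹

lemma C6_int : Integrable (fun z : E4 => ((1 + ‖z‖ ^ 2) ^ 3)⁻¹) := by
  have h := integrable_rpow_neg_one_add_norm_sq (E := E4) (μ := volume) (r := 6) (by simp; norm_num)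
  refine h.congr (Eventually.of_forall fun z => ?_)
  have : (0:ℝ) ≤ 1 + ‖z‖ ^ 2 := by positivity
  simp only
  rw [show (-6 / 2 : ℝ) = -((3:ℕ):ℝ) by norm_num, Real.rpow_neg this, Real.rpow_natCast]

lemma C6_pos : 0 < C6 := by
  rw [C6, integral_pos_iff_support_of_nonneg (fun z => by positivity) C6_int]
  have : Function.support (fun z : E4 => ((1 + ‖z‖ ^ 2) ^ 3)⁻¹) = univ := by
    ext z
    simp only [Function.mem_support, mem_univ, iff_true]
    positivity
  rw [this]
  simp

lemma peak {w : E4 → ℝ} (hw : Integrable w) (cw : Continuous w) (x : E4) :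
    Tendsto (fun c : ℝ => ∫ y, w y * (c ^ 4 * ((1 + c ^ 2 * ‖y - x‖ ^ 2) ^ 3)⁻¹)) atTop
      (nhds (C6 * w x)) := by
  have hC := C6_pos
  have h := tendsto_integral_comp_smul_smul_of_integrable' (μ := volume)
    (φ := fun z : E4 => C6⁻¹ * ((1 + ‖z‖ ^ 2) ^ 3)⁻¹) (g := w) (x₀ := x)
    (fun z => by positivity)
    (by rw [integral_const_mul]; exact inv_mul_cancel₀ hC.ne') ?_ hw cw.continuousAt
  · have h2 := h.const_mul C6
    refine h2.congr fun c => ?_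
    rw [← integral_const_mul]
    congr 1
    ext y
    simp only [finrank_euclideanSpace, Fintype.card_fin, smul_eq_mul, norm_smul, Real.norm_eq_abs,
      mul_pow, sq_abs, norm_sub_rev x y]
    field_simp
  · simp only [finrank_euclideanSpace, Fintype.card_fin]
    have hb : ∀ z : E4, ‖z‖ ^ 4 * (C6⁻¹ * ((1 + ‖z‖ ^ 2) ^ 3)⁻¹) ≤ C6⁻¹ * (‖z‖ ^ 2)⁻¹ := by
      intro z
      rcases eq_or_ne ‖z‖ 0 with h | h
      · rw [h]; simp
      · have hz : 0 < ‖z‖ := lt_of_le_of_ne (norm_nonneg _) (Ne.symm h)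
        rw [mul_left_comm]
        gcongr
        rw [← div_eq_mul_inv, div_le_iff₀ (by positivity), inv_mul_eq_div, le_div_iff₀ (by positivity)]
        calc ‖z‖ ^ 4 * ‖z‖ ^ 2 = (‖z‖ ^ 2) ^ 3 := by ring
          _ ≤ (1 + ‖z‖ ^ 2) ^ 3 := by gcongr; linarith
    have lim : Tendsto (fun z : E4 => C6⁻¹ * (‖z‖ ^ 2)⁻¹) (Bornology.cobounded E4) (nhds 0) := by
      have := (tendsto_inv_atTop_zero.comp
        ((tendsto_pow_atTop two_ne_zero).comp (tendsto_norm_cobounded_atTop (E := E4)))).const_mul C6⁻¹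
      simpa using this
    exact squeeze_zero (fun z => by positivity) hb lim

lemma peak_bound {w : E4 → ℝ} (hw : Integrable w) (cw : Continuous w) (x : E4) {M : ℝ}
    (h : ∀ e : ℝ, 0 < e → |∫ y, w y * (8 * e / (‖y - x‖ ^ 2 + e) ^ 3)| ≤ M) :
    |w x| ≤ M / (8 * C6) := by
  have hC := C6_pos
  have h1 := ((peak hw cw x).const_mul 8).abs
  have h2 : |8 * (C6 * w x)| ≤ M := by
    apply le_of_tendsto h1
    filter_upwards [eventually_gt_atTop 0] with c hc
    have := h (1 / c ^ 2) (by positivity)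
    rw [← integral_const_mul]
    have e : (fun y => 8 * (w y * (c ^ 4 * ((1 + c ^ 2 * ‖y - x‖ ^ 2) ^ 3)⁻¹))) = fun y =>
        w y * (8 * (1 / c ^ 2) / (‖y - x‖ ^ 2 + 1 / c ^ 2) ^ 3) := by
      ext y
      have h1 : ‖y - x‖ ^ 2 + 1 / c ^ 2 = (1 + c ^ 2 * ‖y - x‖ ^ 2) / c ^ 2 := by
        field_simp; ring
      rw [h1]
      field_simp
    rw [e]
    exact this
  rw [le_div_iff₀ (by positivity)]
  rw [abs_mul, abs_mul, abs_of_pos hC, abs_of_pos (by norm_num : (0:ℝ) < 8)] at h2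
  linarith

lemma memLp_ann {v : E4 → ℝ} (hv : Continuous v) (r : ℝ) :
    MemLp v 2 (volume.restrict {x : E4 | r < ‖x‖ ∧ ‖x‖ < 1}) := by
  obtain ⟨B, hB⟩ := (isCompact_closedBall (0:E4) 1).exists_bound_of_continuousOn hv.continuousOn
  have : IsFiniteMeasure (volume.restrict (Metric.closedBall (0:E4) 1)) :=
    ⟨by rw [Measure.restrict_apply_univ]; exact measure_closedBall_lt_top⟩
  have h : MemLp v 2 (volume.restrict (Metric.closedBall (0:E4) 1)) :=
    MemLp.of_bound hv.aestronglyMeasurable B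
      (ae_restrict_of_forall_mem Metric.isClosed_closedBall.measurableSet hB)
  exact h.mono_measure (Measure.restrict_mono (fun x hx => by simpa using hx.2.le) le_rfl)

def NN (v : E4 → ℝ) (r : ℝ) : ℝ := (eLpNorm v 2 (volume.restrict {x : E4 | r < ‖x‖ ∧ ‖x‖ < 1})).toReal

lemma shell_L2 {v m : E4 → ℝ} (hv : Continuous v) {r a b c : ℝ} (ha : r ^ 2 < a)
    (hab : a ≤ b) (hb : b < 1) (hc : 0 ≤ c)
    (hm : ∀ y, ‖y‖ ^ 2 ∈ Icc a b → |m y| ≤ c)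
    (h0 : ∀ y, ‖y‖ ^ 2 ∉ Icc a b → m y = 0) :
    |∫ y, v y * m y| ≤ c * (b * √V4) * NN v r := by
  have ha0 : 0 ≤ a := by nlinarith [sq_nonneg r]
  set S : Set E4 := {y : E4 | ‖y‖ ^ 2 ∈ Icc a b} with hS
  have mS : MeasurableSet S := by
    rw [hS, shell_eq a b ha0 hab]
    exact Metric.isClosed_closedBall.measurableSet.diff Metric.isOpen_ball.measurableSet
  rw [← setIntegral_eq_integral_of_forall_compl_eq_zero (s := S)
    (fun y hy => by rw [h0 y hy, mul_zero])]
  have e1 : ‖∫ y in S, v y * m y‖ₑ ≤ ENNReal.ofReal c * eLpNorm v 1 (volume.restrict S) := by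
    refine (enorm_integral_le_lintegral_enorm _).trans ?_
    rw [eLpNorm_one_eq_lintegral_enorm, ← lintegral_const_mul' _ _ ENNReal.ofReal_ne_top]
    apply setLIntegral_mono' mS
    intro y hy
    rw [enorm_mul, mul_comm]
    gcongr
    rw [Real.enorm_eq_ofReal_abs]
    exact ENNReal.ofReal_le_ofReal (hm y hy)
  have e2 : eLpNorm v 1 (volume.restrict S) ≤ eLpNorm v 2 (volume.restrict S) *
      (volume S) ^ (1/2:ℝ) := by
    have := eLpNorm_le_eLpNorm_mul_rpow_measure_univ (μ := volume.restrict S) (f := v) (p := 1) (q := 2)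
      (by norm_num) hv.aestronglyMeasurable
    refine this.trans (le_of_eq ?_)
    congr 1
    rw [Measure.restrict_apply_univ]
    norm_num
  have e3 : eLpNorm v 2 (volume.restrict S) ≤
      eLpNorm v 2 (volume.restrict {x : E4 | r < ‖x‖ ∧ ‖x‖ < 1}) := by
    apply eLpNorm_mono_measure
    apply Measure.restrict_mono _ le_rfl
    intro y hy
    have h1 := hy.1
    have h2 := hy.2
    constructor
    · exact lt_of_pow_lt_pow_left₀ 2 (norm_nonneg _) (by linarith)
    · nlinarith [norm_nonneg y]
  have e4 : (volume S) ^ (1/2:ℝ) ≤ ENNReal.ofReal (b * √V4) := by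
    rw [hS, shell_vol a b ha0 hab]
    have hb0 : 0 ≤ b := ha0.trans hab
    have : ENNReal.ofReal ((b ^ 2 - a ^ 2) * V4) ≤ ENNReal.ofReal ((b * √V4) ^ 2) := by
      apply ENNReal.ofReal_le_ofReal
      rw [mul_pow, Real.sq_sqrt V4_pos.le]
      have := V4_pos
      gcongr
      nlinarith [sq_nonneg a]
    refine (ENNReal.rpow_le_rpow this (by norm_num)).trans (le_of_eq ?_)
    rw [ENNReal.ofReal_rpow_of_nonneg (by positivity) (by norm_num), ← Real.sqrt_eq_rpow,
      Real.sqrt_sq (by positivity)]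
  have hfin := (memLp_ann hv r).eLpNorm_ne_top
  have e5 : ‖∫ y in S, v y * m y‖ₑ ≤ ENNReal.ofReal c *
      (eLpNorm v 2 (volume.restrict {x : E4 | r < ‖x‖ ∧ ‖x‖ < 1}) * ENNReal.ofReal (b * √V4)) := by
    refine e1.trans ?_
    gcongr
    exact e2.trans (mul_le_mul' e3 e4)
  have e6 := ENNReal.toReal_mono (by finiteness) e5
  rw [toReal_enorm, Real.norm_eq_abs, ENNReal.toReal_mul, ENNReal.toReal_mul, ENNReal.toReal_ofReal hc,
    ENNReal.toReal_ofReal (mul_nonneg (ha0.trans hab) (Real.sqrt_nonneg _))] at e6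
  rw [NN]
  linarith


/-- cutoff data -/
lemma exists_al : ∃ (s s' s'' : ℝ → ℝ) (A : ℝ), 0 < A ∧ (∀ t, HasDerivAt s (s' t) t) ∧
    (∀ t, HasDerivAt s' (s'' t) t) ∧ Continuous s'' ∧ (∀ t, t ≤ 6/5 → s t = 0) ∧
    (∀ t, 2 ≤ t → s t = 1) ∧ (∀ t, t ∉ Icc (6/5:ℝ) 2 → s' t = 0) ∧
    (∀ t, t ∉ Icc (6/5:ℝ) 2 → s'' t = 0) ∧ (∀ t, |s' t| ≤ A) ∧ (∀ t, |s'' t| ≤ A) := by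
  obtain ⟨s, s', s'', A, hA, hs, hs', cs'', s0, s1, z1, z2, b1, b2, sn, sl⟩ := exists_S
  have lin : ∀ t : ℝ, HasDerivAt (fun t : ℝ => (5 * t - 6) / 4) (5/4) t := fun t => by
    have := ((((hasDerivAt_id t).const_mul 5).sub_const 6).div_const 4)
    simpa using this
  have mem : ∀ t : ℝ, t ∉ Icc (6/5:ℝ) 2 → (5 * t - 6) / 4 ∉ Icc (0:ℝ) 1 := fun t ht h =>
    ht ⟨by linarith [h.1], by linarith [h.2]⟩
  refine ⟨fun t => s ((5 * t - 6) / 4), fun t => s' ((5 * t - 6) / 4) * (5/4),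
    fun t => s'' ((5 * t - 6) / 4) * (5/4) * (5/4), A * (25/16), by positivity,
    fun t => (hs _).comp t (lin t), fun t => ((hs' _).comp t (lin t)).mul_const _,
    by fun_prop, fun t ht => s0 _ (by linarith), fun t ht => s1 _ (by linarith),
    fun t ht => by simp only; rw [z1 _ (mem t ht), zero_mul],
    fun t ht => by simp only; rw [z2 _ (mem t ht), zero_mul, zero_mul], fun t => ?_, fun t => ?_⟩
  · rw [abs_mul, abs_of_pos (by norm_num : (0:ℝ) < 5/4)]
    nlinarith [b1 ((5 * t - 6) / 4)]
  · rw [abs_mul, abs_mul, abs_of_pos (by norm_num : (0:ℝ) < 5/4)]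
    nlinarith [b2 ((5 * t - 6) / 4)]

lemma outer_bd {x y : E4} {e F F' A : ℝ} (he : 0 < e) (hx : ‖x‖ < 1/2)
    (hy : 8/15 ≤ ‖y‖ ^ 2) (hy' : ‖y‖ ^ 2 ≤ 8/9) (hF : |F| ≤ A * 9) (hF' : |F'| ≤ A * 9) (hA : 0 < A) :
    |8 * inner ℝ y (y - x) * F * (-1 / (‖y - x‖ ^ 2 + e) ^ 2) +
      1 / (‖y - x‖ ^ 2 + e) * (8 * F + 4 * ‖y‖ ^ 2 * F')| ≤ 100000 * A := by
  have h1 : ‖y‖ ≤ 1 := by nlinarith [norm_nonneg y]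
  have h2 : 7/10 ≤ ‖y‖ := by nlinarith [norm_nonneg y]
  have h3 : ‖y‖ - ‖x‖ ≤ ‖y - x‖ := norm_sub_norm_le y x
  have h4 : ‖y - x‖ ≤ ‖y‖ + ‖x‖ := norm_sub_le y x
  have h5 : 1/5 ≤ ‖y - x‖ := by linarith
  have h6 : ‖y - x‖ ≤ 3/2 := by linarith
  have hi : |inner ℝ y (y - x)| ≤ 3/2 := by
    refine (abs_real_inner_le_norm _ _).trans ?_
    nlinarith [norm_nonneg y, norm_nonneg (y-x)]
  have hd : 1/25 ≤ ‖y - x‖ ^ 2 + e := by nlinarith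
  have g1 : |1 / (‖y - x‖ ^ 2 + e)| ≤ 25 := by
    rw [abs_of_pos (by positivity), div_le_iff₀ (by linarith)]; linarith
  have g2 : |-1 / (‖y - x‖ ^ 2 + e) ^ 2| ≤ 625 := by
    rw [neg_div, abs_neg, abs_of_pos (by positivity), div_le_iff₀ (by positivity)]; nlinarith
  have k1 : |8 * inner ℝ y (y - x) * F * (-1 / (‖y - x‖ ^ 2 + e) ^ 2)| ≤ 8 * (3/2) * (A * 9) * 625 := by
    rw [abs_mul, abs_mul, abs_mul, abs_of_pos (by norm_num : (0:ℝ) < 8)]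
    gcongr
  have k2 : |8 * F + 4 * ‖y‖ ^ 2 * F'| ≤ 8 * (A * 9) + 4 * 1 * (A * 9) := by
    refine (abs_add_le _ _).trans ?_
    rw [abs_mul, abs_mul, abs_mul, abs_of_pos (by norm_num : (0:ℝ) < 8),
      abs_of_pos (by norm_num : (0:ℝ) < 4), abs_of_nonneg (by positivity : 0 ≤ ‖y‖ ^ 2)]
    gcongr
    linarith
  have k3 : |1 / (‖y - x‖ ^ 2 + e) * (8 * F + 4 * ‖y‖ ^ 2 * F')| ≤ 25 * (8 * (A * 9) + 4 * 1 * (A * 9)) := by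
    rw [abs_mul]; gcongr
  refine (abs_add_le _ _).trans ?_
  linarith

lemma inner_bd {x y : E4} {e F F' A r : ℝ} (he : 0 < e) (hr : 0 < r) (hx : 2 * r < ‖x‖)
    (hy' : ‖y‖ ^ 2 ≤ 2 * r ^ 2) (hF : |F| ≤ A / r ^ 2) (hF' : |F'| ≤ A / r ^ 4) (hA : 0 < A) :
    |8 * inner ℝ y (y - x) * F * (-1 / (‖y - x‖ ^ 2 + e) ^ 2) +
      (1 / (‖y - x‖ ^ 2 + e) - 1 / (‖x‖ ^ 2 + e)) * (8 * F + 4 * ‖y‖ ^ 2 * F')|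
      ≤ 2000 * A / (r * ‖x‖ ^ 3) := by
  have hX : 0 < ‖x‖ := by linarith
  have hY := norm_nonneg y
  have h1 : ‖y‖ ≤ 3/2 * r := abs_le_of_sq_le_sq' (by nlinarith) (by positivity) |>.2
  have h2 : ‖x‖ - ‖y‖ ≤ ‖y - x‖ := by rw [norm_sub_rev]; exact norm_sub_norm_le x y
  have h2' : ‖y - x‖ - ‖x‖ ≤ ‖y‖ := by
    have := norm_sub_le y x; linarith
  have h3 : ‖x‖ / 4 ≤ ‖y - x‖ := by linarith
  set D := ‖y - x‖ with hD
  set X := ‖x‖ with hXd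
  have hDp : 0 < D := by linarith
  have hDe : D ^ 2 ≤ D ^ 2 + e := by linarith
  have k1 : |8 * inner ℝ y (y - x) * F * (-1 / (D ^ 2 + e) ^ 2)| ≤ 768 * A / (r * X ^ 3) := by
    have a1 : |-1 / (D ^ 2 + e) ^ 2| ≤ 1 / (D ^ 2) ^ 2 := by
      rw [neg_div, abs_neg, abs_of_pos (by positivity)]
      gcongr
    have a2 : |inner ℝ y (y - x)| ≤ (3/2 * r) * D :=
      (abs_real_inner_le_norm _ _).trans (by gcongr)
    rw [abs_mul, abs_mul, abs_mul, abs_of_pos (by norm_num : (0:ℝ) < 8)]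
    calc 8 * |inner ℝ y (y - x)| * |F| * |-1 / (D ^ 2 + e) ^ 2| ≤
        8 * ((3/2 * r) * D) * (A / r ^ 2) * (1 / (D ^ 2) ^ 2) := by gcongr
      _ = 12 * A / (r * D ^ 3) := by field_simp; norm_num
      _ ≤ 12 * A / (r * (X / 4) ^ 3) := by gcongr
      _ = 768 * A / (r * X ^ 3) := by field_simp; norm_num
  have k2 : |8 * F + 4 * ‖y‖ ^ 2 * F'| ≤ 16 * A / r ^ 2 := by
    refine (abs_add_le _ _).trans ?_
    rw [abs_mul, abs_mul, abs_mul, abs_of_pos (by norm_num : (0:ℝ) < 8),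
      abs_of_pos (by norm_num : (0:ℝ) < 4), abs_of_nonneg (by positivity : 0 ≤ ‖y‖ ^ 2)]
    calc 8 * |F| + 4 * ‖y‖ ^ 2 * |F'| ≤ 8 * (A / r ^ 2) + 4 * (2 * r ^ 2) * (A / r ^ 4) := by gcongr
      _ = 16 * A / r ^ 2 := by field_simp; norm_num
  have k3 : |1 / (D ^ 2 + e) - 1 / (X ^ 2 + e)| ≤ 30 * r / X ^ 3 := by
    have e1 : 1 / (D ^ 2 + e) - 1 / (X ^ 2 + e) = (X - D) * ((X + D) / ((D ^ 2 + e) * (X ^ 2 + e))) := by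
      field_simp; ring
    have e2 : |X - D| ≤ 3/2 * r := by rw [abs_le]; constructor <;> linarith
    have e3 : |(X + D) / ((D ^ 2 + e) * (X ^ 2 + e))| ≤ (X + D) / (D ^ 2 * X ^ 2) := by
      rw [abs_of_pos (by positivity)]
      gcongr <;> linarith
    have e4 : (X + D) / (D ^ 2 * X ^ 2) = 1 / (D ^ 2 * X) + 1 / (D * X ^ 2) := by
      field_simp
    have e5 : 1 / (D ^ 2 * X) ≤ 1 / ((X/4) ^ 2 * X) := by gcongr
    have e6 : 1 / (D * X ^ 2) ≤ 1 / ((X/4) * X ^ 2) := by gcongr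
    have e7 : 1 / ((X/4) ^ 2 * X) + 1 / ((X/4) * X ^ 2) = 20 / X ^ 3 := by field_simp; norm_num
    rw [e1, abs_mul]
    calc |X - D| * |(X + D) / ((D ^ 2 + e) * (X ^ 2 + e))| ≤ (3/2 * r) * (20 / X ^ 3) := by
          gcongr; linarith
      _ = 30 * r / X ^ 3 := by field_simp; norm_num
  refine (abs_add_le _ _).trans ?_
  rw [abs_mul (_ - _)]
  calc _ ≤ 768 * A / (r * X ^ 3) + 30 * r / X ^ 3 * (16 * A / r ^ 2) := by gcongr
    _ = 1248 * A / (r * X ^ 3) := by field_simp; norm_num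
    _ ≤ _ := by gcongr; norm_num

lemma pointwise : ∃ K : ℝ, 0 < K ∧ ∀ (v : E4 → ℝ), Continuous v → ∀ r : ℝ, 0 < r → r < 1/8 →
    IsHarmonicOn v {x | r < ‖x‖ ∧ ‖x‖ < 1} → mm v 1 = 0 → mm v r = 0 → ∀ x : E4, 2 * r < ‖x‖ →
    ‖x‖ < 1/2 → |v x| ≤ K * NN v r * (1 + r / ‖x‖ ^ 3) := by
  obtain ⟨s, s', s'', A, hA, hs, hs', cs'', s0, s1, z1, z2, b1, b2⟩ := exists_al
  have hC := C6_pos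
  have hV := V4_pos
  refine ⟨100000 * A * √V4 / (8 * C6), by positivity, ?_⟩
  intro v hv r hr hr8 hu m1 mr x hx1 hx2
  have hr2 : 0 < r ^ 2 := by positivity
  have hr2' : r ^ 2 < 1 / 64 := by nlinarith
  have hN : 0 ≤ NN v r := ENNReal.toReal_nonneg
  have hX : 0 < ‖x‖ := by linarith
  have cs' : Continuous s' := continuous_iff_continuousAt.2 fun t => (hs' t).continuousAt
  have cs : Continuous s := continuous_iff_continuousAt.2 fun t => (hs t).continuousAt
  -- scaled cutoffs
  have sc : ∀ q : ℝ, 0 < q → ∀ t, HasDerivAt (fun t => t / q) (1 / q) t := fun q hq t =>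
    (hasDerivAt_id t).div_const q
  have d0 : ∀ q : ℝ, 0 < q → ∀ t, HasDerivAt (fun t => s (t / q)) (s' (t / q) * (1 / q)) t :=
    fun q hq t => (hs _).comp t (sc q hq t)
  have d1 : ∀ q : ℝ, 0 < q → ∀ t, HasDerivAt (fun t => s' (t / q) * (1 / q))
      (s'' (t / q) * (1 / q) * (1 / q)) t :=
    fun q hq t => ((hs' _).comp t (sc q hq t)).mul_const _
  have mem : ∀ q : ℝ, 0 < q → ∀ t, t ∉ Icc (6/5 * q) (2 * q) → t / q ∉ Icc (6/5:ℝ) 2 := by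
    intro q hq t ht h
    apply ht
    have h1 := h.1
    have h2 := h.2
    rw [le_div_iff₀ hq] at h1
    rw [div_le_iff₀ hq] at h2
    exact ⟨h1, h2⟩
  have zz1 : ∀ q : ℝ, 0 < q → ∀ t, t ∉ Icc (6/5 * q) (2 * q) → s' (t / q) * (1 / q) = 0 :=
    fun q hq t ht => by rw [z1 _ (mem q hq t ht), zero_mul]
  have zz2 : ∀ q : ℝ, 0 < q → ∀ t, t ∉ Icc (6/5 * q) (2 * q) → s'' (t / q) * (1 / q) * (1 / q) = 0 :=
    fun q hq t ht => by rw [z2 _ (mem q hq t ht), zero_mul, zero_mul]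
  let f : ℝ → ℝ := fun t => s (t / r ^ 2) - s (t / (4/9))
  have f0 : ∀ t, t ∉ Icc (6/5 * r ^ 2) (8/9) → f t = 0 := by
    intro t ht
    rw [mem_Icc, not_and_or, not_le, not_le] at ht
    simp only [f]
    rcases ht with h | h
    · rw [s0 _ (by rw [div_le_iff₀ hr2]; linarith), s0 _ (by rw [div_le_iff₀ (by norm_num)]; linarith)]
      simp
    · rw [s1 _ (by rw [le_div_iff₀ hr2]; linarith), s1 _ (by rw [le_div_iff₀ (by norm_num)]; linarith)]
      simp
  have sub1 : ∀ t, t ∉ Icc (6/5 * r ^ 2) (8/9) → t ∉ Icc (6/5 * r ^ 2) (2 * r ^ 2) := fun t ht h =>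
    ht ⟨h.1, by linarith [h.2]⟩
  have sub2 : ∀ t, t ∉ Icc (6/5 * r ^ 2) (8/9) → t ∉ Icc (6/5 * (4/9:ℝ)) (2 * (4/9)) := fun t ht h =>
    ht ⟨by linarith [h.1], by linarith [h.2]⟩
  have fx : f (‖x‖ ^ 2) = 1 := by
    simp only [f]
    rw [s1 _ (by rw [le_div_iff₀ hr2]; nlinarith), s0 _ (by rw [div_le_iff₀ (by norm_num)]; nlinarith)]
    simp
  have cf : Continuous f := by fun_prop
  have integ : ∀ G : E4 → ℝ, Continuous G → (∀ y, ‖y‖ ^ 2 ∉ Icc (6/5 * r ^ 2) (8/9) → G y = 0) →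
      Integrable (fun y : E4 => v y * G y) := by
    intro F hF hF0
    apply Continuous.integrable_of_hasCompactSupport (by fun_prop)
    apply HasCompactSupport.intro (isCompact_closedBall (0:E4) 1)
    intro x hx
    simp only [Metric.mem_closedBall, dist_zero_right, not_le] at hx
    rw [hF0 _ (fun h => by nlinarith [h.2]), mul_zero]
  have main := peak_bound (w := fun y => v y * f (‖y‖ ^ 2)) (x := x)
    (M := 100000 * A * √V4 * NN v r * (1 + r / ‖x‖ ^ 3))
    (integ _ (by fun_prop) (fun y hy => f0 _ hy)) (by fun_prop) ?_
  · simp only [fx, mul_one] at main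
    refine main.trans (le_of_eq ?_)
    ring
  intro e he
  have hd : ∀ y : E4, ‖y - x‖ ^ 2 + e ≠ 0 := fun y => by positivity
  have cg1 : Continuous fun y : E4 => -1 / (‖y - x‖ ^ 2 + e) ^ 2 :=
    Continuous.div (by fun_prop) (by fun_prop) (fun y => pow_ne_zero _ (hd y))
  have cg0 : Continuous fun y : E4 => 1 / (‖y - x‖ ^ 2 + e) :=
    Continuous.div (by fun_prop) (by fun_prop) hd
  have cg3 : Continuous fun y : E4 => 8 * e / (‖y - x‖ ^ 2 + e) ^ 3 :=
    Continuous.div (by fun_prop) (by fun_prop) (fun y => pow_ne_zero _ (hd y))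
  let Fp : ℝ → ℝ → ℝ := fun q t => s' (t / q) * (1 / q)
  let Fpp : ℝ → ℝ → ℝ := fun q t => s'' (t / q) * (1 / q) * (1 / q)
  have cFp : ∀ q, Continuous (Fp q) := fun q => by fun_prop
  have cFpp : ∀ q, Continuous (Fpp q) := fun q => by fun_prop
  let G : ℝ → E4 → ℝ := fun q y =>
    8 * inner ℝ y (y - x) * Fp q (‖y‖ ^ 2) * (-1 / (‖y - x‖ ^ 2 + e) ^ 2) +
      1 / (‖y - x‖ ^ 2 + e) * (8 * Fp q (‖y‖ ^ 2) + 4 * ‖y‖ ^ 2 * Fpp q (‖y‖ ^ 2))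
  let H : E4 → ℝ := fun y => 8 * Fp (r ^ 2) (‖y‖ ^ 2) + 4 * ‖y‖ ^ 2 * Fpp (r ^ 2) (‖y‖ ^ 2)
  have cG : ∀ q, Continuous (G q) := fun q => by
    have := cFp q
    have := cFpp q
    have h1 : Continuous fun y : E4 => 8 * inner ℝ y (y - x) * Fp q (‖y‖ ^ 2) := by fun_prop
    have h2 : Continuous fun y : E4 => (8 * Fp q (‖y‖ ^ 2) + 4 * ‖y‖ ^ 2 * Fpp q (‖y‖ ^ 2)) := by fun_prop
    exact (h1.mul cg1).add (cg0.mul h2)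
  have cH : Continuous H := by
    have := cFp (r ^ 2)
    have := cFpp (r ^ 2)
    fun_prop
  have Fp0 : ∀ q > 0, ∀ t, t ∉ Icc (6/5 * q) (2 * q) → Fp q t = 0 := zz1
  have Fpp0 : ∀ q > 0, ∀ t, t ∉ Icc (6/5 * q) (2 * q) → Fpp q t = 0 := zz2
  have G0 : ∀ q > 0, ∀ y : E4, ‖y‖ ^ 2 ∉ Icc (6/5 * q) (2 * q) → G q y = 0 := by
    intro q hq y hy
    simp only [G, Fp0 q hq _ hy, Fpp0 q hq _ hy]; simp
  have H0 : ∀ y : E4, ‖y‖ ^ 2 ∉ Icc (6/5 * r ^ 2) (2 * r ^ 2) → H y = 0 := by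
    intro y hy
    simp only [H, Fp0 _ hr2 _ hy, Fpp0 _ hr2 _ hy]; simp
  have iG1 := integ (G (r ^ 2)) (cG _) (fun y hy => G0 _ hr2 y (sub1 _ hy))
  have iG2 := integ (G (4/9)) (cG _) (fun y hy => G0 _ (by norm_num) y (sub2 _ hy))
  have iH := integ H cH (fun y hy => H0 y (sub1 _ hy))
  have i0 := integ (fun y => f (‖y‖ ^ 2) * (8 * e / (‖y - x‖ ^ 2 + e) ^ 3))
    ((cf.comp (by fun_prop)).mul cg3) (fun y hy => by rw [f0 _ hy, zero_mul])
  have te : ∀ t : ℝ, 0 ≤ t → t + e ≠ 0 := fun t ht => by positivity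
  have W := weak_explicit hr hu (f := f) (f' := fun t => Fp (r ^ 2) t - Fp (4/9) t)
    (f'' := fun t => Fpp (r ^ 2) t - Fpp (4/9) t) (g := fun t => 1 / (t + e))
    (g' := fun t => -1 / (t + e) ^ 2) (g'' := fun t => 2 / (t + e) ^ 3)
    (a := 6/5 * r ^ 2) (b := 8/9) (by linarith) (by norm_num)
    (fun t => (d0 _ hr2 t).sub (d0 _ (by norm_num) t))
    (fun t => (d1 _ hr2 t).sub (d1 _ (by norm_num) t))
    ((cFpp _).sub (cFpp _)) f0
    (fun t ht => by simp only [Fp0 _ hr2 _ (sub1 _ ht), Fp0 (4/9) (by norm_num) _ (sub2 _ ht)]; simp)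
    (fun t ht => by simp only [Fpp0 _ hr2 _ (sub1 _ ht), Fpp0 (4/9) (by norm_num) _ (sub2 _ ht)]; simp)
    (fun t ht => by
      have h1 : HasDerivAt (fun t => t + e) 1 t := (hasDerivAt_id t).add_const e
      have := (hasDerivAt_const t (1:ℝ)).div h1 (te t ht)
      refine this.congr_deriv ?_
      simp)
    (fun t ht => by
      have h1 : HasDerivAt (fun t => t + e) 1 t := (hasDerivAt_id t).add_const e
      have := (hasDerivAt_const t (-1:ℝ)).div (h1.pow 2) (pow_ne_zero _ (te t ht))
      refine this.congr_deriv ?_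
      have := te t ht
      simp
      field_simp)
    (ContinuousOn.div (by fun_prop) (by fun_prop) (fun t ht => pow_ne_zero _ (te t ht))) x
  have split : ∫ y, v y * (f (‖y‖ ^ 2) * (8 * e / (‖y - x‖ ^ 2 + e) ^ 3)) =
      (∫ y, v y * G (r ^ 2) y) - ∫ y, v y * G (4/9) y := by
    have i3 : Integrable (fun y => v y * G (r ^ 2) y - v y * G (4/9) y) := iG1.sub iG2
    rw [← integral_sub iG1 iG2, ← sub_eq_zero, ← integral_sub i0 i3, ← neg_eq_zero,
      ← integral_neg]
    rw [← W]
    congr 1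
    ext y
    have := hd y
    simp only [G]
    field_simp
    ring
  have mz : ∫ y, v y * H y = 0 := mean_zero hv hr hr8 hu m1 mr (a := 6/5 * r ^ 2) (b := 2 * r ^ 2)
    (by linarith) (by linarith) (d1 _ hr2) (cFpp _) (zz1 _ hr2) (zz2 _ hr2)
  have split2 : ∫ y, v y * G (r ^ 2) y = ∫ y, v y * (G (r ^ 2) y - 1 / (‖x‖ ^ 2 + e) * H y) := by
    have : ∫ y, v y * G (r ^ 2) y =
        (∫ y, v y * G (r ^ 2) y) - ∫ y, 1 / (‖x‖ ^ 2 + e) * (v y * H y) := by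
      rw [integral_const_mul, mz]; simp
    rw [this, ← integral_sub iG1 (iH.const_mul _)]
    congr 1
    ext y
    ring
  have bIn : |∫ y, v y * (G (r ^ 2) y - 1 / (‖x‖ ^ 2 + e) * H y)| ≤
      2000 * A / (r * ‖x‖ ^ 3) * (2 * r ^ 2 * √V4) * NN v r := by
    apply shell_L2 hv (a := 6/5 * r ^ 2) (by linarith) (by linarith) (by linarith) (by positivity)
    · intro y hy
      have := inner_bd (x := x) (y := y) (F := Fp (r ^ 2) (‖y‖ ^ 2)) (F' := Fpp (r ^ 2) (‖y‖ ^ 2))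
        he hr hx1 hy.2 (A := A) ?_ ?_ hA
      · refine le_trans (le_of_eq ?_) this
        congr 1
        simp only [G, H]
        ring
      · simp only [Fp]
        rw [abs_mul, abs_of_pos (by positivity : 0 < 1 / r ^ 2), mul_one_div]
        gcongr
        exact b1 _
      · simp only [Fpp]
        rw [mul_assoc, abs_mul, abs_of_pos (by positivity : 0 < 1 / r ^ 2 * (1 / r ^ 2)),
          show 1 / r ^ 2 * (1 / r ^ 2) = 1 / r ^ 4 by field_simp, mul_one_div]
        gcongr
        exact b2 _
    · intro y hy
      rw [G0 _ hr2 y hy, H0 y hy]; simp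
  have bOut : |∫ y, v y * G (4/9) y| ≤ 100000 * A * (8/9 * √V4) * NN v r := by
    apply shell_L2 hv (a := 6/5 * (4/9)) (by linarith) (by norm_num) (by norm_num) (by positivity)
    · intro y hy
      have h1 := hy.1
      have h2 := hy.2
      refine outer_bd he hx2 (by linarith) (by linarith) ?_ ?_ hA
      · simp only [Fp]
        rw [abs_mul, abs_of_pos (by norm_num : (0:ℝ) < 1 / (4/9))]
        have := b1 (‖y‖ ^ 2 / (4/9))
        nlinarith
      · simp only [Fpp]
        rw [mul_assoc, abs_mul, abs_of_pos (by norm_num : (0:ℝ) < 1 / (4/9) * (1 / (4/9)))]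
        have := b2 (‖y‖ ^ 2 / (4/9))
        nlinarith
    · intro y hy
      exact G0 (4/9) (by norm_num) y (by convert hy using 2; norm_num)
  have e0 : (fun y => v y * f (‖y‖ ^ 2) * (8 * e / (‖y - x‖ ^ 2 + e) ^ 3)) =
      fun y => v y * (f (‖y‖ ^ 2) * (8 * e / (‖y - x‖ ^ 2 + e) ^ 3)) := by
    ext y; ring
  rw [e0, split, split2]
  refine (abs_sub _ _).trans ((add_le_add bIn bOut).trans ?_)
  have q1 : 2000 * A / (r * ‖x‖ ^ 3) * (2 * r ^ 2 * √V4) * NN v r =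
      4000 * (A * √V4 * NN v r * (r / ‖x‖ ^ 3)) := by field_simp; ring
  rw [q1]
  have p1 : 0 ≤ A * √V4 * NN v r * (r / ‖x‖ ^ 3) := by positivity
  have p2 : 0 ≤ A * √V4 * NN v r := by positivity
  nlinarith


lemma rpow_calc {M r : ℝ} (hM : 0 ≤ M) (hr : 0 < r) :
    (2 * M * r) ^ (2/3:ℝ) * (M / r ^ 2) ^ (1/3:ℝ) ≤ 2 * M := by
  have h1 : (2 * M * r) ^ (2/3:ℝ) = ((2 * M * r) ^ 2) ^ (1/3:ℝ) := by
    rw [← Real.rpow_natCast, ← Real.rpow_mul (by positivity)]; norm_num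
  rw [h1, ← Real.mul_rpow (by positivity) (by positivity)]
  have h2 : (2 * M * r) ^ 2 * (M / r ^ 2) = 4 * M ^ 3 := by field_simp; ring
  rw [h2]
  calc (4 * M ^ 3) ^ (1/3:ℝ) ≤ ((2 * M) ^ 3) ^ (1/3:ℝ) := by
        apply Real.rpow_le_rpow (by positivity) _ (by norm_num)
        have : 0 ≤ M ^ 3 := by positivity
        nlinarith
    _ = 2 * M := by
        rw [← Real.rpow_natCast, ← Real.rpow_mul (by positivity)]; norm_num

lemma sqrt_vol (R : ℝ) (_hR : 0 ≤ R) :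
    (ENNReal.ofReal (R ^ 4 * V4)) ^ (1/2:ℝ) = ENNReal.ofReal (√V4 * R ^ 2) := by
  have := V4_pos
  rw [ENNReal.ofReal_rpow_of_nonneg (by positivity) (by norm_num), ← Real.sqrt_eq_rpow]
  congr 1
  rw [show R ^ 4 * V4 = V4 * (R ^ 2) ^ 2 by ring, Real.sqrt_mul V4_pos.le, Real.sqrt_sq (by positivity)]

lemma Lam_bound {u : E4 → ℝ} {M r : ℝ} (hM : 0 ≤ M) (hr : 0 < r) (hr8 : r < 1/8)
    (h : ∀ x : E4, 2 * r < ‖x‖ → ‖x‖ < 1/2 → |u x| ≤ M * (1 + r / ‖x‖ ^ 3)) :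
    Lam {x : E4 | 2 * r < ‖x‖ ∧ ‖x‖ < 1 / 2} u ≤ ENNReal.ofReal (8 * √V4 * M) := by
  have hV := V4_pos
  have key : ∀ l ∈ Ioi (0:ℝ), (volume {x | x ∈ {x : E4 | 2 * r < ‖x‖ ∧ ‖x‖ < 1 / 2} ∧ l < |u x|}) ^ ((1 : ℝ) / 2)
      ≤ (Ioc 0 (2 * M)).indicator (fun _ => ENNReal.ofReal (√V4)) l +
        (Ioc 0 (M / r ^ 2)).indicator
          (fun l => ENNReal.ofReal (√V4 * (2 * M * r) ^ (2/3:ℝ) * l ^ (-2/3:ℝ))) l := by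
    intro l hl
    have hl' : 0 < l := hl
    by_cases h1 : l ≤ 2 * M
    · rw [indicator_of_mem (show l ∈ Ioc 0 (2 * M) from ⟨hl, h1⟩)]
      refine le_trans ?_ le_self_add
      have e := sqrt_vol 1 (by norm_num)
      rw [one_pow, one_mul, one_pow, mul_one] at e
      rw [← e]
      apply ENNReal.rpow_le_rpow _ (by norm_num)
      have e2 := ball_vol 1 (by norm_num)
      rw [one_pow, one_mul] at e2
      rw [← e2]
      apply measure_mono
      rintro x ⟨⟨_, hx⟩, _⟩
      simp only [Metric.mem_ball, dist_zero_right]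
      linarith
    · push Not at h1
      by_cases h2 : l ≤ M / r ^ 2
      · rw [indicator_of_mem (show l ∈ Ioc 0 (M / r ^ 2) from ⟨hl, h2⟩)]
        refine le_trans ?_ le_add_self
        have hq : 0 ≤ 2 * M * r / l := by positivity
        have e : √V4 * (2 * M * r) ^ (2/3:ℝ) * l ^ (-2/3:ℝ) = √V4 * ((2 * M * r / l) ^ (1/3:ℝ)) ^ 2 := by
          rw [← Real.rpow_natCast, ← Real.rpow_mul hq, Real.div_rpow (by positivity) hl'.le,
            show (-2/3:ℝ) = -(2/3) by norm_num, Real.rpow_neg hl'.le]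
          norm_num
          ring
        rw [e, ← sqrt_vol _ (by positivity), ← cball_vol _ (by positivity)]
        apply ENNReal.rpow_le_rpow _ (by norm_num)
        apply measure_mono
        rintro x ⟨⟨hx1, hx2⟩, hx3⟩
        simp only [Metric.mem_closedBall, dist_zero_right]
        have hX : 0 < ‖x‖ := by linarith
        have h3 := h x hx1 hx2
        have h4 : l ≤ 2 * M * r / ‖x‖ ^ 3 := by
          have : M * (1 + r / ‖x‖ ^ 3) = M + (2 * M * r / ‖x‖ ^ 3) / 2 := by field_simp
          linarith
        have h5 : ‖x‖ ^ 3 ≤ 2 * M * r / l := by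
          rw [le_div_iff₀ (by positivity)] at h4 ⊢
          linarith
        calc ‖x‖ = (‖x‖ ^ 3) ^ (1/3:ℝ) := by
              rw [← Real.rpow_natCast, ← Real.rpow_mul hX.le]; norm_num
          _ ≤ _ := Real.rpow_le_rpow (by positivity) h5 (by norm_num)
      · push Not at h2
        have : {x | x ∈ {x : E4 | 2 * r < ‖x‖ ∧ ‖x‖ < 1 / 2} ∧ l < |u x|} = ∅ := by
          rw [eq_empty_iff_forall_notMem]
          rintro x ⟨⟨hx1, hx2⟩, hx3⟩
          have hX : 0 < ‖x‖ := by linarith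
          have h3 := h x hx1 hx2
          have h4 : r / ‖x‖ ^ 3 ≤ r / (2 * r) ^ 3 := by gcongr
          have h5 : r / (2 * r) ^ 3 = 1 / 8 * (1 / r ^ 2) := by field_simp; norm_num
          have h6 : 64 ≤ 1 / r ^ 2 := by
            rw [le_div_iff₀ (by positivity)]; nlinarith
          have h7 : M * (1 + r / ‖x‖ ^ 3) ≤ M * (1 / r ^ 2) := by
            gcongr
            linarith
          rw [mul_one_div] at h7
          linarith
        rw [this]
        simp
  unfold Lam
  refine (setLIntegral_mono' measurableSet_Ioi key).trans ?_
  refine (setLIntegral_le_lintegral _ _).trans ?_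
  rw [lintegral_add_left (measurable_const.indicator measurableSet_Ioc),
    lintegral_indicator measurableSet_Ioc, lintegral_indicator measurableSet_Ioc]
  have i1 : ∫⁻ _ in Ioc 0 (2 * M), ENNReal.ofReal (√V4) = ENNReal.ofReal (√V4 * (2 * M)) := by
    rw [setLIntegral_const, Real.volume_Ioc, sub_zero, ← ENNReal.ofReal_mul (by positivity)]
  have i2 : ∫⁻ l in Ioc 0 (M / r ^ 2), ENNReal.ofReal (√V4 * (2 * M * r) ^ (2/3:ℝ) * l ^ (-2/3:ℝ)) ≤
      ENNReal.ofReal (√V4 * (6 * M)) := by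
    have hL : 0 ≤ M / r ^ 2 := by positivity
    have hint : IntervalIntegrable (fun l : ℝ => √V4 * (2 * M * r) ^ (2/3:ℝ) * l ^ (-2/3:ℝ)) volume 0 (M / r ^ 2) :=
      (intervalIntegral.intervalIntegrable_rpow' (by norm_num)).const_mul _
    rw [← ofReal_integral_eq_lintegral_ofReal ((intervalIntegrable_iff_integrableOn_Ioc_of_le hL).1 hint)]
    · apply ENNReal.ofReal_le_ofReal
      rw [← intervalIntegral.integral_of_le hL, intervalIntegral.integral_const_mul,
        integral_rpow (Or.inl (by norm_num))]
      have h0 : (0:ℝ) ^ (-2/3 + 1 : ℝ) = 0 := Real.zero_rpow (by norm_num)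
      rw [h0, sub_zero, show (-2/3 + 1 : ℝ) = 1/3 by norm_num]
      have := rpow_calc hM hr
      calc _ = √V4 * (3 * ((2 * M * r) ^ (2/3:ℝ) * (M / r ^ 2) ^ (1/3:ℝ))) := by ring
        _ ≤ √V4 * (3 * (2 * M)) := by gcongr
        _ = _ := by ring
    · filter_upwards [ae_restrict_mem measurableSet_Ioc] with l hl
      have := hl.1
      simp only [Pi.zero_apply]
      positivity
  rw [i1]
  refine (add_le_add le_rfl i2).trans ?_
  rw [← ENNReal.ofReal_add (by positivity) (by positivity)]
  apply ENNReal.ofReal_le_ofReal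
  linarith


theorem harmonic_annulus_L21_estimate :
    ∃ C : ℝ, 0 < C ∧
      ∀ (r : ℝ), r ∈ Set.Ioo (0 : ℝ) (1 / 8) →
      ∀ u : EuclideanSpace ℝ (Fin 4) → ℝ,
        ContinuousOn u {x | r ≤ ‖x‖ ∧ ‖x‖ ≤ 1} →
        IsHarmonicOn u {x | r < ‖x‖ ∧ ‖x‖ < 1} →
        (∫ x in Metric.sphere (0 : EuclideanSpace ℝ (Fin 4)) 1,
            u x ∂(μH[(3 : ℝ)])) = 0 →
        (∫ x in Metric.sphere (0 : EuclideanSpace ℝ (Fin 4)) r,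
            u x ∂(μH[(3 : ℝ)])) = 0 →
        Lam {x | 2 * r < ‖x‖ ∧ ‖x‖ < 1 / 2} u ≤
          ENNReal.ofReal C *
            eLpNorm u 2 (volume.restrict {x | r < ‖x‖ ∧ ‖x‖ < 1}) := by
  obtain ⟨K, hK, hpt⟩ := pointwise
  have hV := V4_pos
  refine ⟨8 * √V4 * K, by positivity, ?_⟩
  rintro r ⟨hr, hr8⟩ u cu hu h1 h2
  have hcl : IsClosed {x : E4 | r ≤ ‖x‖ ∧ ‖x‖ ≤ 1} :=
    (isClosed_le continuous_const continuous_norm).inter (isClosed_le continuous_norm continuous_const)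
  have hop : IsOpen {x : E4 | r < ‖x‖ ∧ ‖x‖ < 1} :=
    (isOpen_lt continuous_const continuous_norm).inter (isOpen_lt continuous_norm continuous_const)
  obtain ⟨V, hV2⟩ := ContinuousMap.exists_restrict_eq hcl
    (⟨_, continuousOn_iff_continuous_domRestrict.1 cu⟩ : C({x : E4 | r ≤ ‖x‖ ∧ ‖x‖ ≤ 1}, ℝ))
  let v : E4 → ℝ := fun x => V x
  have hv : Continuous v := V.continuous
  have vu : ∀ x : E4, r ≤ ‖x‖ → ‖x‖ ≤ 1 → v x = u x := fun x a b => by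
    have := DFunLike.congr_fun hV2 (⟨x, a, b⟩ : {x : E4 | r ≤ ‖x‖ ∧ ‖x‖ ≤ 1})
    exact this
  have vuo : ∀ x ∈ {x : E4 | r < ‖x‖ ∧ ‖x‖ < 1}, v x = u x := fun x hx => vu x hx.1.le hx.2.le
  have hvh : IsHarmonicOn v {x | r < ‖x‖ ∧ ‖x‖ < 1} := by
    refine ⟨hu.1.congr vuo, fun x hx => ?_⟩
    rw [← hu.2 x hx]
    refine Finset.sum_congr rfl fun i _ => ?_
    have : (fun y => fderiv ℝ v y (EuclideanSpace.single i (1 : ℝ))) =ᶠ[nhds x]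
        fun y => fderiv ℝ u y (EuclideanSpace.single i (1 : ℝ)) := by
      filter_upwards [hop.mem_nhds hx] with y hy
      have e : v =ᶠ[nhds y] u := by
        filter_upwards [hop.mem_nhds hy] with z hz
        exact vuo z hz
      rw [e.fderiv_eq]
    rw [this.fderiv_eq]
  have sph : ∀ ρ : ℝ, r ≤ ρ → ρ ≤ 1 → (∫ x in Metric.sphere (0 : E4) ρ, u x ∂(μH[(3 : ℝ)])) = 0 →
      mm v ρ = 0 := by
    intro ρ ha hb h
    apply mm_eq_sphere (by linarith)
    rw [← h]
    apply setIntegral_congr_fun Metric.isClosed_sphere.measurableSet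
    intro x hx
    have : ‖x‖ = ρ := by simpa using hx
    exact vu x (by linarith) (by linarith)
  have P := hpt v hv r hr hr8 hvh (sph 1 (by linarith) le_rfl h1) (sph r le_rfl (by linarith) h2)
  have hN : 0 ≤ NN v r := ENNReal.toReal_nonneg
  have L := Lam_bound (u := u) (M := K * NN v r) (by positivity) hr hr8 (fun x a b => by
    rw [← vu x (by linarith) (by linarith)]
    exact P x a b)
  refine L.trans (le_of_eq ?_)
  have e1 : eLpNorm u 2 (volume.restrict {x : E4 | r < ‖x‖ ∧ ‖x‖ < 1}) =
      eLpNorm v 2 (volume.restrict {x : E4 | r < ‖x‖ ∧ ‖x‖ < 1}) := by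
    apply eLpNorm_congr_ae
    filter_upwards [ae_restrict_mem hop.measurableSet] with x hx
    exact (vuo x hx).symm
  rw [e1, ← mul_assoc, ENNReal.ofReal_mul (by positivity), NN,
    ENNReal.ofReal_toReal (memLp_ann hv r).eLpNorm_ne_top]
end
end

section
/- There exists a constant C > 0 such that for every r ∈ (0, 1/8) and every function u that is continuous on the closed annulus {x ∈ ℝ⁴ : r ≤ |x| ≤ 1}, harmonic on the open annulus A(r,1) = {x ∈ ℝ⁴ : r < |x| < 1}, and satisfies ∫_{|x|=1} u dσ = 0 and ∫_{|x|=r} u dσ = 0, one has Λ_{A(2r,1/2)}(|∇ᵀ∇u|) ≤ C · ‖|∇ᵀ∇u|‖_{L²(A(r,1))}, where C is independent of r and of u. -/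
open MeasureTheory Filter Set ENNReal

noncomputable section

/-- The Hessian matrix `∇²u(x)`, whose `(i,j)` entry is `∂ᵢ∂ⱼ u (x)`. -/
def hess (u : EuclideanSpace ℝ (Fin 4) → ℝ) (x : EuclideanSpace ℝ (Fin 4))
    (i j : Fin 4) : ℝ :=
  fderiv ℝ (fun y => fderiv ℝ u y (EuclideanSpace.single j (1 : ℝ))) x
    (EuclideanSpace.single i (1 : ℝ))

/-- The tangential part `P_x ∇²u(x)` of the Hessian, where
`P_x = Id - |x|⁻² x xᵀ` projects onto the tangent space of the sphere through `x`. -/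
def tangHess (u : EuclideanSpace ℝ (Fin 4) → ℝ) (x : EuclideanSpace ℝ (Fin 4))
    (i j : Fin 4) : ℝ :=
  hess u x i j - (‖x‖ ^ 2)⁻¹ * x i * (∑ k : Fin 4, x k * hess u x k j)

/-- The Frobenius norm `|∇ᵀ∇u(x)|` of the tangential part of the Hessian. -/
def tangHessNorm (u : EuclideanSpace ℝ (Fin 4) → ℝ)
    (x : EuclideanSpace ℝ (Fin 4)) : ℝ :=
  Real.sqrt (∑ i : Fin 4, ∑ j : Fin 4, (tangHess u x i j) ^ 2)


/-- partial derivative -/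
def pd (i : Fin 4) (f : E4 → ℝ) : E4 → ℝ :=
  fun y => fderiv ℝ f y (EuclideanSpace.single i (1 : ℝ))

lemma pd_contDiff {f : E4 → ℝ} {m n : ℕ∞} (hf : ContDiff ℝ n f) (hmn : m + 1 ≤ n) (i : Fin 4) :
    ContDiff ℝ m (pd i f) := by
  have : ContDiff ℝ m (fderiv ℝ f) := hf.fderiv_right (by exact_mod_cast hmn)
  exact this.clm_apply contDiff_const

lemma pd_smooth {f : E4 → ℝ} (hf : ContDiff ℝ (⊤ : ℕ∞) f) (i : Fin 4) :
    ContDiff ℝ (⊤ : ℕ∞) (pd i f) := pd_contDiff hf (by simp) i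

lemma pd_hcs {f : E4 → ℝ} (hf : HasCompactSupport f) (i : Fin 4) : HasCompactSupport (pd i f) :=
  hf.fderiv_apply ℝ _

lemma pd_congr {f g : E4 → ℝ} {y : E4} (h : f =ᶠ[nhds y] g) (i : Fin 4) :
    pd i f =ᶠ[nhds y] pd i g := by
  filter_upwards [h.fderiv (𝕜 := ℝ)] with z hz
  simp [pd, hz]

lemma pd_const_ev {f : E4 → ℝ} {y : E4} {c : ℝ} (h : f =ᶠ[nhds y] fun _ => c) (i : Fin 4) :
    pd i f =ᶠ[nhds y] fun _ => 0 := by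
  refine (pd_congr h i).trans ?_
  filter_upwards with z
  simp [pd]

lemma pd_comm_at {f : E4 → ℝ} {x : E4} (hf : ContDiffAt ℝ 2 f x) (i j : Fin 4) :
    pd i (pd j f) x = pd j (pd i f) x := by
  have hs := hf.isSymmSndFDerivAt (by simp)
  have hd : DifferentiableAt ℝ (fderiv ℝ f) x :=
    (hf.fderiv_right (m := 1) (by norm_num)).differentiableAt (by simp)
  have key : ∀ a b : Fin 4, pd a (pd b f) x =
      fderiv ℝ (fderiv ℝ f) x (EuclideanSpace.single a 1) (EuclideanSpace.single b 1) := by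
    intro a b
    unfold pd
    rw [fderiv_clm_apply hd (differentiableAt_const _)]
    simp
  rw [key, key]
  exact hs _ _

lemma pd_comm {f : E4 → ℝ} (hf : ContDiff ℝ (⊤ : ℕ∞) f) (i j : Fin 4) :
    pd i (pd j f) = pd j (pd i f) := by
  ext x
  exact pd_comm_at (hf.contDiffAt.of_le (WithTop.coe_le_coe.2 (le_top : (2 : ℕ∞) ≤ ⊤))) i j

lemma ibp {f g : E4 → ℝ} (hf : ContDiff ℝ 1 f) (hfc : HasCompactSupport f) (hg : ContDiff ℝ 1 g)
    (i : Fin 4) : ∫ x, pd i f x * g x = - ∫ x, f x * pd i g x := by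
  have h1 : Continuous (pd i f) := (pd_contDiff (m := 0) (n := 1) hf (by simp) i).continuous
  have h2 : Continuous (pd i g) := (pd_contDiff (m := 0) (n := 1) hg (by simp) i).continuous
  have := integral_mul_fderiv_eq_neg_fderiv_mul_of_integrable (μ := (volume : Measure E4))
    (f := f) (g := g) (v := EuclideanSpace.single i (1 : ℝ))
    ((h1.mul hg.continuous).integrable_of_hasCompactSupport ((pd_hcs hfc i).mul_right))
    ((hf.continuous.mul h2).integrable_of_hasCompactSupport (hfc.mul_right))
    ((hf.continuous.mul hg.continuous).integrable_of_hasCompactSupport (hfc.mul_right))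
    (fun x _ => hf.differentiable (by simp) x) (fun x _ => hg.differentiable (by simp) x)
  unfold pd
  rw [this, neg_neg]

lemma ibp2 {U ψ : E4 → ℝ} (hU : ContDiff ℝ 2 U) (hUc : HasCompactSupport U)
    (hψ : ContDiff ℝ (⊤ : ℕ∞) ψ) (i j : Fin 4) :
    ∫ x, pd i (pd j U) x * ψ x = ∫ x, U x * pd j (pd i ψ) x := by
  have hU1 : ContDiff ℝ 1 U := hU.of_le (by norm_num)
  have s : ∀ {f : E4 → ℝ}, ContDiff ℝ (⊤ : ℕ∞) f → ContDiff ℝ 1 f :=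
    fun h => h.of_le (by exact_mod_cast le_top)
  rw [ibp (pd_contDiff (m := 1) (n := 2) hU (by norm_num) j) (pd_hcs hUc j) (s hψ),
    ibp hU1 hUc (s (pd_smooth hψ i)), neg_neg]

lemma ibp4 {U ψ : E4 → ℝ} (hU : ContDiff ℝ 2 U) (hUc : HasCompactSupport U)
    (hψ : ContDiff ℝ (⊤ : ℕ∞) ψ) (i j k : Fin 4) :
    ∫ x, pd i (pd j U) x * pd k (pd k ψ) x = ∫ x, pd k (pd k U) x * pd i (pd j ψ) x := by
  rw [ibp2 hU hUc (pd_smooth (pd_smooth hψ k) k), ibp2 hU hUc (pd_smooth (pd_smooth hψ j) i)]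
  rw [pd_comm (pd_smooth hψ k) i k, pd_comm hψ i k,
    pd_comm (pd_smooth (pd_smooth hψ i) k) j k, pd_comm (pd_smooth hψ i) j k, pd_comm hψ j i]

/-- Laplacian -/
def lap (f : E4 → ℝ) : E4 → ℝ := fun y => ∑ k, pd k (pd k f) y

lemma weak_id {U ψ : E4 → ℝ} (hU : ContDiff ℝ 2 U) (hUc : HasCompactSupport U)
    (hψ : ContDiff ℝ (⊤ : ℕ∞) ψ) (i j : Fin 4)
    (h0 : ∀ y, lap U y * pd i (pd j ψ) y = 0) :
    ∫ x, pd i (pd j U) x * lap ψ x = 0 := by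
  have hc : ∀ a b, Continuous (pd a (pd b U)) := fun a b =>
    (pd_contDiff (m := 0) (n := 1) (pd_contDiff (m := 1) (n := 2) hU (by norm_num) b)
      (by simp) a).continuous
  have hcs : ∀ a b, HasCompactSupport (pd a (pd b U)) := fun a b => pd_hcs (pd_hcs hUc b) a
  have hcψ : ∀ a b, Continuous (pd a (pd b ψ)) := fun a b =>
    (pd_smooth (pd_smooth hψ b) a).continuous
  unfold lap
  simp_rw [Finset.mul_sum]
  rw [integral_finsetSum]
  · rw [Finset.sum_congr rfl (fun k _ => ibp4 hU hUc hψ i j k)]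
    rw [← integral_finsetSum]
    · simp_rw [← Finset.sum_mul]
      rw [← integral_zero E4 ℝ]
      congr 1
      ext y
      exact h0 y
    · intro k _
      exact ((hc k k).mul (hcψ i j)).integrable_of_hasCompactSupport ((hcs k k).mul_right)
  · intro k _
    exact ((hc i j).mul (hcψ k k)).integrable_of_hasCompactSupport ((hcs i j).mul_right)

lemma pd_mul {f g : E4 → ℝ} (hf : Differentiable ℝ f) (hg : Differentiable ℝ g) (i : Fin 4) :
    pd i (fun y => f y * g y) = fun y => f y * pd i g y + g y * pd i f y := by
  ext y
  unfold pd
  rw [fderiv_fun_mul (hf y) (hg y)]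
  simp

lemma pd_add {f g : E4 → ℝ} (hf : Differentiable ℝ f) (hg : Differentiable ℝ g) (i : Fin 4) :
    pd i (fun y => f y + g y) = fun y => pd i f y + pd i g y := by
  ext y
  unfold pd
  rw [fderiv_fun_add (hf y) (hg y)]
  simp

lemma pd_sub {f g : E4 → ℝ} (hf : Differentiable ℝ f) (hg : Differentiable ℝ g) (i : Fin 4) :
    pd i (fun y => f y - g y) = fun y => pd i f y - pd i g y := by
  ext y
  unfold pd
  rw [fderiv_fun_sub (hf y) (hg y)]
  simp

lemma smooth_diff {f : E4 → ℝ} (hf : ContDiff ℝ (⊤ : ℕ∞) f) : Differentiable ℝ f :=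
  hf.differentiable (by simp)

lemma lap_mul {f g : E4 → ℝ} (hf : ContDiff ℝ (⊤ : ℕ∞) f) (hg : ContDiff ℝ (⊤ : ℕ∞) g) (y : E4) :
    lap (fun y => f y * g y) y =
      f y * lap g y + (2 * (∑ k, pd k f y * pd k g y) + g y * lap f y) := by
  unfold lap
  have : ∀ k, pd k (pd k (fun y => f y * g y)) y = f y * pd k (pd k g) y +
      (2 * (pd k f y * pd k g y) + g y * pd k (pd k f) y) := by
    intro k
    have hf' := pd_smooth hf k
    have hg' := pd_smooth hg k
    rw [pd_mul (smooth_diff hf) (smooth_diff hg),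
      pd_add (smooth_diff (hf.mul hg')) (smooth_diff (hg.mul hf')),
      pd_mul (smooth_diff hf) (smooth_diff hg'), pd_mul (smooth_diff hg) (smooth_diff hf')]
    ring
  simp_rw [this, Finset.sum_add_distrib, Finset.mul_sum]

lemma lap_sub {f g : E4 → ℝ} (hf : ContDiff ℝ (⊤ : ℕ∞) f) (hg : ContDiff ℝ (⊤ : ℕ∞) g) (y : E4) :
    lap (fun y => f y - g y) y = lap f y - lap g y := by
  unfold lap
  rw [← Finset.sum_sub_distrib]
  refine Finset.sum_congr rfl fun k _ => ?_
  rw [pd_sub (smooth_diff hf) (smooth_diff hg),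
    pd_sub (smooth_diff (pd_smooth hf k)) (smooth_diff (pd_smooth hg k))]

lemma pd_scale {f : E4 → ℝ} (c : ℝ) (i : Fin 4) :
    pd i (fun y => f (c • y)) = fun y => c * pd i f (c • y) := by
  ext y
  unfold pd
  rw [fderiv_comp_smul]
  simp

lemma lap_scale {f : E4 → ℝ} (hf : ContDiff ℝ (⊤ : ℕ∞) f) (c : ℝ) (y : E4) :
    lap (fun y => f (c • y)) y = c ^ 2 * lap f (c • y) := by
  unfold lap
  rw [Finset.mul_sum]
  refine Finset.sum_congr rfl fun k _ => ?_
  rw [pd_scale]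
  have hs : ContDiff ℝ (⊤ : ℕ∞) (fun y => pd k f (c • y)) :=
    (pd_smooth hf k).comp (contDiff_const_smul c)
  rw [pd_mul (differentiable_const _) (smooth_diff hs), pd_scale]
  simp [pd]
  ring

/-- regularized fundamental solution -/
def Gk (e : ℝ) (x : E4) : E4 → ℝ := fun y => (‖x - y‖ ^ 2 + e ^ 2)⁻¹

lemma Gk_smooth {e : ℝ} (he : 0 < e) (x : E4) : ContDiff ℝ (⊤ : ℕ∞) (Gk e x) := by
  unfold Gk
  refine ContDiff.inv ?_ (fun y => by positivity)
  exact ((contDiff_const.sub contDiff_id).norm_sq ℝ).add contDiff_const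

lemma Q_hasFDeriv (x y : E4) (e : ℝ) : HasFDerivAt (fun y : E4 => ‖x - y‖ ^ 2 + e ^ 2)
    (2 • (innerSL ℝ (x - y)).comp (-ContinuousLinearMap.id ℝ E4)) y := by
  have h1 : HasFDerivAt (fun y : E4 => x - y) (-ContinuousLinearMap.id ℝ E4) y :=
    (hasFDerivAt_id y).const_sub x
  exact h1.norm_sq.add_const _

lemma pd_Gk {e : ℝ} (he : 0 < e) (x : E4) (i : Fin 4) :
    pd i (Gk e x) = fun y => 2 * (x i - y i) * (Gk e x y) ^ 2 := by
  ext y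
  have hq : ‖x - y‖ ^ 2 + e ^ 2 ≠ 0 := by positivity
  have h := (hasDerivAt_inv hq).comp_hasFDerivAt y (Q_hasFDeriv x y e)
  have h' : HasFDerivAt (Gk e x) _ y := h
  unfold pd
  rw [h'.fderiv]
  unfold Gk
  simp [EuclideanSpace.inner_single_right]
  field_simp
  ring

lemma lap_Gk {e : ℝ} (he : 0 < e) (x y : E4) :
    lap (Gk e x) y = - (8 * e ^ 2 * (Gk e x y) ^ 3) := by
  have hG := Gk_smooth he x
  have hq : ‖x - y‖ ^ 2 + e ^ 2 ≠ 0 := by positivity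
  have hk : ∀ k, pd k (pd k (Gk e x)) y =
      -2 * (Gk e x y) ^ 2 + 8 * (x k - y k) ^ 2 * (Gk e x y) ^ 3 := by
    intro k
    rw [pd_Gk he]
    have hl : Differentiable ℝ (fun y : E4 => 2 * (x k - y k)) := by fun_prop
    have hG2 : ContDiff ℝ (⊤ : ℕ∞) (fun y => Gk e x y ^ 2) := hG.pow 2
    rw [pd_mul hl (smooth_diff hG2)]
    have e1 : pd k (fun y : E4 => 2 * (x k - y k)) y = -2 := by
      have : HasFDerivAt (fun y : E4 => 2 * (x k - y k))
          ((2:ℝ) • (-(EuclideanSpace.proj k : E4 →L[ℝ] ℝ))) y := by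
        have h0 : HasFDerivAt (fun y : E4 => y k) (EuclideanSpace.proj k : E4 →L[ℝ] ℝ) y :=
          (EuclideanSpace.proj k : E4 →L[ℝ] ℝ).hasFDerivAt
        exact (h0.const_sub (x k)).const_mul 2
      unfold pd
      rw [this.fderiv]
      simp
    have e2 : pd k (fun y => Gk e x y ^ 2) y = 2 * Gk e x y * pd k (Gk e x) y := by
      have := pd_mul (smooth_diff hG) (smooth_diff hG) k
      simp_rw [← pow_two] at this
      rw [this]
      ring
    simp only [e1, e2, pd_Gk he]
    ring
  unfold lap
  simp_rw [hk]
  have hn : ‖x - y‖ ^ 2 = ∑ k, (x k - y k) ^ 2 := by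
    rw [EuclideanSpace.norm_sq_eq]; simp
  rw [Finset.sum_add_distrib, ← Finset.sum_mul, ← Finset.sum_mul, ← Finset.mul_sum, ← hn]
  simp
  unfold Gk
  field_simp
  ring

def W (f g : E4 → ℝ) (y : E4) : ℝ := 2 * (∑ k, pd k f y * pd k g y) + g y * lap f y

lemma W_bound {f g : E4 → ℝ} {y : E4} {a b c d : ℝ} (h1 : ∀ k, |pd k f y| ≤ a)
    (h2 : ∀ k, |pd k g y| ≤ b) (h3 : |g y| ≤ c) (h4 : |lap f y| ≤ d) :
    |W f g y| ≤ 8 * (a * b) + c * d := by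
  have ha : 0 ≤ a := (abs_nonneg _).trans (h1 0)
  have hc : 0 ≤ c := (abs_nonneg _).trans h3
  have hs : |∑ k, pd k f y * pd k g y| ≤ 4 * (a * b) := by
    refine (Finset.abs_sum_le_sum_abs _ _).trans ?_
    have : ∀ k ∈ (Finset.univ : Finset (Fin 4)), |pd k f y * pd k g y| ≤ a * b := by
      intro k _
      rw [abs_mul]
      exact mul_le_mul (h1 k) (h2 k) (abs_nonneg _) ha
    refine (Finset.sum_le_card_nsmul _ _ _ this).trans ?_
    simp
  unfold W
  refine (abs_add_le _ _).trans ?_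
  rw [abs_mul, abs_mul]
  have : |g y| * |lap f y| ≤ c * d := mul_le_mul h3 h4 (abs_nonneg _) hc
  simp only [Nat.abs_ofNat]
  linarith

lemma lap_smooth {f : E4 → ℝ} (hf : ContDiff ℝ (⊤ : ℕ∞) f) : ContDiff ℝ (⊤ : ℕ∞) (lap f) := by
  unfold lap
  exact ContDiff.sum fun k _ => pd_smooth (pd_smooth hf k) k

lemma lap_const_ev {f : E4 → ℝ} {y : E4} {c : ℝ} (h : f =ᶠ[nhds y] fun _ => c) :
    lap f y = 0 := by
  unfold lap
  refine Finset.sum_eq_zero fun k _ => ?_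
  exact (pd_const_ev (pd_const_ev h k) k).self_of_nhds

lemma W_zero {f : E4 → ℝ} (g : E4 → ℝ) {y : E4} {c : ℝ} (h : f =ᶠ[nhds y] fun _ => c) :
    W f g y = 0 := by
  unfold W
  rw [lap_const_ev h]
  simp [(pd_const_ev h _).self_of_nhds]

lemma bump_ev_in (b : ContDiffBump (0 : E4)) {y : E4} (hy : ‖y‖ < b.rIn) :
    (b : E4 → ℝ) =ᶠ[nhds y] fun _ => 1 :=
  b.eventuallyEq_one_of_mem_ball (by simpa using hy)

lemma bump_ev_out (b : ContDiffBump (0 : E4)) {y : E4} (hy : b.rOut < ‖y‖) :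
    (b : E4 → ℝ) =ᶠ[nhds y] fun _ => 0 := by
  have : ∀ᶠ z : E4 in nhds y, b.rOut < ‖z‖ := continuous_norm.continuousAt.eventually_const_lt hy
  filter_upwards [this] with z hz
  exact b.zero_of_le_dist (by simpa using hz.le)

lemma bump_smooth (b : ContDiffBump (0 : E4)) : ContDiff ℝ (⊤ : ℕ∞) (b : E4 → ℝ) := b.contDiff

lemma bump_bound (b : ContDiffBump (0 : E4)) :
    ∃ K : ℝ, 0 < K ∧ (∀ y k, |pd k b y| ≤ K) ∧ ∀ y, |lap b y| ≤ K := by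
  have hb := bump_smooth b
  have hbs : HasCompactSupport (b : E4 → ℝ) := b.hasCompactSupport
  have h1 : ∀ k, ∃ C, ∀ y, ‖pd k b y‖ ≤ C := fun k =>
    (pd_smooth hb k).continuous.bounded_above_of_compact_support (pd_hcs hbs k)
  have h2 : ∀ k, ∃ C, ∀ y, ‖pd k (pd k b) y‖ ≤ C := fun k =>
    (pd_smooth (pd_smooth hb k) k).continuous.bounded_above_of_compact_support
      (pd_hcs (pd_hcs hbs k) k)
  choose C1 hC1 using h1
  choose C2 hC2 using h2
  have n1 : ∀ k, 0 ≤ C1 k := fun k => (norm_nonneg _).trans (hC1 k 0)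
  have n2 : ∀ k, 0 ≤ C2 k := fun k => (norm_nonneg _).trans (hC2 k 0)
  have s1 : 0 ≤ ∑ k, C1 k := Finset.sum_nonneg fun k _ => n1 k
  have s2 : 0 ≤ ∑ k, C2 k := Finset.sum_nonneg fun k _ => n2 k
  refine ⟨1 + (∑ k, C1 k) + ∑ k, C2 k, by linarith, fun y k => ?_, fun y => ?_⟩
  · have := Finset.single_le_sum (f := C1) (fun k _ => n1 k) (Finset.mem_univ k)
    have := hC1 k y
    rw [Real.norm_eq_abs] at this
    linarith
  · have : |lap b y| ≤ ∑ k, C2 k := by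
      unfold lap
      exact (Finset.abs_sum_le_sum_abs _ _).trans (Finset.sum_le_sum fun k _ => hC2 k y)
    linarith

lemma Gk_pos {e : ℝ} (he : 0 < e) (x y : E4) : 0 < Gk e x y := by
  unfold Gk; positivity

lemma Gk_le {e d : ℝ} {x y : E4} (hd : 0 < d) (h : d ≤ ‖x - y‖) :
    Gk e x y ≤ 1 / d ^ 2 := by
  unfold Gk
  rw [inv_eq_one_div]
  apply one_div_le_one_div_of_le (by positivity)
  nlinarith [sq_nonneg e]

lemma pd_Gk_le {e d : ℝ} (he : 0 < e) {x y : E4} (hd : 0 < d) (h : d ≤ ‖x - y‖) (k : Fin 4) :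
    |pd k (Gk e x) y| ≤ 2 / d ^ 3 := by
  rw [pd_Gk he]
  have hn : 0 < ‖x - y‖ := hd.trans_le h
  have h1 : |x k - y k| ≤ ‖x - y‖ := by
    have := PiLp.norm_apply_le (x - y) k
    simpa using this
  have h2 := Gk_le (e := e) hn le_rfl
  have h0 := (Gk_pos he x y).le
  calc |2 * (x k - y k) * Gk e x y ^ 2| = 2 * |x k - y k| * Gk e x y ^ 2 := by
        rw [abs_mul, abs_mul]; simp
    _ ≤ 2 * ‖x - y‖ * (1 / ‖x - y‖ ^ 2) ^ 2 := by gcongr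
    _ = 2 / ‖x - y‖ ^ 3 := by field_simp
    _ ≤ 2 / d ^ 3 := by gcongr

lemma Gk_diff {e : ℝ} (he : 0 < e) {x y : E4} (hx : 0 < ‖x‖) (h : ‖y‖ ≤ 3 / 4 * ‖x‖) :
    |Gk e x y - Gk e x 0| ≤ 44 * ‖y‖ / ‖x‖ ^ 3 := by
  have hxy : ‖x‖ / 4 ≤ ‖x - y‖ := by
    have := norm_sub_norm_le x y
    linarith
  have hxy' : ‖x - y‖ ≤ 7 / 4 * ‖x‖ := by
    have := norm_sub_le x y
    linarith
  have hdiff : |‖x‖ - ‖x - y‖| ≤ ‖y‖ := by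
    have := abs_norm_sub_norm_le x (x - y)
    simpa using this
  have hq : 0 < ‖x - y‖ ^ 2 + e ^ 2 := by positivity
  have hq0 : 0 < ‖x‖ ^ 2 + e ^ 2 := by positivity
  have e1 : Gk e x y - Gk e x 0 =
      ((‖x‖ - ‖x - y‖) * (‖x‖ + ‖x - y‖)) * (Gk e x y * Gk e x 0) := by
    unfold Gk
    rw [sub_zero]
    field_simp
    ring
  have hp1 := Gk_pos he x y
  have hp2 := Gk_pos he x 0
  have b1 : Gk e x y ≤ 1 / (‖x‖ / 4) ^ 2 := Gk_le (by positivity) hxy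
  have b2 : Gk e x 0 ≤ 1 / ‖x‖ ^ 2 := Gk_le hx (by simp)
  rw [e1, abs_mul, abs_mul, abs_of_pos (mul_pos hp1 hp2),
    abs_of_nonneg (by positivity : 0 ≤ ‖x‖ + ‖x - y‖)]
  calc _ ≤ (‖y‖ * (11 / 4 * ‖x‖)) * ((1 / (‖x‖ / 4) ^ 2) * (1 / ‖x‖ ^ 2)) := by
        gcongr
        linarith
    _ = 44 * ‖y‖ / ‖x‖ ^ 3 := by field_simp; ring

def bp1 : ContDiffBump (0 : E4) := ⟨5 / 4, 3 / 2, by norm_num, by norm_num⟩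
def bp2 : ContDiffBump (0 : E4) := ⟨3 / 4, 7 / 8, by norm_num, by norm_num⟩

def b1 (r : ℝ) : E4 → ℝ := fun y => bp1 (r⁻¹ • y)

lemma b1_smooth (r : ℝ) : ContDiff ℝ (⊤ : ℕ∞) (b1 r) :=
  (bump_smooth bp1).comp (contDiff_const_smul _)

lemma scale_ev {f : E4 → ℝ} {c : ℝ} (t : ℝ) {y : E4} (h : f =ᶠ[nhds (t • y)] fun _ => c) :
    (fun z => f (t • z)) =ᶠ[nhds y] fun _ => c := by
  have : Tendsto (fun z : E4 => t • z) (nhds y) (nhds (t • y)) :=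
    (continuous_const_smul t).continuousAt
  exact this.eventually h

lemma b1_in {r : ℝ} (hr : 0 < r) {y : E4} (hy : ‖y‖ < 5 / 4 * r) :
    b1 r =ᶠ[nhds y] fun _ => 1 := by
  refine scale_ev _ (bump_ev_in bp1 ?_)
  rw [norm_smul, norm_inv, Real.norm_of_nonneg hr.le, inv_mul_lt_iff₀ hr]
  show ‖y‖ < r * (5 / 4)
  linarith

lemma b1_out {r : ℝ} (hr : 0 < r) {y : E4} (hy : 3 / 2 * r < ‖y‖) :
    b1 r =ᶠ[nhds y] fun _ => 0 := by
  refine scale_ev _ (bump_ev_out bp1 ?_)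
  rw [norm_smul, norm_inv, Real.norm_of_nonneg hr.le, lt_inv_mul_iff₀ hr]
  show r * (3 / 2) < ‖y‖
  linarith

lemma b2_in {y : E4} (hy : ‖y‖ < 3 / 4) : (bp2 : E4 → ℝ) =ᶠ[nhds y] fun _ => 1 :=
  bump_ev_in bp2 hy

lemma b2_out {y : E4} (hy : 7 / 8 < ‖y‖) : (bp2 : E4 → ℝ) =ᶠ[nhds y] fun _ => 0 :=
  bump_ev_out bp2 hy

lemma W_outer {K : ℝ} (h1 : ∀ y k, |pd k bp2 y| ≤ K) (h2 : ∀ y, |lap bp2 y| ≤ K)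
    {e : ℝ} (he : 0 < e) {x : E4} (hx : ‖x‖ < 1 / 2) (y : E4) :
    |W bp2 (Gk e x) y| ≤ ({y : E4 | 3 / 4 ≤ ‖y‖ ∧ ‖y‖ ≤ 7 / 8}).indicator (fun _ => 1040 * K) y := by
  by_cases hy : y ∈ {y : E4 | 3 / 4 ≤ ‖y‖ ∧ ‖y‖ ≤ 7 / 8}
  · rw [indicator_of_mem hy]
    have hd : (1 / 4 : ℝ) ≤ ‖x - y‖ := by
      have := norm_sub_norm_le y x
      rw [norm_sub_rev] at this
      have := hy.1
      linarith
    have := W_bound (h1 y) (fun k => pd_Gk_le he (by norm_num) hd k)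
      (c := 16) (by
        rw [abs_of_pos (Gk_pos he x y)]
        refine (Gk_le (by norm_num) hd).trans (by norm_num)) (h2 y)
    refine this.trans (le_of_eq ?_)
    ring
  · rw [indicator_of_notMem hy]
    have : ‖y‖ < 3 / 4 ∨ 7 / 8 < ‖y‖ := by
      by_contra hcon
      push Not at hcon
      exact hy hcon
    rcases this with h | h
    · rw [W_zero _ (b2_in h)]; simp
    · rw [W_zero _ (b2_out h)]; simp

lemma W_inner {K : ℝ} (h1 : ∀ y k, |pd k bp1 y| ≤ K) (h2 : ∀ y, |lap bp1 y| ≤ K)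
    {e r : ℝ} (he : 0 < e) (hr : 0 < r) {x : E4} (hx : 2 * r < ‖x‖) (y : E4) :
    |W (b1 r) (fun y => Gk e x y - Gk e x 0) y| ≤
      ({y : E4 | 5 / 4 * r ≤ ‖y‖ ∧ ‖y‖ ≤ 3 / 2 * r}).indicator
        (fun _ => 1090 * K / (r * ‖x‖ ^ 3)) y := by
  have hK : 0 ≤ K := (abs_nonneg _).trans (h2 0)
  have hx0 : 0 < ‖x‖ := by linarith
  by_cases hy : y ∈ {y : E4 | 5 / 4 * r ≤ ‖y‖ ∧ ‖y‖ ≤ 3 / 2 * r}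
  · rw [indicator_of_mem hy]
    have hy2 := hy.2
    have hd : ‖x‖ / 4 ≤ ‖x - y‖ := by
      have := norm_sub_norm_le x y
      linarith
    have hpd : ∀ k, pd k (fun y => Gk e x y - Gk e x 0) y = pd k (Gk e x) y := by
      intro k
      unfold pd
      rw [fderiv_sub_const (f := Gk e x)]
    have hb1 : ∀ k, |pd k (b1 r) y| ≤ r⁻¹ * K := by
      intro k
      unfold b1
      rw [pd_scale, abs_mul, abs_of_pos (inv_pos.2 hr)]
      gcongr
      exact h1 _ _
    have hb2 : |lap (b1 r) y| ≤ r⁻¹ ^ 2 * K := by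
      unfold b1
      rw [lap_scale (bump_smooth bp1), abs_mul, abs_of_pos (by positivity)]
      gcongr
      exact h2 _
    have h3 : |Gk e x y - Gk e x 0| ≤ 66 * r / ‖x‖ ^ 3 := by
      refine (Gk_diff he hx0 (by linarith)).trans ?_
      exact div_le_div_of_nonneg_right (by linarith) (by positivity)
    have := W_bound (g := fun y => Gk e x y - Gk e x 0) hb1 (b := 2 / (‖x‖ / 4) ^ 3)
      (fun k => by rw [hpd]; exact pd_Gk_le he (by positivity) hd k) h3 hb2
    refine this.trans (le_of_eq ?_)
    field_simp
    norm_num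
  · rw [indicator_of_notMem hy]
    have : ‖y‖ < 5 / 4 * r ∨ 3 / 2 * r < ‖y‖ := by
      by_contra hcon
      push Not at hcon
      exact hy hcon
    rcases this with h | h
    · rw [W_zero _ (b1_in hr h)]; simp
    · rw [W_zero _ (b1_out hr h)]; simp

def ph (z : E4) : ℝ := 8 * (1 + ‖z‖ ^ 2)⁻¹ ^ 3

lemma ph_pos (z : E4) : 0 < ph z := by unfold ph; positivity

lemma ph_cont : Continuous ph := by
  unfold ph
  refine continuous_const.mul (Continuous.pow (Continuous.inv₀ (by fun_prop) ?_) 3)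
  intro z; positivity

lemma ph_int : Integrable ph := by
  have h := integrable_rpow_neg_one_add_norm_sq (E := E4) (μ := volume) (r := 6) (by
    simp [finrank_euclideanSpace]; norm_num)
  refine (h.const_mul 8).congr ?_
  filter_upwards with z
  have hp : (0:ℝ) < 1 + ‖z‖ ^ 2 := by positivity
  unfold ph
  rw [show (-6 / 2 : ℝ) = -((3 : ℕ) : ℝ) by norm_num, Real.rpow_neg hp.le, Real.rpow_natCast,
    inv_pow]

def c0 : ℝ := ∫ z, ph z

lemma c0_pos : 0 < c0 := by
  unfold c0
  rw [integral_pos_iff_support_of_nonneg (fun z => (ph_pos z).le) ph_int]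
  have : Function.support ph = univ := by
    ext z; simp [(ph_pos z).ne']
  rw [this]
  simp

lemma ph_decay : Tendsto (fun z : E4 => ‖z‖ ^ Module.finrank ℝ E4 * (c0⁻¹ * ph z))
    (Bornology.cobounded E4) (nhds 0) := by
  have hn : Tendsto (fun z : E4 => ‖z‖) (Bornology.cobounded E4) atTop := tendsto_norm_cobounded_atTop
  have h2 : Tendsto (fun z : E4 => c0⁻¹ * 8 * (‖z‖ ^ 2)⁻¹) (Bornology.cobounded E4) (nhds 0) := by
    have : Tendsto (fun t : ℝ => c0⁻¹ * 8 * (t ^ 2)⁻¹) atTop (nhds (c0⁻¹ * 8 * 0)) :=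
      ((tendsto_pow_atTop (by norm_num)).inv_tendsto_atTop).const_mul _
    rw [mul_zero] at this
    exact this.comp hn
  have hc := c0_pos
  refine squeeze_zero' (Eventually.of_forall fun z => ?_) ?_ h2
  · have := ph_pos z
    positivity
  · filter_upwards [hn.eventually_gt_atTop 0] with z hz
    rw [finrank_euclideanSpace, Fintype.card_fin]
    unfold ph
    have : (1 + ‖z‖ ^ 2)⁻¹ ^ 3 ≤ (‖z‖ ^ 2)⁻¹ ^ 3 := by
      gcongr
      linarith
    calc ‖z‖ ^ 4 * (c0⁻¹ * (8 * (1 + ‖z‖ ^ 2)⁻¹ ^ 3))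
        ≤ ‖z‖ ^ 4 * (c0⁻¹ * (8 * (‖z‖ ^ 2)⁻¹ ^ 3)) := by gcongr
      _ = c0⁻¹ * 8 * (‖z‖ ^ 2)⁻¹ := by field_simp

lemma peak_s6 {g : E4 → ℝ} (hg : Integrable g) {x : E4} (hc : ContinuousAt g x) :
    Tendsto (fun t : ℝ => ∫ y, (8 * (t⁻¹) ^ 2 * (Gk t⁻¹ x y) ^ 3) * g y) atTop
      (nhds (c0 * g x)) := by
  have hc0 := c0_pos
  have h := tendsto_integral_comp_smul_smul_of_integrable' (μ := (volume : Measure E4))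
    (φ := fun z => c0⁻¹ * ph z) (fun z => by have := ph_pos z; positivity)
    (by rw [integral_const_mul]; exact inv_mul_cancel₀ hc0.ne') ph_decay hg hc
  have h2 := h.const_mul c0
  refine h2.congr' ?_
  filter_upwards [eventually_gt_atTop 0] with t ht
  rw [← integral_const_mul]
  congr 1
  ext y
  rw [finrank_euclideanSpace, Fintype.card_fin]
  unfold ph Gk
  rw [norm_smul, Real.norm_of_nonneg ht.le, smul_eq_mul]
  have : ‖x - y‖ ^ 2 + t⁻¹ ^ 2 = t⁻¹ ^ 2 * (1 + (t * ‖x - y‖) ^ 2) := by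
    field_simp
    ring
  rw [this, mul_inv]
  field_simp

lemma pointwise_U {K1 K2 : ℝ} (h11 : ∀ y k, |pd k bp1 y| ≤ K1) (h12 : ∀ y, |lap bp1 y| ≤ K1)
    (h21 : ∀ y k, |pd k bp2 y| ≤ K2) (h22 : ∀ y, |lap bp2 y| ≤ K2)
    {r : ℝ} (hr : 0 < r) (hr8 : r < 1 / 8) {U : E4 → ℝ} (hU : ContDiff ℝ 2 U)
    (hUc : HasCompactSupport U)
    (hlap : ∀ y : E4, 9 / 8 * r < ‖y‖ → ‖y‖ < 15 / 16 → lap U y = 0)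
    {x : E4} (hx1 : 2 * r < ‖x‖) (hx2 : ‖x‖ < 1 / 2) (i j : Fin 4) :
    c0 * |pd i (pd j U) x| ≤
      1040 * K2 * (∫ y in {y : E4 | 3 / 4 ≤ ‖y‖ ∧ ‖y‖ ≤ 7 / 8}, |pd i (pd j U) y|) +
      1090 * K1 / (r * ‖x‖ ^ 3) *
        (∫ y in {y : E4 | 5 / 4 * r ≤ ‖y‖ ∧ ‖y‖ ≤ 3 / 2 * r}, |pd i (pd j U) y|) := by
  set h : E4 → ℝ := pd i (pd j U) with hh
  have hcont : Continuous h :=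
    (pd_contDiff (m := 0) (n := 1) (pd_contDiff (m := 1) (n := 2) hU (by norm_num) j)
      (by simp) i).continuous
  have hcs : HasCompactSupport h := pd_hcs (pd_hcs hUc j) i
  have hint : Integrable h := hcont.integrable_of_hasCompactSupport hcs
  set S2 := {y : E4 | 3 / 4 ≤ ‖y‖ ∧ ‖y‖ ≤ 7 / 8} with hS2
  set S1 := {y : E4 | 5 / 4 * r ≤ ‖y‖ ∧ ‖y‖ ≤ 3 / 2 * r} with hS1
  have mS2 : MeasurableSet S2 :=
    (measurableSet_le measurable_const measurable_norm).inter
      (measurableSet_le measurable_norm measurable_const)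
  have mS1 : MeasurableSet S1 :=
    (measurableSet_le measurable_const measurable_norm).inter
      (measurableSet_le measurable_norm measurable_const)
  set A2 := 1040 * K2
  set A1 := 1090 * K1 / (r * ‖x‖ ^ 3)
  set g : E4 → ℝ := fun y => (bp2 y - b1 r y) * h y with hg
  have hgcont : Continuous g := ((bump_smooth bp2).continuous.sub (b1_smooth r).continuous).mul hcont
  have hgint : Integrable g := hgcont.integrable_of_hasCompactSupport hcs.mul_left
  have hgx : g x = h x := by
    have e1 := (b2_in (y := x) (by linarith)).self_of_nhds
    have e2 := (b1_out hr (y := x) (by linarith)).self_of_nhds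
    simp only [hg, e1, e2]
    ring
  have hp := peak_s6 hgint (x := x) hgcont.continuousAt
  rw [hgx] at hp
  have hp' := hp.abs
  rw [abs_mul, abs_of_pos c0_pos] at hp'
  refine le_of_tendsto hp' ?_
  filter_upwards [eventually_gt_atTop 0] with t ht
  set e := t⁻¹ with hedef
  have he : 0 < e := inv_pos.2 ht
  have hG := Gk_smooth he x
  have hGc : ContDiff ℝ (⊤ : ℕ∞) (fun y => Gk e x y - Gk e x 0) := hG.sub contDiff_const
  set ψ : E4 → ℝ := fun y => bp2 y * Gk e x y - b1 r y * (Gk e x y - Gk e x 0) with hψ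
  have hf1 : ContDiff ℝ (⊤ : ℕ∞) (fun y => bp2 y * Gk e x y) := (bump_smooth bp2).mul hG
  have hf2 : ContDiff ℝ (⊤ : ℕ∞) (fun y => b1 r y * (Gk e x y - Gk e x 0)) :=
    (b1_smooth r).mul hGc
  have hψs : ContDiff ℝ (⊤ : ℕ∞) ψ := hf1.sub hf2
  have hw := weak_id hU hUc hψs i j (by
    intro y
    by_cases hy1 : 9 / 8 * r < ‖y‖
    · by_cases hy2 : ‖y‖ < 15 / 16
      · rw [hlap y hy1 hy2, zero_mul]
      · have hev : ψ =ᶠ[nhds y] fun _ => 0 := by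
          filter_upwards [b2_out (y := y) (by linarith), b1_out hr (y := y) (by linarith)]
            with z hz1 hz2
          simp [hψ, hz1, hz2]
        rw [(pd_const_ev (pd_const_ev hev j) i).self_of_nhds, mul_zero]
    · have hev : ψ =ᶠ[nhds y] fun _ => Gk e x 0 := by
        filter_upwards [b2_in (y := y) (by linarith), b1_in hr (y := y) (by linarith)]
          with z hz1 hz2
        simp [hψ, hz1, hz2]
      rw [(pd_const_ev (pd_const_ev hev j) i).self_of_nhds, mul_zero])
  set V : E4 → ℝ := fun y => W bp2 (Gk e x) y - W (b1 r) (fun y => Gk e x y - Gk e x 0) y with hV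
  have hlapψ : ∀ y, h y * lap ψ y = h y * V y - (8 * e ^ 2 * (Gk e x y) ^ 3) * g y := by
    intro y
    have l1 : lap (fun y => Gk e x y - Gk e x 0) y = lap (Gk e x) y := by
      rw [lap_sub hG contDiff_const, lap_const_ev (f := fun _ => Gk e x 0) (Eventually.of_forall fun _ => rfl),
        sub_zero]
    rw [hψ, lap_sub hf1 hf2, lap_mul (bump_smooth bp2) hG, lap_mul (b1_smooth r) hGc, l1,
      lap_Gk he]
    simp only [hV, W, hg]
    ring
  have hlapc : Continuous (lap ψ) := (lap_smooth hψs).continuous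
  have i1 : Integrable (fun y => h y * lap ψ y) :=
    (hcont.mul hlapc).integrable_of_hasCompactSupport hcs.mul_right
  have i2 : Integrable (fun y => (8 * e ^ 2 * (Gk e x y) ^ 3) * g y) :=
    ((continuous_const.mul (hG.continuous.pow 3)).mul hgcont).integrable_of_hasCompactSupport
      (hcs.mul_left.mul_left)
  have i3 : Integrable (fun y => h y * V y) := by
    refine (i1.add i2).congr ?_
    filter_upwards with y
    simp only [Pi.add_apply, hlapψ]
    ring
  have heq : ∫ y, (8 * e ^ 2 * (Gk e x y) ^ 3) * g y = ∫ y, h y * V y := by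
    have : ∫ y, h y * lap ψ y = 0 := hw
    simp_rw [hlapψ] at this
    rw [integral_sub i3 i2] at this
    linarith
  rw [heq]
  have hbd : ∀ y, |h y * V y| ≤ S2.indicator (fun y => A2 * |h y|) y +
      S1.indicator (fun y => A1 * |h y|) y := by
    intro y
    rw [abs_mul]
    have v1 := W_outer h21 h22 he hx2 y
    have v2 := W_inner h11 h12 he hr hx1 y
    have : |V y| ≤ S2.indicator (fun _ => A2) y + S1.indicator (fun _ => A1) y :=
      (abs_sub _ _).trans (add_le_add v1 v2)
    calc |h y| * |V y| ≤ |h y| * (S2.indicator (fun _ => A2) y + S1.indicator (fun _ => A1) y) := by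
          gcongr
      _ = _ := by
        simp only [indicator]
        split_ifs <;> ring
  have j2 : Integrable (S2.indicator (fun y => A2 * |h y|)) :=
    (hint.abs.const_mul A2).indicator mS2
  have j1 : Integrable (S1.indicator (fun y => A1 * |h y|)) :=
    (hint.abs.const_mul A1).indicator mS1
  calc |∫ y, h y * V y| ≤ ∫ y, |h y * V y| := abs_integral_le_integral_abs
    _ ≤ ∫ y, (S2.indicator (fun y => A2 * |h y|) y + S1.indicator (fun y => A1 * |h y|) y) :=
        integral_mono i3.abs (j2.add j1) hbd
    _ = _ := by
      rw [integral_add j2 j1, integral_indicator mS2, integral_indicator mS1,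
        integral_const_mul, integral_const_mul]

lemma lint_pow {a b : ℝ} (ha : 0 < a) (hb : 0 < b) :
    ∫⁻ l in Ioo 0 a, ENNReal.ofReal ((b / l) ^ ((2 : ℝ) / 3)) =
      ENNReal.ofReal (3 * (b ^ 2 * a) ^ ((1 : ℝ) / 3)) := by
  have hii : IntervalIntegrable (fun l : ℝ => b ^ ((2 : ℝ) / 3) * l ^ (-(2 : ℝ) / 3)) volume 0 a :=
    (intervalIntegral.intervalIntegrable_rpow' (by norm_num)).const_mul _
  have hint : IntegrableOn (fun l : ℝ => b ^ ((2 : ℝ) / 3) * l ^ (-(2 : ℝ) / 3)) (Ioo 0 a) :=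
    (intervalIntegrable_iff_integrableOn_Ioo_of_le ha.le).1 hii
  have hval : ∫ l in Ioo 0 a, b ^ ((2 : ℝ) / 3) * l ^ (-(2 : ℝ) / 3) =
      3 * (b ^ 2 * a) ^ ((1 : ℝ) / 3) := by
    rw [← integral_Ioc_eq_integral_Ioo, ← intervalIntegral.integral_of_le ha.le,
      intervalIntegral.integral_const_mul, integral_rpow (Or.inl (by norm_num)),
      Real.mul_rpow (by positivity) ha.le, ← Real.rpow_natCast b 2, ← Real.rpow_mul hb.le,
      Real.zero_rpow (by norm_num)]
    norm_num
    ring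
  rw [← hval, ofReal_integral_eq_lintegral_ofReal hint]
  · refine setLIntegral_congr_fun measurableSet_Ioo fun l hl => ?_
    have hl0 : 0 < l := hl.1
    rw [Real.div_rpow hb.le hl0.le, neg_div, Real.rpow_neg hl0.le, div_eq_mul_inv]
  · filter_upwards [ae_restrict_mem measurableSet_Ioo] with l hl
    have hl0 : 0 < l := hl.1
    positivity

def kap : ℝ≥0∞ := volume (Metric.ball (0 : E4) 1)

lemma kap_lt : kap < ⊤ := by
  unfold kap; exact measure_ball_lt_top

lemma kap_ne : kap ^ ((1 : ℝ) / 2) ≠ ⊤ :=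
  ENNReal.rpow_ne_top_of_nonneg (by norm_num) kap_lt.ne

lemma vol_ball_half {ρ : ℝ} (hρ : 0 ≤ ρ) :
    volume (Metric.ball (0 : E4) ρ) ^ ((1 : ℝ) / 2) =
      ENNReal.ofReal (ρ ^ 2) * kap ^ ((1 : ℝ) / 2) := by
  rw [Measure.addHaar_ball _ _ hρ, finrank_euclideanSpace, Fintype.card_fin,
    ENNReal.mul_rpow_of_nonneg _ _ (by norm_num), ENNReal.ofReal_rpow_of_nonneg (by positivity)
      (by norm_num)]
  congr 2
  rw [← Real.sqrt_eq_rpow, show ρ ^ 4 = (ρ ^ 2) ^ 2 by ring, Real.sqrt_sq (by positivity)]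

lemma vol_closedBall_half {ρ : ℝ} (hρ : 0 ≤ ρ) :
    volume (Metric.closedBall (0 : E4) ρ) ^ ((1 : ℝ) / 2) =
      ENNReal.ofReal (ρ ^ 2) * kap ^ ((1 : ℝ) / 2) := by
  rw [Measure.addHaar_closedBall_eq_addHaar_ball, vol_ball_half hρ]

lemma Lam_bound_s6 {r N : ℝ} (hr : 0 < r) (hN : 0 ≤ N) {g : E4 → ℝ}
    (hg : ∀ x : E4, 2 * r < ‖x‖ → ‖x‖ < 1 / 2 → |g x| ≤ N * (1 + r / ‖x‖ ^ 3)) :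
    Lam {x : E4 | 2 * r < ‖x‖ ∧ ‖x‖ < 1 / 2} g ≤
      ENNReal.ofReal (5 * N) * kap ^ ((1 : ℝ) / 2) := by
  unfold Lam
  rcases hN.eq_or_lt with h0 | hN
  · have : ∀ l ∈ Ioi (0 : ℝ), (volume {x | x ∈ {x : E4 | 2 * r < ‖x‖ ∧ ‖x‖ < 1 / 2} ∧ l < |g x|})
        ^ ((1 : ℝ) / 2) = 0 := by
      intro l hl
      have : {x | x ∈ {x : E4 | 2 * r < ‖x‖ ∧ ‖x‖ < 1 / 2} ∧ l < |g x|} = ∅ := by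
        ext x
        simp only [mem_ofPred_eq, mem_empty_iff_false, iff_false, not_and, not_lt]
        rintro ⟨h1, h2⟩
        have := hg x h1 h2
        rw [← h0, zero_mul] at this
        exact this.trans (le_of_lt hl)
      rw [this]
      simp
    rw [setLIntegral_congr_fun measurableSet_Ioi this]
    simp
  set a := 2 * N / (8 * r ^ 2) with ha
  set b := 2 * N * r with hb
  have ha0 : 0 < a := by positivity
  have hb0 : 0 < b := by positivity
  set q := kap ^ ((1 : ℝ) / 2) with hq
  set F1 : ℝ → ℝ≥0∞ := (Ioo (0 : ℝ) (2 * N)).indicator (fun _ => q)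
  set F2 : ℝ → ℝ≥0∞ := (Ioo (0 : ℝ) a).indicator
    (fun l => ENNReal.ofReal ((b / l) ^ ((2 : ℝ) / 3)) * q)
  have key : ∀ l ∈ Ioi (0 : ℝ), (volume {x | x ∈ {x : E4 | 2 * r < ‖x‖ ∧ ‖x‖ < 1 / 2} ∧ l < |g x|})
        ^ ((1 : ℝ) / 2) ≤ F1 l + F2 l := by
    intro l hl
    have hl0 : 0 < l := hl
    set ρ := (b / l) ^ ((1 : ℝ) / 3) with hρ
    have hρ0 : 0 < ρ := by positivity
    have hρ3 : ρ ^ 3 = b / l := by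
      rw [hρ, ← Real.rpow_natCast, ← Real.rpow_mul (by positivity)]
      norm_num
    have hρ2 : ρ ^ 2 = (b / l) ^ ((2 : ℝ) / 3) := by
      rw [hρ, ← Real.rpow_natCast, ← Real.rpow_mul (by positivity)]
      norm_num
    have hsub : {x | x ∈ {x : E4 | 2 * r < ‖x‖ ∧ ‖x‖ < 1 / 2} ∧ l < |g x|} ⊆
        {x | l < 2 * N ∧ x ∈ Metric.ball (0 : E4) 1} ∪
          {x | l < a ∧ x ∈ Metric.ball (0 : E4) ρ} := by
      rintro x ⟨⟨h1, h2⟩, h3⟩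
      have hx0 : 0 < ‖x‖ := by linarith
      have h4 := h3.trans_le (hg x h1 h2)
      by_cases hl2 : l < 2 * N
      · left
        refine ⟨hl2, ?_⟩
        simp only [mem_ball_zero_iff]
        linarith
      · right
        have h5 : l < 2 * N * (r / ‖x‖ ^ 3) := by linarith
        have h6 : l * ‖x‖ ^ 3 < b := by
          rw [← mul_div_assoc, lt_div_iff₀ (by positivity)] at h5
          exact h5
        constructor
        · rw [ha, lt_div_iff₀ (by positivity)]
          have h7 : (2 * r) ^ 3 ≤ ‖x‖ ^ 3 := by gcongr
          have h8 : l * (2 * r) ^ 3 < 2 * N * r := (by gcongr : l * (2 * r) ^ 3 ≤ l * ‖x‖ ^ 3).trans_lt h6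
          have h9 : (l * (8 * r ^ 2)) * r < (2 * N) * r := by linarith
          exact lt_of_mul_lt_mul_right h9 hr.le
        · simp only [mem_ball_zero_iff]
          refine lt_of_pow_lt_pow_left₀ 3 hρ0.le ?_
          rw [hρ3, lt_div_iff₀ hl0]
          linarith
    have hm1 : volume {x | l < 2 * N ∧ x ∈ Metric.ball (0 : E4) 1} ^ ((1 : ℝ) / 2) ≤ F1 l := by
      by_cases hc : l < 2 * N
      · have : l ∈ Ioo 0 (2 * N) := ⟨hl0, hc⟩
        simp only [F1, indicator_of_mem this, hc, true_and, ofPred_mem_eq]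
        rw [vol_ball_half zero_le_one]
        simp [hq]
      · simp [hc]
    have hm2 : volume {x | l < a ∧ x ∈ Metric.ball (0 : E4) ρ} ^ ((1 : ℝ) / 2) ≤ F2 l := by
      by_cases hc : l < a
      · have : l ∈ Ioo 0 a := ⟨hl0, hc⟩
        simp only [F2, indicator_of_mem this, hc, true_and, ofPred_mem_eq]
        rw [vol_ball_half hρ0.le, hρ2]
      · simp [hc]
    calc _ ≤ (volume {x | l < 2 * N ∧ x ∈ Metric.ball (0 : E4) 1} +
          volume {x | l < a ∧ x ∈ Metric.ball (0 : E4) ρ}) ^ ((1 : ℝ) / 2) := by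
          gcongr
          exact (measure_mono hsub).trans (measure_union_le _ _)
      _ ≤ _ := ENNReal.rpow_add_le_add_rpow _ _ (by norm_num) (by norm_num)
      _ ≤ _ := add_le_add hm1 hm2
  have mF1 : Measurable F1 := measurable_const.indicator measurableSet_Ioo
  have hcube : 3 * (b ^ 2 * a) ^ ((1 : ℝ) / 3) = 3 * N := by
    have : b ^ 2 * a = N ^ 3 := by
      rw [ha, hb]; field_simp; norm_num
    rw [this, ← Real.rpow_natCast N 3, ← Real.rpow_mul hN.le]
    norm_num
  calc _ ≤ ∫⁻ l in Ioi (0 : ℝ), (F1 l + F2 l) := setLIntegral_mono' measurableSet_Ioi key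
    _ ≤ ∫⁻ l, (F1 l + F2 l) := setLIntegral_le_lintegral _ _
    _ = (∫⁻ l, F1 l) + ∫⁻ l, F2 l := lintegral_add_left mF1 _
    _ = q * ENNReal.ofReal (2 * N) + ENNReal.ofReal (3 * N) * q := by
      congr 1
      · simp only [F1]
        rw [lintegral_indicator measurableSet_Ioo, setLIntegral_const, Real.volume_Ioo, sub_zero]
      · simp only [F2]
        rw [lintegral_indicator measurableSet_Ioo, lintegral_mul_const' _ _ kap_ne,
          lint_pow ha0 hb0, hcube]
    _ = _ := by
      rw [mul_comm q, ← add_mul, ← ENNReal.ofReal_add (by positivity) (by positivity)]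
      congr 2
      ring

lemma tang_entry_le (u : E4 → ℝ) (x : E4) (i j : Fin 4) :
    |tangHess u x i j| ≤ tangHessNorm u x := by
  unfold tangHessNorm
  refine Real.abs_le_sqrt ?_
  refine le_trans ?_ (Finset.single_le_sum (f := fun i => ∑ j, tangHess u x i j ^ 2)
    (fun i _ => Finset.sum_nonneg fun j _ => sq_nonneg _) (Finset.mem_univ i))
  exact Finset.single_le_sum (f := fun j => tangHess u x i j ^ 2)
    (fun j _ => sq_nonneg _) (Finset.mem_univ j)

lemma hess_le_tang {u : E4 → ℝ} {x : E4} (hx : 0 < ‖x‖)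
    (hs : ∀ i j, hess u x i j = hess u x j i) (ht : ∑ i, hess u x i i = 0) (i j : Fin 4) :
    |hess u x i j| ≤ 9 * tangHessNorm u x := by
  set n := ‖x‖ with hn
  set τ := tangHessNorm u x with hτ
  have hle := tang_entry_le u x
  have hτ0 : 0 ≤ τ := (abs_nonneg _).trans (hle 0 0)
  have hxn : ∀ k, |x k| ≤ n := fun k => by simpa using PiLp.norm_apply_le x k
  set s : Fin 4 → ℝ := fun j => ∑ k, x k * hess u x k j with hsdef
  set q : ℝ := ∑ j, x j * s j with hq
  have hnsq : ∑ k, x k * x k = n ^ 2 := by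
    rw [hn, EuclideanSpace.norm_sq_eq]; simp [pow_two]
  have hT : ∀ i j, tangHess u x i j = hess u x i j - (n ^ 2)⁻¹ * x i * s j := fun i j => rfl
  have sum_abs : ∀ f : Fin 4 → ℝ, ∀ B : ℝ, (∀ k, |f k| ≤ B) → |∑ k, f k| ≤ 4 * B := by
    intro f B hB
    refine (Finset.abs_sum_le_sum_abs _ _).trans ?_
    refine (Finset.sum_le_card_nsmul _ _ B fun k _ => hB k).trans ?_
    simp
  have hq1 : ∑ k, tangHess u x k k = - ((n ^ 2)⁻¹ * q) := by
    simp_rw [hT]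
    rw [Finset.sum_sub_distrib, ht, hq, Finset.mul_sum]
    simp [mul_assoc]
  have hqb : |(n ^ 2)⁻¹ * q| ≤ 4 * τ := by
    have := sum_abs _ τ (fun k => hle k k)
    rwa [hq1, abs_neg] at this
  have hs1 : ∀ j, ∑ k, tangHess u x j k * x k = s j - x j * ((n ^ 2)⁻¹ * q) := by
    intro j
    simp_rw [hT, sub_mul]
    rw [Finset.sum_sub_distrib]
    congr 1
    · simp only [hsdef]
      refine Finset.sum_congr rfl fun k _ => ?_
      rw [hs j k]; ring
    · rw [hq, Finset.mul_sum, Finset.mul_sum]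
      refine Finset.sum_congr rfl fun k _ => ?_
      ring
  have hsb : ∀ j, |s j| ≤ 8 * τ * n := by
    intro j
    have e : s j = (∑ k, tangHess u x j k * x k) + x j * ((n ^ 2)⁻¹ * q) := by rw [hs1]; ring
    have a1 : |∑ k, tangHess u x j k * x k| ≤ 4 * (τ * n) := sum_abs _ _ fun k => by
      rw [abs_mul]
      exact mul_le_mul (hle j k) (hxn k) (abs_nonneg _) hτ0
    have a2 : |x j * ((n ^ 2)⁻¹ * q)| ≤ n * (4 * τ) := by
      rw [abs_mul]
      exact mul_le_mul (hxn j) hqb (abs_nonneg _) hx.le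
    rw [e]
    refine (abs_add_le _ _).trans ?_
    linarith
  have e : hess u x i j = tangHess u x i j + (n ^ 2)⁻¹ * x i * s j := by rw [hT]; ring
  have a3 : |(n ^ 2)⁻¹ * x i * s j| ≤ 8 * τ := by
    rw [abs_mul, abs_mul, abs_of_pos (by positivity : 0 < (n ^ 2)⁻¹)]
    calc (n ^ 2)⁻¹ * |x i| * |s j| ≤ (n ^ 2)⁻¹ * n * (8 * τ * n) := by
          gcongr
          · exact hxn i
          · exact hsb j
      _ = 8 * τ := by field_simp
  rw [e]
  refine (abs_add_le _ _).trans ?_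
  have := hle i j
  linarith

lemma tang_le_hess {u : E4 → ℝ} {x : E4} (hx : 0 < ‖x‖) {B : ℝ}
    (hB : ∀ i j, |hess u x i j| ≤ B) : tangHessNorm u x ≤ 20 * B := by
  have hB0 : 0 ≤ B := (abs_nonneg _).trans (hB 0 0)
  have hxn : ∀ k, |x k| ≤ ‖x‖ := fun k => by simpa using PiLp.norm_apply_le x k
  have hT : ∀ i j, |tangHess u x i j| ≤ 5 * B := by
    intro i j
    have a1 : |∑ k, x k * hess u x k j| ≤ 4 * (‖x‖ * B) := by
      refine (Finset.abs_sum_le_sum_abs _ _).trans ?_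
      refine (Finset.sum_le_card_nsmul _ _ (‖x‖ * B) fun k _ => ?_).trans ?_
      · rw [abs_mul]
        exact mul_le_mul (hxn k) (hB k j) (abs_nonneg _) hx.le
      · simp
    unfold tangHess
    refine (abs_sub _ _).trans ?_
    have : |(‖x‖ ^ 2)⁻¹ * x i * ∑ k, x k * hess u x k j| ≤ 4 * B := by
      rw [abs_mul, abs_mul, abs_of_pos (by positivity : 0 < (‖x‖ ^ 2)⁻¹)]
      calc _ ≤ (‖x‖ ^ 2)⁻¹ * ‖x‖ * (4 * (‖x‖ * B)) := by
            gcongr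
            exact hxn i
        _ = 4 * B := by field_simp
    have := hB i j
    linarith
  unfold tangHessNorm
  refine Real.sqrt_le_iff.2 ⟨by positivity, ?_⟩
  have h1 : ∀ i j, tangHess u x i j ^ 2 ≤ 25 * B ^ 2 := by
    intro i j
    have := sq_le_sq' (by linarith [neg_abs_le (tangHess u x i j), hT i j])
      ((le_abs_self _).trans (hT i j))
    linarith
  calc ∑ i, ∑ j, tangHess u x i j ^ 2 ≤ ∑ i : Fin 4, ∑ j : Fin 4, 25 * B ^ 2 :=
        Finset.sum_le_sum fun i _ => Finset.sum_le_sum fun j _ => h1 i j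
    _ = (20 * B) ^ 2 := by simp; ring

lemma exists_ext {r : ℝ} (hr : 0 < r) (hr8 : r < 1 / 8) {u : E4 → ℝ}
    (hu : ContDiffOn ℝ 2 u {x | r < ‖x‖ ∧ ‖x‖ < 1}) :
    ∃ U : E4 → ℝ, ContDiff ℝ 2 U ∧ HasCompactSupport U ∧
      ∀ y : E4, 9 / 8 * r < ‖y‖ → ‖y‖ < 15 / 16 → U =ᶠ[nhds y] u := by
  let c1 : ContDiffBump (0 : E4) := ⟨15 / 16, 31 / 32, by norm_num, by norm_num⟩
  let c2 : ContDiffBump (0 : E4) := ⟨17 / 16 * r, 9 / 8 * r, by positivity, by linarith⟩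
  have h1i : ∀ y : E4, ‖y‖ < 15 / 16 → (c1 : E4 → ℝ) =ᶠ[nhds y] fun _ => 1 :=
    fun y hy => bump_ev_in c1 hy
  have h1o : ∀ y : E4, 31 / 32 < ‖y‖ → (c1 : E4 → ℝ) =ᶠ[nhds y] fun _ => 0 :=
    fun y hy => bump_ev_out c1 hy
  have h2i : ∀ y : E4, ‖y‖ < 17 / 16 * r → (c2 : E4 → ℝ) =ᶠ[nhds y] fun _ => 1 :=
    fun y hy => bump_ev_in c2 hy
  have h2o : ∀ y : E4, 9 / 8 * r < ‖y‖ → (c2 : E4 → ℝ) =ᶠ[nhds y] fun _ => 0 :=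
    fun y hy => bump_ev_out c2 hy
  have hopen : IsOpen {x : E4 | r < ‖x‖ ∧ ‖x‖ < 1} :=
    (isOpen_lt continuous_const continuous_norm).inter
      (isOpen_lt continuous_norm continuous_const)
  refine ⟨fun y => (c1 y - c2 y) * u y, ?_, ?_, ?_⟩
  · rw [contDiff_iff_contDiffAt]
    intro y
    by_cases hy1 : r < ‖y‖
    · by_cases hy2 : ‖y‖ < 1
      · exact (c1.contDiffAt.sub c2.contDiffAt).mul (hu.contDiffAt (hopen.mem_nhds ⟨hy1, hy2⟩))
      · refine (contDiffAt_const (c := (0 : ℝ))).congr_of_eventuallyEq ?_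
        filter_upwards [h1o y (by linarith), h2o y (by linarith)] with z hz1 hz2
        simp [hz1, hz2]
    · refine (contDiffAt_const (c := (0 : ℝ))).congr_of_eventuallyEq ?_
      filter_upwards [h1i y (by linarith), h2i y (by linarith)] with z hz1 hz2
      simp [hz1, hz2]
  · refine HasCompactSupport.intro (isCompact_closedBall (0 : E4) 1) fun y hy => ?_
    have hy' : 1 < ‖y‖ := by simpa using hy
    have e1 := (h1o y (by linarith)).self_of_nhds
    have e2 := (h2o y (by linarith)).self_of_nhds
    simp [e1, e2]
  · intro y hy1 hy2
    filter_upwards [h1i y hy2, h2o y hy1] with z hz1 hz2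
    simp [hz1, hz2]

lemma L1_bound {h τ : E4 → ℝ} (hc : Continuous h) (hcs : HasCompactSupport h)
    {S Ω : Set E4} (hS : MeasurableSet S) (hSΩ : S ⊆ Ω) {ρ : ℝ} (hρ : 0 ≤ ρ)
    (hSρ : S ⊆ Metric.closedBall 0 ρ) (hle : ∀ y ∈ S, |h y| ≤ 9 * τ y) (hτ : ∀ y, 0 ≤ τ y)
    (hfin : eLpNorm τ 2 (volume.restrict Ω) ≠ ⊤) :
    ∫ y in S, |h y| ≤
      9 * (eLpNorm τ 2 (volume.restrict Ω)).toReal * (ρ ^ 2 * (kap ^ ((1 : ℝ) / 2)).toReal) := by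
  have hint : Integrable h (volume.restrict S) :=
    (hc.integrable_of_hasCompactSupport hcs).restrict
  have e1 : ENNReal.ofReal (∫ y in S, |h y|) = eLpNorm h 1 (volume.restrict S) := by
    rw [eLpNorm_one_eq_lintegral_enorm]
    exact ofReal_integral_norm_eq_lintegral_enorm hint
  have e2 : eLpNorm h 1 (volume.restrict S) ≤
      eLpNorm h 2 (volume.restrict S) * (volume S) ^ ((1 : ℝ) / 2) := by
    have := eLpNorm_le_eLpNorm_mul_rpow_measure_univ (p := 1) (q := 2) (μ := volume.restrict S)
      (f := h) (by norm_num) hint.aestronglyMeasurable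
    refine this.trans (le_of_eq ?_)
    rw [Measure.restrict_apply_univ]
    congr 2
    norm_num
  have e3 : eLpNorm h 2 (volume.restrict S) ≤
      ENNReal.ofReal 9 * eLpNorm τ 2 (volume.restrict Ω) := by
    refine (eLpNorm_le_mul_eLpNorm_of_ae_le_mul (g := τ) (c := 9) ?_ 2).trans ?_
    · filter_upwards [ae_restrict_mem hS] with y hy
      rw [Real.norm_eq_abs, Real.norm_of_nonneg (hτ y)]
      exact hle y hy
    · gcongr
  have e4 : (volume S) ^ ((1 : ℝ) / 2) ≤ ENNReal.ofReal (ρ ^ 2) * kap ^ ((1 : ℝ) / 2) := by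
    rw [← vol_closedBall_half hρ]
    gcongr
  have e5 : ENNReal.ofReal (∫ y in S, |h y|) ≤ ENNReal.ofReal
      (9 * (eLpNorm τ 2 (volume.restrict Ω)).toReal * (ρ ^ 2 * (kap ^ ((1 : ℝ) / 2)).toReal)) := by
    rw [e1, ENNReal.ofReal_mul (by positivity), ENNReal.ofReal_mul (by norm_num),
      ENNReal.ofReal_mul (by positivity), ENNReal.ofReal_toReal hfin, ENNReal.ofReal_toReal kap_ne]
    exact e2.trans (mul_le_mul' e3 e4)
  exact (ENNReal.ofReal_le_ofReal_iff (by positivity)).1 e5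

theorem harmonic_annulus_tangential_hessian_L21_estimate :
    ∃ C : ℝ, 0 < C ∧
      ∀ (r : ℝ), r ∈ Set.Ioo (0 : ℝ) (1 / 8) →
      ∀ u : EuclideanSpace ℝ (Fin 4) → ℝ,
        ContinuousOn u {x | r ≤ ‖x‖ ∧ ‖x‖ ≤ 1} →
        IsHarmonicOn u {x | r < ‖x‖ ∧ ‖x‖ < 1} →
        (∫ x in Metric.sphere (0 : EuclideanSpace ℝ (Fin 4)) 1,
            u x ∂(μH[(3 : ℝ)])) = 0 →
        (∫ x in Metric.sphere (0 : EuclideanSpace ℝ (Fin 4)) r,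
            u x ∂(μH[(3 : ℝ)])) = 0 →
        Lam {x | 2 * r < ‖x‖ ∧ ‖x‖ < 1 / 2} (tangHessNorm u) ≤
          ENNReal.ofReal C *
            eLpNorm (tangHessNorm u) 2
              (volume.restrict {x | r < ‖x‖ ∧ ‖x‖ < 1}) := by
  obtain ⟨K1, hK1, h11, h12⟩ := bump_bound bp1
  obtain ⟨K2, hK2, h21, h22⟩ := bump_bound bp2
  set κ := (kap ^ ((1 : ℝ) / 2)).toReal with hκ
  have hκ0 : 0 ≤ κ := ENNReal.toReal_nonneg
  have hc0 := c0_pos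
  set D := c0⁻¹ * (9 * κ * (1040 * K2 + 1090 * K1 * (9 / 4))) with hD
  have hD0 : 0 ≤ D := by positivity
  refine ⟨5 * (20 * D) * κ + 1, by positivity, ?_⟩
  rintro r ⟨hr, hr8⟩ u - ⟨hu2, hul⟩ - -
  set Ω := {x : E4 | r < ‖x‖ ∧ ‖x‖ < 1} with hΩ
  have hopen : IsOpen Ω :=
    (isOpen_lt continuous_const continuous_norm).inter
      (isOpen_lt continuous_norm continuous_const)
  set M := eLpNorm (tangHessNorm u) 2 (volume.restrict Ω) with hM
  by_cases hfin : M = ⊤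
  · rw [hfin, ENNReal.mul_top]
    · exact le_top
    · rw [ne_eq, ENNReal.ofReal_eq_zero, not_le]
      positivity
  obtain ⟨U, hU, hUc, hUu⟩ := exists_ext hr hr8 hu2
  have hhess : ∀ y : E4, 9 / 8 * r < ‖y‖ → ‖y‖ < 15 / 16 → ∀ i j,
      pd i (pd j U) y = hess u y i j := fun y h1 h2 i j =>
    (pd_congr (pd_congr (hUu y h1 h2) j) i).self_of_nhds
  have hlap : ∀ y : E4, 9 / 8 * r < ‖y‖ → ‖y‖ < 15 / 16 → lap U y = 0 := by
    intro y h1 h2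
    unfold lap
    simp_rw [hhess y h1 h2]
    exact hul y ⟨by linarith, by linarith⟩
  have htang : ∀ y ∈ Ω, ∀ i j, |hess u y i j| ≤ 9 * tangHessNorm u y := by
    intro y hy i j
    refine hess_le_tang (hr.trans hy.1) (fun i j => ?_) (hul y hy) i j
    exact pd_comm_at (hu2.contDiffAt (hopen.mem_nhds hy)) i j
  have hτ : ∀ y, 0 ≤ tangHessNorm u y := fun y => Real.sqrt_nonneg _
  have hpt : ∀ x : E4, 2 * r < ‖x‖ → ‖x‖ < 1 / 2 →
      |tangHessNorm u x| ≤ (20 * D * M.toReal) * (1 + r / ‖x‖ ^ 3) := by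
    intro x hx1 hx2
    have hx0 : 0 < ‖x‖ := by linarith
    have hM0 : 0 ≤ M.toReal := ENNReal.toReal_nonneg
    rw [abs_of_nonneg (hτ x)]
    have hB : ∀ i j, |hess u x i j| ≤ D * M.toReal * (1 + r / ‖x‖ ^ 3) := by
      intro i j
      rw [← hhess x (by linarith) (by linarith)]
      have hp := pointwise_U h11 h12 h21 h22 hr hr8 hU hUc hlap hx1 hx2 i j
      have hcont : Continuous (pd i (pd j U)) :=
        (pd_contDiff (m := 0) (n := 1) (pd_contDiff (m := 1) (n := 2) hU (by norm_num) j)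
          (by simp) i).continuous
      have hcs : HasCompactSupport (pd i (pd j U)) := pd_hcs (pd_hcs hUc j) i
      have hle : ∀ y : E4, 9 / 8 * r < ‖y‖ → ‖y‖ < 15 / 16 →
          |pd i (pd j U) y| ≤ 9 * tangHessNorm u y := by
        intro y h1 h2
        rw [hhess y h1 h2]
        exact htang y ⟨by linarith, by linarith⟩ i j
      have l2 := L1_bound (τ := tangHessNorm u) hcont hcs
        (S := {y : E4 | 3 / 4 ≤ ‖y‖ ∧ ‖y‖ ≤ 7 / 8}) (Ω := Ω) (ρ := 1)
        ((measurableSet_le measurable_const measurable_norm).inter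
          (measurableSet_le measurable_norm measurable_const))
        (fun y hy => ⟨by linarith [hy.1], by linarith [hy.2]⟩) zero_le_one
        (fun y hy => by
          rw [mem_closedBall_zero_iff]; linarith [hy.2])
        (fun y hy => hle y (by linarith [hy.1]) (by linarith [hy.2])) hτ hfin
      have l1 := L1_bound (τ := tangHessNorm u) hcont hcs
        (S := {y : E4 | 5 / 4 * r ≤ ‖y‖ ∧ ‖y‖ ≤ 3 / 2 * r}) (Ω := Ω) (ρ := 3 / 2 * r)
        ((measurableSet_le measurable_const measurable_norm).inter
          (measurableSet_le measurable_norm measurable_const))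
        (fun y hy => ⟨by linarith [hy.1], by linarith [hy.2]⟩) (by positivity)
        (fun y hy => by
          rw [mem_closedBall_zero_iff]; exact hy.2)
        (fun y hy => hle y (by linarith [hy.1]) (by linarith [hy.2])) hτ hfin
      rw [← hM, ← hκ] at l1 l2
      have h3 : c0 * |pd i (pd j U) x| ≤ 1040 * K2 * (9 * M.toReal * (1 ^ 2 * κ)) +
          1090 * K1 / (r * ‖x‖ ^ 3) * (9 * M.toReal * ((3 / 2 * r) ^ 2 * κ)) := by
        refine hp.trans (add_le_add ?_ ?_)
        · exact mul_le_mul_of_nonneg_left l2 (by positivity)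
        · exact mul_le_mul_of_nonneg_left l1 (by positivity)
      have h4 : 1090 * K1 / (r * ‖x‖ ^ 3) * (9 * M.toReal * ((3 / 2 * r) ^ 2 * κ)) =
          9 * κ * M.toReal * (1090 * K1 * (9 / 4)) * (r / ‖x‖ ^ 3) := by
        field_simp
        ring
      rw [h4] at h3
      set w := r / ‖x‖ ^ 3 with hw
      have hw0 : 0 ≤ w := by positivity
      have h5 : c0 * |pd i (pd j U) x| ≤
          (9 * κ * (1040 * K2 + 1090 * K1 * (9 / 4))) * M.toReal * (1 + w) := by
        have p1 : 0 ≤ κ * K2 * M.toReal * w := by positivity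
        have p2 : 0 ≤ κ * K1 * M.toReal := by positivity
        nlinarith
      rw [hD, mul_assoc, mul_assoc, le_inv_mul_iff₀ hc0]
      linarith
    refine (tang_le_hess hx0 hB).trans (le_of_eq ?_)
    ring
  refine (Lam_bound_s6 hr (by positivity) hpt).trans ?_
  have e1 : kap ^ ((1 : ℝ) / 2) = ENNReal.ofReal κ := (ENNReal.ofReal_toReal kap_ne).symm
  have e2 : M = ENNReal.ofReal M.toReal := (ENNReal.ofReal_toReal hfin).symm
  rw [e1, ← ENNReal.ofReal_mul (by positivity)]
  conv_rhs => rw [e2]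
  rw [← ENNReal.ofReal_mul (by positivity)]
  apply ENNReal.ofReal_le_ofReal
  have : 0 ≤ M.toReal := ENNReal.toReal_nonneg
  nlinarith
end
end

section
/- There exists an absolute constant c > 0 such that for every r ∈ (0, 1/8) and every integer j, letting Ω = {x ∈ ℝ⁴ : 2r < |x| < 1/2} and f_j(x) = |x|^j, the following hold: if j ≤ −3, then Λ_Ω(f_j) ≤ c · (2r)^{j+2}; and if j ≥ 0, then Λ_Ω(f_j) ≤ c · 2^{−3j/4}. The constant c is independent of j and of r. -/
open MeasureTheory Filter Set ENNReal

noncomputable section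

theorem aux_neg (V : ℝ≥0∞) (hV : V = volume (Metric.ball (0 : EuclideanSpace ℝ (Fin 4)) 1))
    (R : ℝ) (hR : 0 < R) (j : ℤ) (hj : j ≤ -3) :
    Lam {x : EuclideanSpace ℝ (Fin 4) | R < ‖x‖ ∧ ‖x‖ < 1 / 2} (fun x => ‖x‖ ^ j) ≤
      V ^ ((1:ℝ)/2) * ENNReal.ofReal (3 * R ^ (j + 2)) := by
  have hjr : (j : ℝ) ≤ -3 := by exact_mod_cast hj
  have hj0 : (j : ℝ) < 0 := by linarith
  have hs : (-(2:ℝ)/3) ≤ 2 / (j:ℝ) := by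
    rw [le_div_iff_of_neg hj0]; linarith
  have hA : 0 < R ^ j := zpow_pos hR j
  have key : ∀ l ∈ Set.Ioi (0:ℝ),
      (volume {x : EuclideanSpace ℝ (Fin 4) |
        x ∈ {x : EuclideanSpace ℝ (Fin 4) | R < ‖x‖ ∧ ‖x‖ < 1 / 2} ∧ l < |‖x‖ ^ j|}) ^ ((1 : ℝ) / 2)
      ≤ (Set.Ioc 0 (R ^ j)).indicator
          (fun l => V ^ ((1:ℝ)/2) * ENNReal.ofReal (l ^ (2 / (j:ℝ)))) l := by
    intro l hl
    have hl0 : 0 < l := hl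
    by_cases hlA : l ≤ R ^ j
    · rw [Set.indicator_of_mem (show l ∈ Set.Ioc 0 (R ^ j) from ⟨hl0, hlA⟩)]
      have hsub : {x : EuclideanSpace ℝ (Fin 4) |
        x ∈ {x : EuclideanSpace ℝ (Fin 4) | R < ‖x‖ ∧ ‖x‖ < 1 / 2} ∧ l < |‖x‖ ^ j|}
          ⊆ Metric.ball 0 (l ^ (1 / (j:ℝ))) := by
        rintro x ⟨⟨h1, h2⟩, h3⟩
        have hx : 0 < ‖x‖ := hR.trans h1
        rw [abs_of_pos (zpow_pos hx j), ← Real.rpow_intCast] at h3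
        have h4 := Real.rpow_lt_rpow_of_neg hl0 h3 (show 1 / (j:ℝ) < 0 from
          div_neg_of_pos_of_neg one_pos hj0)
        rw [← Real.rpow_mul hx.le, mul_one_div_cancel hj0.ne, Real.rpow_one] at h4
        simpa using h4
      have hp : 0 < l ^ (1 / (j:ℝ)) := Real.rpow_pos_of_pos hl0 _
      calc _ ≤ (volume (Metric.ball (0 : EuclideanSpace ℝ (Fin 4)) (l ^ (1 / (j:ℝ))))) ^ ((1:ℝ)/2) :=
            ENNReal.rpow_le_rpow (measure_mono hsub) (by norm_num)
        _ = _ := by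
          rw [Measure.addHaar_ball _ _ hp.le, ← hV, ENNReal.mul_rpow_of_nonneg _ _ (by norm_num),
            mul_comm, ENNReal.ofReal_rpow_of_pos (by positivity)]
          congr 2
          rw [finrank_euclideanSpace_fin, ← Real.rpow_natCast, ← Real.rpow_mul hl0.le,
            ← Real.rpow_mul hl0.le]
          congr 1
          push_cast
          ring
    · have : {x : EuclideanSpace ℝ (Fin 4) |
        x ∈ {x : EuclideanSpace ℝ (Fin 4) | R < ‖x‖ ∧ ‖x‖ < 1 / 2} ∧ l < |‖x‖ ^ j|} = ∅ := by
        rw [Set.eq_empty_iff_forall_notMem]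
        rintro x ⟨⟨h1, h2⟩, h3⟩
        have hx : 0 < ‖x‖ := hR.trans h1
        rw [abs_of_pos (zpow_pos hx j)] at h3
        apply hlA
        refine h3.le.trans ?_
        rw [← Real.rpow_intCast, ← Real.rpow_intCast]
        exact (Real.rpow_lt_rpow_of_neg hR h1 hj0).le
      rw [this]
      simp
  have hint : IntervalIntegrable (fun l : ℝ => l ^ (2 / (j:ℝ))) volume 0 (R ^ j) :=
    intervalIntegral.intervalIntegrable_rpow' (by linarith)
  calc _ ≤ ∫⁻ l in Set.Ioi (0:ℝ), (Set.Ioc 0 (R ^ j)).indicator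
          (fun l => V ^ ((1:ℝ)/2) * ENNReal.ofReal (l ^ (2 / (j:ℝ)))) l :=
        setLIntegral_mono' measurableSet_Ioi key
    _ ≤ ∫⁻ l, (Set.Ioc 0 (R ^ j)).indicator
          (fun l => V ^ ((1:ℝ)/2) * ENNReal.ofReal (l ^ (2 / (j:ℝ)))) l :=
        setLIntegral_le_lintegral _ _
    _ = V ^ ((1:ℝ)/2) * ∫⁻ l in Set.Ioc 0 (R ^ j), ENNReal.ofReal (l ^ (2 / (j:ℝ))) := by
        rw [lintegral_indicator measurableSet_Ioc, lintegral_const_mul]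
        fun_prop
    _ ≤ _ := by
        gcongr
        rw [← ofReal_integral_eq_lintegral_ofReal]
        · apply ENNReal.ofReal_le_ofReal
          rw [← intervalIntegral.integral_of_le hA.le, integral_rpow (Or.inl (by linarith)),
            Real.zero_rpow (by linarith), sub_zero]
          have e : (R ^ j) ^ (2 / (j:ℝ) + 1) = R ^ (j + 2) := by
            rw [← Real.rpow_intCast, ← Real.rpow_intCast, ← Real.rpow_mul hR.le]
            congr 1
            have := hj0.ne
            push_cast
            field_simp
            ring
          rw [e, div_le_iff₀ (by linarith)]
          have : 0 < R ^ (j + 2) := zpow_pos hR _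
          nlinarith
        · exact (intervalIntegrable_iff_integrableOn_Ioc_of_le hA.le).1 hint
        · filter_upwards [ae_restrict_mem measurableSet_Ioc] with l hl
          exact Real.rpow_nonneg hl.1.le _

theorem aux_pos (V : ℝ≥0∞) (hV : V = volume (Metric.ball (0 : EuclideanSpace ℝ (Fin 4)) 1))
    (R : ℝ) (hR : 0 < R) (j : ℤ) (hj : 0 ≤ j) :
    Lam {x : EuclideanSpace ℝ (Fin 4) | R < ‖x‖ ∧ ‖x‖ < 1 / 2} (fun x => ‖x‖ ^ j) ≤
      V ^ ((1:ℝ)/2) * ENNReal.ofReal ((2 : ℝ) ^ (-(3 * (j : ℝ)) / 4)) := by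
  obtain ⟨n, rfl⟩ := Int.eq_ofNat_of_zero_le hj
  have key : ∀ l ∈ Set.Ioi (0:ℝ),
      (volume {x : EuclideanSpace ℝ (Fin 4) |
        x ∈ {x : EuclideanSpace ℝ (Fin 4) | R < ‖x‖ ∧ ‖x‖ < 1 / 2} ∧ l < |‖x‖ ^ (n:ℤ)|}) ^ ((1 : ℝ) / 2)
      ≤ (Set.Ioc 0 ((1/2:ℝ) ^ n)).indicator (fun _ => V ^ ((1:ℝ)/2)) l := by
    intro l hl
    have hl0 : 0 < l := hl
    by_cases hlA : l ≤ (1/2:ℝ) ^ n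
    · rw [Set.indicator_of_mem (show l ∈ Set.Ioc 0 ((1/2:ℝ) ^ n) from ⟨hl0, hlA⟩), hV]
      refine ENNReal.rpow_le_rpow (measure_mono ?_) (by norm_num)
      rintro x ⟨⟨h1, h2⟩, h3⟩
      rw [mem_ball_zero_iff]
      linarith
    · have : {x : EuclideanSpace ℝ (Fin 4) |
        x ∈ {x : EuclideanSpace ℝ (Fin 4) | R < ‖x‖ ∧ ‖x‖ < 1 / 2} ∧ l < |‖x‖ ^ (n:ℤ)|} = ∅ := by
        rw [Set.eq_empty_iff_forall_notMem]
        rintro x ⟨⟨h1, h2⟩, h3⟩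
        rw [zpow_natCast, abs_of_nonneg (by positivity)] at h3
        exact hlA (h3.le.trans (pow_le_pow_left₀ (norm_nonneg _) h2.le n))
      rw [this]
      simp
  calc _ ≤ ∫⁻ l in Set.Ioi (0:ℝ), (Set.Ioc 0 ((1/2:ℝ) ^ n)).indicator (fun _ => V ^ ((1:ℝ)/2)) l :=
        setLIntegral_mono' measurableSet_Ioi key
    _ ≤ ∫⁻ l, (Set.Ioc 0 ((1/2:ℝ) ^ n)).indicator (fun _ => V ^ ((1:ℝ)/2)) l :=
        setLIntegral_le_lintegral _ _
    _ = V ^ ((1:ℝ)/2) * ENNReal.ofReal ((1/2:ℝ) ^ n) := by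
        rw [lintegral_indicator measurableSet_Ioc, setLIntegral_const, Real.volume_Ioc, sub_zero]
    _ ≤ _ := by
        gcongr
        have : ((1/2:ℝ)) ^ n = (2:ℝ) ^ (-(n:ℝ)) := by
          rw [Real.rpow_neg (by norm_num), Real.rpow_natCast]; simp
        rw [this]
        apply Real.rpow_le_rpow_of_exponent_le (by norm_num)
        have : (0:ℝ) ≤ n := Nat.cast_nonneg n
        push_cast
        linarith

theorem power_L21_annulus_estimate :
    ∃ c : ℝ, 0 < c ∧
      ∀ (r : ℝ), r ∈ Set.Ioo (0 : ℝ) (1 / 8) →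
      ∀ j : ℤ,
        (j ≤ -3 →
          Lam {x : EuclideanSpace ℝ (Fin 4) | 2 * r < ‖x‖ ∧ ‖x‖ < 1 / 2}
              (fun x => ‖x‖ ^ j) ≤
            ENNReal.ofReal (c * (2 * r) ^ (j + 2))) ∧
        (0 ≤ j →
          Lam {x : EuclideanSpace ℝ (Fin 4) | 2 * r < ‖x‖ ∧ ‖x‖ < 1 / 2}
              (fun x => ‖x‖ ^ j) ≤
            ENNReal.ofReal (c * (2 : ℝ) ^ (-(3 * (j : ℝ)) / 4))) := by
  obtain ⟨V, hV⟩ : ∃ V, V = volume (Metric.ball (0 : EuclideanSpace ℝ (Fin 4)) 1) := ⟨_, rfl⟩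
  have hVt : V ^ ((1:ℝ)/2) ≠ ∞ := by
    rw [hV]
    exact ENNReal.rpow_ne_top_of_nonneg (by norm_num) measure_ball_lt_top.ne
  obtain ⟨W, hW⟩ : ∃ W, W = (V ^ ((1:ℝ)/2)).toReal := ⟨_, rfl⟩
  have hW0 : 0 ≤ W := hW ▸ ENNReal.toReal_nonneg
  have hVW : V ^ ((1:ℝ)/2) = ENNReal.ofReal W := by rw [hW, ENNReal.ofReal_toReal hVt]
  refine ⟨3 * W + 1, by positivity, fun r hr j => ⟨fun hj => ?_, fun hj => ?_⟩⟩
  · have hR : 0 < 2 * r := by linarith [hr.1]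
    refine (aux_neg V hV _ hR j hj).trans ?_
    rw [hVW, ← ENNReal.ofReal_mul hW0]
    apply ENNReal.ofReal_le_ofReal
    have : 0 < (2 * r) ^ (j + 2) := zpow_pos hR _
    nlinarith
  · have hR : 0 < 2 * r := by linarith [hr.1]
    refine (aux_pos V hV _ hR j hj).trans ?_
    rw [hVW, ← ENNReal.ofReal_mul hW0]
    apply ENNReal.ofReal_le_ofReal
    have : 0 < (2 : ℝ) ^ (-(3 * (j : ℝ)) / 4) := by positivity
    nlinarith
end
end
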